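/- Let H be a semisimple and cosemisimple Hopf algebra over an algebraically closed field K (of arbitrary characteristic). If H has a nontrivial self-dual simple module, then the dimension of H is even. -/

import Mathlib

open HopfAlgebra Module

/-- The trivial one-dimensional `H`-module: `H` acts on the base field `K`
through the counit `ε`, i.e. `h • c = ε(h) * c`. -/
noncomputable local instance trivialHModule {K H : Type*} [CommSemiring K] [Semiring H]
    [Bialgebra K H] : Module H K :=
  Module.compHom K (Bialgebra.counitAlgHom K H).toRingHom

section
open HopfAlgebra Module Coalgebra
open scoped TensorProduct
namespace SDE

section alg
variable {K A : Type*} [Field K] [Ring A] [Algebra K A]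

lemma exists_left_int [IsSemisimpleRing A] (ε : A →ₐ[K] K) :
    ∃ e : A, ε e = 1 ∧ ∀ a, a * e = ε a • e := by
  obtain ⟨J, hJ⟩ := exists_isCompl (RingHom.ker ε : Submodule A A)
  have htop : (1 : A) ∈ (RingHom.ker ε : Submodule A A) ⊔ J := by rw [hJ.sup_eq_top]; trivial
  obtain ⟨k, hk, e, he, hke⟩ := Submodule.mem_sup.1 htop
  have hk' : ε k = 0 := hk
  refine ⟨e, ?_, fun a => ?_⟩
  · have := congrArg ε hke
    simpa [hk'] using this
  · have h1 : ε e = 1 := by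
      have := congrArg ε hke
      simpa [hk'] using this
    have hm : a * e - ε a • e ∈ J := by
      refine J.sub_mem (J.smul_mem a he) ?_
      rw [Algebra.smul_def]
      exact J.smul_mem _ he
    have hm2 : a * e - ε a • e ∈ (RingHom.ker ε : Submodule A A) := by
      change ε _ = 0
      simp [h1]
    have := Submodule.mem_bot A |>.1 (hJ.inf_eq_bot ▸ Submodule.mem_inf.2 ⟨hm2, hm⟩)
    exact sub_eq_zero.1 this

lemma exists_int [IsSemisimpleRing A] (ε : A →ₐ[K] K) :
    ∃ e : A, ε e = 1 ∧ (∀ a, a * e = ε a • e) ∧ (∀ a, e * a = ε a • e) := by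
  obtain ⟨e, he, hl⟩ := exists_left_int ε
  obtain ⟨f, hf, hr⟩ := exists_left_int (A := Aᵐᵒᵖ)
    (AlgHom.fromOpposite ε (fun x y => mul_comm (ε x) (ε y)))
  have hf' : ε f.unop = 1 := hf
  have hr' : ∀ a, f.unop * a = ε a • f.unop := fun a => by
    have := congrArg MulOpposite.unop (hr (MulOpposite.op a))
    exact this
  have h : f.unop = e := by
    have h1 := hl f.unop
    rw [hr' e, he, hf', one_smul, one_smul] at h1
    exact h1
  exact ⟨e, he, hl, fun a => by rw [← h]; exact hr' a⟩
end alg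

section hopf
variable {K H : Type*} [Field K] [Ring H] [HopfAlgebra K H]

local notation "𝒮" => antipode K (A := H)

/-- right coregular operator `x ↦ x₁ f(x₂)` -/
noncomputable def Rop (f : Dual K H) : H →ₗ[K] H :=
  (TensorProduct.rid K H).toLinearMap ∘ₗ LinearMap.lTensor H f ∘ₗ comul

lemma Rop_repr (f : Dual K H) {x : H} {ι : Type*} (r : Coalgebra.Repr K x ι) :
    Rop f x = ∑ i ∈ r.index, f (r.right i) • r.left i := by
  simp [Rop, ← r.eq, map_sum]

lemma Rop_counit : Rop (counit : Dual K H) = LinearMap.id := by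
  ext x; simp [Rop]

lemma counit_Rop (f : Dual K H) (x : H) : counit (R := K) (Rop f x) = f x := by
  rw [Rop_repr f (ℛ K x), map_sum]
  conv_rhs => rw [← sum_counit_smul (ℛ K x)]
  simp [mul_comm]

lemma Rop_comp (f g : Dual K H) : Rop f ∘ₗ Rop g = Rop (f ∘ₗ Rop g) := by
  let T : H ⊗[K] (H ⊗[K] H) →ₗ[K] H := (TensorProduct.rid K H).toLinearMap ∘ₗ LinearMap.lTensor H
     (LinearMap.mul' K K ∘ₗ TensorProduct.map f g)
  ext x
  have e1 : Rop f (Rop g x) = T (TensorProduct.assoc K H H H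
      (LinearMap.rTensor H comul (comul x))) := by
    rw [Rop_repr g (ℛ K x), map_sum, ← (ℛ K x).eq]
    simp only [map_sum, LinearMap.rTensor_tmul]
    refine Finset.sum_congr rfl fun i _ => ?_
    rw [map_smul, Rop_repr f (ℛ K ((ℛ K x).left i)), ← (ℛ K ((ℛ K x).left i)).eq]
    simp [T, map_sum, TensorProduct.sum_tmul, Finset.smul_sum, smul_smul, mul_comm]
  have e2 : Rop (f ∘ₗ Rop g) x = T (LinearMap.lTensor H comul (comul x)) := by
    rw [Rop_repr _ (ℛ K x), ← (ℛ K x).eq]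
    simp only [map_sum, LinearMap.lTensor_tmul]
    refine Finset.sum_congr rfl fun i _ => ?_
    rw [LinearMap.comp_apply, Rop_repr g (ℛ K ((ℛ K x).right i)), ← (ℛ K ((ℛ K x).right i)).eq]
    simp [T, map_sum, TensorProduct.tmul_sum, Finset.sum_smul, mul_comm]
  rw [LinearMap.comp_apply, e1, e2, coassoc_apply]

lemma sum_smul_counit {h : H} {ι : Type*} (r : Coalgebra.Repr K h ι) :
    ∑ i ∈ r.index, counit (R := K) (r.right i) • r.left i = h := by
  rw [← Rop_repr, Rop_counit, LinearMap.id_apply]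

lemma A1 {h : H} {ι : Type*} (r : Coalgebra.Repr K h ι) :
    ∑ i ∈ r.index, (𝒮 (r.left i) ⊗ₜ[K] (1 : H)) * comul (r.right i) = 1 ⊗ₜ h := by
  let P : H ⊗[K] (H ⊗[K] H) →ₗ[K] H ⊗[K] H :=
    LinearMap.rTensor H (LinearMap.mul' K H ∘ₗ LinearMap.rTensor H 𝒮) ∘ₗ
      (TensorProduct.assoc K H H H).symm.toLinearMap
  have h1 : ∑ i ∈ r.index, (𝒮 (r.left i) ⊗ₜ[K] (1 : H)) * comul (r.right i)
      = P (LinearMap.lTensor H comul (comul h)) := by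
    rw [← r.eq]
    simp only [map_sum, LinearMap.lTensor_tmul]
    refine Finset.sum_congr rfl fun i _ => ?_
    rw [← (ℛ K (r.right i)).eq]
    simp [P, TensorProduct.tmul_sum, Finset.mul_sum]
  rw [h1, ← coassoc_apply, ← r.eq]
  simp only [map_sum, LinearMap.rTensor_tmul, P, LinearMap.comp_apply, LinearEquiv.coe_coe,
    LinearEquiv.symm_apply_apply, mul_antipode_rTensor_comul_apply, Algebra.algebraMap_eq_smul_one]
  simp only [TensorProduct.smul_tmul]
  rw [← TensorProduct.tmul_sum, sum_counit_smul]

lemma A2 {h : H} {ι : Type*} (r : Coalgebra.Repr K h ι) :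
    ∑ i ∈ r.index, comul (r.left i) * ((1 : H) ⊗ₜ[K] 𝒮 (r.right i)) = h ⊗ₜ 1 := by
  let P : (H ⊗[K] H) ⊗[K] H →ₗ[K] H ⊗[K] H :=
    LinearMap.lTensor H (LinearMap.mul' K H ∘ₗ LinearMap.lTensor H 𝒮) ∘ₗ
      (TensorProduct.assoc K H H H).toLinearMap
  have h1 : ∑ i ∈ r.index, comul (r.left i) * ((1 : H) ⊗ₜ[K] 𝒮 (r.right i))
      = P (LinearMap.rTensor H comul (comul h)) := by
    rw [← r.eq]
    simp only [map_sum, LinearMap.rTensor_tmul]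
    refine Finset.sum_congr rfl fun i _ => ?_
    rw [← (ℛ K (r.left i)).eq]
    simp [P, TensorProduct.sum_tmul, Finset.sum_mul]
  rw [h1]
  simp only [P, LinearMap.comp_apply, LinearEquiv.coe_coe]
  rw [coassoc_apply, ← r.eq]
  simp only [map_sum, LinearMap.lTensor_tmul, LinearMap.comp_apply,
    mul_antipode_lTensor_comul_apply, Algebra.algebraMap_eq_smul_one]
  simp only [← TensorProduct.smul_tmul]
  rw [← TensorProduct.sum_tmul, sum_smul_counit]

/-- `x₁ 𝒮(x₂) ⊗ x₃ = 1 ⊗ x`. -/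
lemma A3 (x : H) : LinearMap.rTensor H (LinearMap.mul' K H ∘ₗ LinearMap.lTensor H 𝒮 ∘ₗ comul)
     (comul x) = 1 ⊗ₜ x := by
  rw [← (ℛ K x).eq]
  simp only [map_sum, LinearMap.rTensor_tmul, LinearMap.comp_apply,
    mul_antipode_lTensor_comul_apply, Algebra.algebraMap_eq_smul_one, TensorProduct.smul_tmul]
  rw [← TensorProduct.tmul_sum, sum_counit_smul]

end hopf
end SDE
end

section
open HopfAlgebra Module Coalgebra
open scoped TensorProduct
namespace SDE
section hopf
variable {K H : Type*} [Field K] [Ring H] [HopfAlgebra K H]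

local notation "𝒮" => antipode K (A := H)

lemma coassoc3 {M : Type*} [AddCommGroup M] [Module K M] (T : H ⊗[K] (H ⊗[K] H) →ₗ[K] M) (x : H) :
    ∑ i ∈ (ℛ K x).index, ∑ j ∈ (ℛ K ((ℛ K x).left i)).index,
      T ((ℛ K ((ℛ K x).left i)).left j ⊗ₜ ((ℛ K ((ℛ K x).left i)).right j ⊗ₜ (ℛ K x).right i)) =
    ∑ i ∈ (ℛ K x).index, ∑ j ∈ (ℛ K ((ℛ K x).right i)).index,
      T ((ℛ K x).left i ⊗ₜ ((ℛ K ((ℛ K x).right i)).left j ⊗ₜ (ℛ K ((ℛ K x).right i)).right j)) := by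
  have := congrArg T (sum_tmul_tmul_eq (ℛ K x) (fun i => ℛ K ((ℛ K x).left i))
    (fun i => ℛ K ((ℛ K x).right i)))
  simpa only [map_sum] using this

lemma comul_antipode (x : H) : comul (R := K) (𝒮 x) =
    TensorProduct.map 𝒮 𝒮 (TensorProduct.comm K H H (comul x)) := by
  have key : WithConv.toConv ((TensorProduct.map 𝒮 𝒮) ∘ₗ (TensorProduct.comm K H H).toLinearMap
      ∘ₗ comul) * WithConv.toConv (comul (R := K) (A := H)) = 1 := by
    apply WithConv.ofConv_injective
    ext x
    change _ = (1 : WithConv (H →ₗ[K] H ⊗[K] H)) x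
    rw [LinearMap.convOne_apply]
    change (_ * _ : WithConv (H →ₗ[K] H ⊗[K] H)) x = _
    rw [(ℛ K x).convMul_apply]
    let T : H ⊗[K] (H ⊗[K] H) →ₗ[K] H ⊗[K] H :=
      LinearMap.mul' K (H ⊗[K] H) ∘ₗ TensorProduct.map
        (Algebra.TensorProduct.includeRight.toLinearMap ∘ₗ 𝒮)
        (LinearMap.mul' K (H ⊗[K] H) ∘ₗ TensorProduct.map
          ((Algebra.TensorProduct.includeLeft (R := K) (S := K) (A := H) (B := H)).toLinearMap ∘ₗ 𝒮)
            comul)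
    have hT : ∀ a b c : H, T (a ⊗ₜ (b ⊗ₜ c)) = ((1 : H) ⊗ₜ 𝒮 a) * ((𝒮 b ⊗ₜ (1 : H)) * comul c) := by
      intro a b c; simp [T]
    have := coassoc3 T x
    simp only [hT] at this
    simp only [← Finset.mul_sum, A1] at this
    calc _ = _ := ?_
      _ = _ := this
      _ = _ := ?_
    · refine Finset.sum_congr rfl fun i _ => ?_
      change TensorProduct.map 𝒮 𝒮 (TensorProduct.comm K H H (comul ((ℛ K x).left i))) *
        comul ((ℛ K x).right i) = _
      rw [← (ℛ K ((ℛ K x).left i)).eq]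
      simp only [map_sum, TensorProduct.comm_tmul, TensorProduct.map_tmul, Finset.sum_mul]
      refine Finset.sum_congr rfl fun j _ => ?_
      rw [← mul_assoc]
      simp
    · simp only [Algebra.TensorProduct.tmul_mul_tmul, one_mul]
      rw [← TensorProduct.tmul_sum, sum_antipode_mul_eq_smul]
      simp [Algebra.TensorProduct.algebraMap_apply, Algebra.algebraMap_eq_smul_one,
        TensorProduct.smul_tmul, Algebra.TensorProduct.one_def]
  have := left_inv_eq_right_inv key (LinearMap.comul_right_inv (R := K) (C := H))
  have := congrArg WithConv.ofConv this
  have := LinearMap.congr_fun this x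
  exact this.symm

lemma comul_antipode_sq (x : H) : comul (R := K) (𝒮 (𝒮 x)) =
    TensorProduct.map (𝒮 ∘ₗ 𝒮) (𝒮 ∘ₗ 𝒮) (comul x) := by
  rw [comul_antipode, comul_antipode, ← (ℛ K x).eq]
  simp [map_sum]

lemma Rop_antipode_sq (f : Dual K H) (x : H) : Rop f (𝒮 (𝒮 x)) = 𝒮 (𝒮 (Rop (f ∘ₗ 𝒮 ∘ₗ 𝒮) x)) := by
  simp only [Rop, LinearMap.comp_apply, comul_antipode_sq]
  rw [← (ℛ K x).eq]
  simp [map_sum]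

lemma antipode_sq_mul (x y : H) : 𝒮 (𝒮 (x * y)) = 𝒮 (𝒮 x) * 𝒮 (𝒮 y) := by
  simp [antipode_mul_antidistrib]

/-- `Λ` is a two-sided normalized integral. -/
structure IsInt (Λ : H) : Prop where
  eps : counit (R := K) Λ = 1
  left : ∀ h : H, h * Λ = counit (R := K) h • Λ
  right : ∀ h : H, Λ * h = counit (R := K) h • Λ

/-- `lam` is a two-sided normalized integral on `H`. -/
structure IsCoint (lam : Dual K H) : Prop where
  one : lam 1 = 1
  left : ∀ x : H, Rop lam x = lam x • (1 : H)
  right : ∀ x : H, TensorProduct.lid K H (LinearMap.rTensor H lam (comul x)) = lam x • (1 : H)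

lemma IsInt.X1 {Λ : H} (hΛ : IsInt (K := K) Λ) (h : H) :
    ((1 : H) ⊗ₜ[K] h) * comul Λ = (𝒮 h ⊗ₜ[K] (1 : H)) * comul Λ := by
  rw [← A1 (ℛ K h), Finset.sum_mul]
  simp only [mul_assoc, ← Bialgebra.comul_mul, hΛ.left, map_smul, mul_smul_comm]
  conv_rhs => rw [← sum_smul_counit (ℛ K h)]
  simp only [map_sum, TensorProduct.sum_tmul, Finset.sum_mul, map_smul, ← TensorProduct.smul_tmul',
    smul_mul_assoc]

lemma IsInt.X2 {Λ : H} (hΛ : IsInt (K := K) Λ) (h : H) :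
    comul Λ * (h ⊗ₜ[K] (1 : H)) = comul Λ * ((1 : H) ⊗ₜ[K] 𝒮 h) := by
  rw [← A2 (ℛ K h), Finset.mul_sum]
  simp only [← mul_assoc, ← Bialgebra.comul_mul, hΛ.right, map_smul, smul_mul_assoc]
  conv_rhs => rw [← sum_counit_smul (ℛ K h)]
  simp only [map_sum, TensorProduct.tmul_sum, Finset.mul_sum, map_smul, TensorProduct.tmul_smul,
    mul_smul_comm]

section Y
variable {Λ : H} {lam : Dual K H} (hΛ : IsInt (K := K) Λ) (hl : IsCoint lam)
include hΛ hl

lemma Y1 (h : H) : ∑ i ∈ (ℛ K Λ).index, lam (h * (ℛ K Λ).right i) • (ℛ K Λ).left i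
    = lam Λ • 𝒮 h := by
  have := congrArg (TensorProduct.rid K H ∘ LinearMap.lTensor H lam) (hΛ.X1 h)
  rw [← (ℛ K Λ).eq] at this
  simp [Finset.mul_sum, map_sum] at this
  rw [this]
  have h2 := hl.left Λ
  rw [Rop_repr lam (ℛ K Λ)] at h2
  have h3 := congrArg (fun z => 𝒮 h * z) h2
  simpa [Finset.mul_sum] using h3

lemma Y2 (h : H) : ∑ i ∈ (ℛ K Λ).index, lam ((ℛ K Λ).right i * 𝒮 h) • (ℛ K Λ).left i
    = lam Λ • h := by
  have := congrArg (TensorProduct.rid K H ∘ LinearMap.lTensor H lam) (hΛ.X2 h)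
  rw [← (ℛ K Λ).eq] at this
  simp [Finset.sum_mul, map_sum] at this
  rw [← this]
  have h2 := hl.left Λ
  rw [Rop_repr lam (ℛ K Λ)] at h2
  have h3 := congrArg (fun z => z * h) h2
  simpa [Finset.sum_mul] using h3

lemma lamL : ∑ i ∈ (ℛ K Λ).index, lam ((ℛ K Λ).left i) • (ℛ K Λ).right i = lam Λ • (1 : H) := by
  rw [← hl.right Λ]
  conv_rhs => rw [← (ℛ K Λ).eq]
  simp [map_sum]

lemma Y3 (h : H) : ∑ i ∈ (ℛ K Λ).index, lam (𝒮 h * (ℛ K Λ).left i) • (ℛ K Λ).right i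
    = lam Λ • h := by
  have := congrArg (TensorProduct.lid K H ∘ LinearMap.rTensor H lam) (hΛ.X1 h)
  rw [← (ℛ K Λ).eq] at this
  simp [Finset.mul_sum, map_sum] at this
  rw [← this]
  have h3 := congrArg (fun z => h * z) (lamL hΛ hl)
  simpa [Finset.mul_sum] using h3

lemma Y4 (h : H) : ∑ i ∈ (ℛ K Λ).index, lam ((ℛ K Λ).left i * h) • (ℛ K Λ).right i
    = lam Λ • 𝒮 h := by
  have := congrArg (TensorProduct.lid K H ∘ LinearMap.rTensor H lam) (hΛ.X2 h)
  rw [← (ℛ K Λ).eq] at this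
  simp [Finset.sum_mul, map_sum] at this
  rw [this]
  have h3 := congrArg (fun z => z * 𝒮 h) (lamL hΛ hl)
  simpa [Finset.sum_mul] using h3

end Y
end hopf
end SDE
end

section
open HopfAlgebra Module Coalgebra
open scoped TensorProduct
namespace SDE
section hopf
variable {K H : Type*} [Field K] [Ring H] [HopfAlgebra K H] [FiniteDimensional K H]

local notation "𝒮" => antipode K (A := H)

lemma trace_rank_one {ι : Type*} (s : Finset ι) (φ : ι → Dual K H) (a : ι → H) (T : H →ₗ[K] H)
    (hT : ∀ x, T x = ∑ i ∈ s, φ i x • a i) :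
    LinearMap.trace K H T = ∑ i ∈ s, φ i (a i) := by
  have : T = ∑ i ∈ s, (φ i).smulRight (a i) := by
    ext x; simp [hT]
  rw [this, map_sum]
  simp

section Y
variable {Λ : H} {lam : Dual K H} (hΛ : IsInt (K := K) Λ) (hl : IsCoint lam)
include hΛ hl

lemma ell_trace : lam Λ * LinearMap.trace K H (𝒮 ∘ₗ 𝒮) = 1 := by
  rw [← smul_eq_mul, ← map_smul]
  rw [trace_rank_one (ℛ K Λ).index
    (fun i => lam ∘ₗ LinearMap.mulRight K ((ℛ K Λ).right i) ∘ₗ 𝒮) (fun i => (ℛ K Λ).left i)]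
  · simp only [LinearMap.comp_apply, LinearMap.mulRight_apply]
    rw [← map_sum, sum_antipode_mul_eq_smul, map_smul, hΛ.eps, hl.one, one_smul]
  · intro x
    simp only [LinearMap.smul_apply, LinearMap.comp_apply, LinearMap.mulRight_apply]
    rw [Y1 hΛ hl]

lemma ell_ne : lam Λ ≠ 0 := left_ne_zero_of_mul_eq_one (ell_trace hΛ hl)

lemma antipode_inj : Function.Injective 𝒮 := by
  rw [injective_iff_map_eq_zero]
  intro h hh
  have := Y2 hΛ hl h
  simp only [hh, mul_zero, map_zero, zero_smul, Finset.sum_const_zero] at this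
  exact (smul_eq_zero.1 this.symm).resolve_left (ell_ne hΛ hl)

lemma antipode_surj : Function.Surjective 𝒮 :=
  LinearMap.surjective_of_injective (antipode_inj hΛ hl)

lemma lam_nak (h y : H) : lam (h * y) = lam (y * 𝒮 (𝒮 h)) := by
  obtain ⟨k, rfl⟩ := antipode_surj hΛ hl y
  have e1 := Y1 hΛ hl h
  rw [← Y2 hΛ hl (𝒮 h)] at e1
  have e2 := congrArg (fun z => lam (z * k)) e1
  have e4 := Y4 hΛ hl k
  have f1 := congrArg (fun z => lam (h * z)) e4
  have f2 := congrArg (fun z => lam (z * 𝒮 (𝒮 h))) e4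
  simp only [Finset.sum_mul, Finset.mul_sum, map_sum, smul_mul_assoc, mul_smul_comm, map_smul,
    smul_eq_mul] at e2 f1 f2
  apply mul_left_cancel₀ (ell_ne hΛ hl)
  rw [← f1, ← f2]
  rw [Finset.sum_congr rfl (fun i _ => mul_comm _ _), e2]
  exact Finset.sum_congr rfl (fun i _ => mul_comm _ _)

lemma lam_nak' (h y : H) : lam (𝒮 (𝒮 h) * y) = lam (y * h) := by
  obtain ⟨k, rfl⟩ := antipode_surj hΛ hl y
  have e1 := Y3 hΛ hl (𝒮 h)
  rw [← Y4 hΛ hl h] at e1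
  have e2 := congrArg (fun z => lam (k * z)) e1
  have e4 := Y1 hΛ hl k
  have f1 := congrArg (fun z => lam (𝒮 (𝒮 h) * z)) e4
  have f2 := congrArg (fun z => lam (z * h)) e4
  simp only [Finset.sum_mul, Finset.mul_sum, map_sum, smul_mul_assoc, mul_smul_comm, map_smul,
    smul_eq_mul] at e2 f1 f2
  apply mul_left_cancel₀ (ell_ne hΛ hl)
  rw [← f1, ← f2]
  rw [Finset.sum_congr rfl (fun i _ => mul_comm _ _), e2]
  exact Finset.sum_congr rfl (fun i _ => mul_comm _ _)

lemma lam_nondeg (h : H) (hh : ∀ y, lam (h * y) = 0) : h = 0 := by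
  have := Y1 hΛ hl h
  simp only [hh, zero_smul, Finset.sum_const_zero] at this
  have := (smul_eq_zero.1 this.symm).resolve_left (ell_ne hΛ hl)
  exact antipode_inj hΛ hl (by rw [this, map_zero])

lemma antipode_four (h : H) : 𝒮 (𝒮 (𝒮 (𝒮 h))) = h := by
  rw [← sub_eq_zero]
  apply lam_nondeg hΛ hl
  intro y
  rw [sub_mul, map_sub, lam_nak' hΛ hl, lam_nak hΛ hl h, sub_self]

lemma trace_Rop (f : Dual K H) :
    lam Λ * LinearMap.trace K H (𝒮 ∘ₗ 𝒮 ∘ₗ Rop f) = f Λ := by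
  rw [← smul_eq_mul, ← map_smul]
  rw [trace_rank_one (ℛ K Λ).index
    (fun i => lam ∘ₗ LinearMap.mulLeft K ((ℛ K Λ).left i) ∘ₗ 𝒮 ∘ₗ Rop f)
      (fun i => (ℛ K Λ).right i)]
  · simp only [LinearMap.comp_apply, LinearMap.mulLeft_apply]
    let T : H ⊗[K] (H ⊗[K] H) →ₗ[K] K :=
      LinearMap.mul' K K ∘ₗ TensorProduct.map (lam ∘ₗ LinearMap.mul' K H ∘ₗ LinearMap.lTensor H 𝒮) f
        ∘ₗ (TensorProduct.assoc K H H H).symm.toLinearMap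
    have hT : ∀ a b c : H, T (a ⊗ₜ (b ⊗ₜ c)) = lam (a * 𝒮 b) * f c := by
      intro a b c; simp [T]
    have := coassoc3 T Λ
    simp only [hT] at this
    calc _ = _ := ?_
      _ = _ := this.symm
      _ = _ := ?_
    · refine Finset.sum_congr rfl fun i _ => ?_
      rw [Rop_repr f (ℛ K ((ℛ K Λ).right i))]
      simp [map_sum, Finset.mul_sum, mul_comm]
    · simp only [← Finset.sum_mul, ← map_sum]
      simp only [sum_mul_antipode_eq_smul, map_smul, hl.one, smul_eq_mul, mul_one]
      conv_rhs => rw [← sum_counit_smul (ℛ K Λ)]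
      simp
  · intro x
    simp only [LinearMap.smul_apply, LinearMap.comp_apply, LinearMap.mulLeft_apply]
    rw [Y4 hΛ hl]

end Y

section avg
variable {Λ : H} {lam : Dual K H} (hΛ : IsInt (K := K) Λ) (hl : IsCoint lam)

/-- averaging `x ↦ S(Λ₂) x Λ₁` -/
noncomputable def avg (Λ : H) : H →ₗ[K] H :=
  ∑ i ∈ (ℛ K Λ).index, LinearMap.mulLeft K (𝒮 ((ℛ K Λ).right i)) ∘ₗ
    LinearMap.mulRight K ((ℛ K Λ).left i)

include hΛ hl in
lemma avg_mul_comm (x y : H) : avg (K := K) Λ (x * y) = avg (K := K) Λ (y * x) := by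
  obtain ⟨k, rfl⟩ := antipode_surj hΛ hl y
  let T : H ⊗[K] H →ₗ[K] H := LinearMap.mul' K H ∘ₗ (TensorProduct.comm K H H).toLinearMap ∘ₗ
    TensorProduct.map (LinearMap.mulLeft K x) 𝒮
  have := congrArg T (hΛ.X1 k)
  rw [← (ℛ K Λ).eq] at this
  simp [T, Finset.mul_sum, map_sum, antipode_mul_antidistrib] at this
  simp [avg, mul_assoc] at this ⊢
  exact this.symm

include hΛ in
lemma avg_conv (g j : Dual K H) (hj : ∀ x y, j (x * y) = j (y * x)) :
    (g ∘ₗ avg (K := K) Λ) (Rop j Λ) = g (Rop j Λ) := by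
  have key : ∀ a b : H, ∑ i ∈ (ℛ K Λ).index, g (𝒮 b * (ℛ K Λ).left i * a) * j ((ℛ K Λ).right i)
      = ∑ i ∈ (ℛ K Λ).index, g ((ℛ K Λ).left i) * j (𝒮 a * b * (ℛ K Λ).right i) := by
    intro a b
    have h1 := congrArg (LinearMap.mul' K K ∘ₗ TensorProduct.map
       (g ∘ₗ LinearMap.mulLeft K (𝒮 b)) j) (hΛ.X2 a)
    have h2 := congrArg (LinearMap.mul' K K ∘ₗ TensorProduct.map
       g (j ∘ₗ LinearMap.mulRight K (𝒮 a))) (hΛ.X1 b)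
    rw [← (ℛ K Λ).eq] at h1 h2
    simp [Finset.sum_mul, Finset.mul_sum, map_sum] at h1 h2
    simp only [mul_assoc]
    rw [h1, ← h2]
    refine Finset.sum_congr rfl fun i _ => ?_
    rw [hj]
  rw [Rop_repr j (ℛ K Λ)]
  simp only [avg, map_sum, LinearMap.comp_apply, LinearMap.sum_apply, map_smul,
    LinearMap.mulLeft_apply, LinearMap.mulRight_apply, smul_eq_mul, Finset.mul_sum]
  rw [Finset.sum_comm]
  calc _ = ∑ k ∈ (ℛ K Λ).index, ∑ i ∈ (ℛ K Λ).index, g ((ℛ K Λ).left i) *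
        j (𝒮 ((ℛ K Λ).left k) * (ℛ K Λ).right k * (ℛ K Λ).right i) := by
          refine Finset.sum_congr rfl fun k _ => ?_
          rw [← key]
          refine Finset.sum_congr rfl fun i _ => ?_
          rw [mul_comm, mul_assoc]
    _ = _ := by
      rw [Finset.sum_comm]
      refine Finset.sum_congr rfl fun i _ => ?_
      rw [← Finset.mul_sum, ← map_sum, ← Finset.sum_mul, sum_antipode_mul_eq_smul, hΛ.eps,
        one_smul, one_mul, mul_comm]

end avg

section ss
variable {Λ : H} {lam : Dual K H} (hΛ : IsInt (K := K) Λ) (hl : IsCoint lam)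
include hΛ hl

lemma eq_zero_of_Rop (j : Dual K H) (h : Rop j Λ = 0) : j = 0 := by
  ext k
  rw [Rop_repr j (ℛ K Λ)] at h
  have h1 := congrArg (fun z => lam (𝒮 k * z)) h
  have h2 := congrArg j (Y3 hΛ hl k)
  simp only [Finset.mul_sum, map_sum, mul_smul_comm, map_smul, smul_eq_mul, mul_zero,
    map_zero] at h1 h2
  have : lam Λ * j k = 0 := by
    rw [← h2, ← h1]
    exact Finset.sum_congr rfl fun i _ => mul_comm _ _
  simpa [ell_ne hΛ hl] using this

theorem classAlg_semisimple {A : Type*} [Ring A] [Algebra K A] [FiniteDimensional K A]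
    (θ : A →ₗ[K] Dual K H) (hinj : Function.Injective θ) (h1 : θ 1 = counit)
    (hmul : ∀ a b, θ (a * b) = θ a ∘ₗ Rop (θ b))
    (htr : ∀ a x y, θ a (x * y) = θ a (y * x))
    (hsur : ∀ f : Dual K H, (∀ x y, f (x * y) = f (y * x)) → ∃ a, θ a = f)
    (hS : ∀ f : Dual K H, (∀ x y, f (x * y) = f (y * x)) → f ∘ₗ 𝒮 ∘ₗ 𝒮 = f) :
    IsSemisimpleRing A := by
  have hart : IsArtinianRing A := IsArtinianRing.of_finite K A
  rw [IsArtinianRing.isSemisimpleRing_iff_jacobson]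
  rw [eq_bot_iff]
  intro j hj
  have hR : ∀ a b, Rop (θ (a * b)) = Rop (θ a) * Rop (θ b) := fun a b => by
    rw [hmul, ← Rop_comp]; rfl
  have hRp : ∀ a (n : ℕ), Rop (θ (a ^ n)) = Rop (θ a) ^ n := by
    intro a n
    induction n with
    | zero => rw [pow_zero, pow_zero, h1, Rop_counit]; rfl
    | succ n ih => rw [pow_succ, hR, ih, pow_succ]
  have hnil : ∀ a : A, IsNilpotent (a * j) := by
    intro a
    obtain ⟨n, hn⟩ := IsSemiprimaryRing.isNilpotent (R := A)
    have hm : a * j ∈ Ring.jacobson A := Ideal.mul_mem_left _ a hj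
    refine ⟨n, ?_⟩
    have := Ideal.pow_mem_pow hm n
    rw [hn] at this
    simpa using this
  have hz : ∀ a : A, θ (a * j) Λ = 0 := by
    intro a
    rw [← trace_Rop hΛ hl, mul_eq_zero]
    right
    have hc : Commute ((𝒮 ∘ₗ 𝒮 : H →ₗ[K] H) : Module.End K H) (Rop (θ (a * j))) := by
      refine LinearMap.ext fun x => ?_
      change 𝒮 (𝒮 (Rop (θ (a * j)) x)) = Rop (θ (a * j)) (𝒮 (𝒮 x))
      rw [Rop_antipode_sq, hS _ (htr _)]
    have hn : IsNilpotent (Rop (θ (a * j)) : Module.End K H) := by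
      obtain ⟨n, hn⟩ := hnil a
      refine ⟨n, ?_⟩
      rw [← hRp, hn, map_zero]
      ext x; simp [Rop]
    have := hc.isNilpotent_mul_left hn
    exact (LinearMap.isNilpotent_trace_of_isNilpotent this).eq_zero
  have : θ j = 0 := by
    apply eq_zero_of_Rop hΛ hl
    by_contra hne
    have : ∀ g : Dual K H, g (Rop (θ j) Λ) = 0 := by
      intro g
      rw [← avg_conv hΛ g (θ j) (htr j)]
      obtain ⟨a, ha⟩ := hsur (g ∘ₗ avg Λ) (fun x y => by
        simp only [LinearMap.comp_apply, avg_mul_comm hΛ hl x y])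
      rw [← ha]
      have := hz a
      rwa [hmul] at this
    exact hne ((Module.forall_dual_apply_eq_zero_iff K _).1 this)
  rw [Submodule.mem_bot]
  exact hinj (by rw [this, map_zero])
end ss

end hopf
end SDE
end

section
open Module Matrix
open scoped Kronecker
namespace SDE

lemma sum_sigma_fin {ι M : Type*} [Fintype ι] [Semiring M] (c : ι → ℕ) (f : ι → M) :
    ∑ t : (Σ i, Fin (c i)), f t.1 = ∑ i, (c i : M) * f i := by
  rw [Fintype.sum_sigma]
  simp

section rank
variable {K : Type*} [Field K]

lemma exists_factor {n : Type*} [Fintype n] [DecidableEq n] (E : Matrix n n K) (hE : E * E = E) :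
    ∃ (U : Matrix n (Fin E.rank) K) (V : Matrix (Fin E.rank) n K), E = U * V ∧ V * U = 1 := by
  have hr : finrank K (LinearMap.range E.mulVecLin) = E.rank := rfl
  let b := (finBasisOfFinrankEq K _ hr).equivFun
  have hid : ∀ y : LinearMap.range E.mulVecLin, E.mulVecLin y = y := by
    rintro ⟨_, x, rfl⟩
    simp [Matrix.mulVec_mulVec, hE]
  refine ⟨LinearMap.toMatrix' ((LinearMap.range E.mulVecLin).subtype ∘ₗ b.symm.toLinearMap),
    LinearMap.toMatrix' (b.toLinearMap ∘ₗ E.mulVecLin.rangeRestrict), ?_, ?_⟩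
  · rw [← LinearMap.toMatrix'_comp]
    have : ((LinearMap.range E.mulVecLin).subtype ∘ₗ b.symm.toLinearMap) ∘ₗ
      (b.toLinearMap ∘ₗ E.mulVecLin.rangeRestrict) = Matrix.toLin' E := by
      ext x; simp
    rw [this, LinearMap.toMatrix'_toLin']
  · rw [← LinearMap.toMatrix'_comp]
    have : (b.toLinearMap ∘ₗ E.mulVecLin.rangeRestrict) ∘ₗ
      ((LinearMap.range E.mulVecLin).subtype ∘ₗ b.symm.toLinearMap) = LinearMap.id := by
      ext x : 1
      refine LinearMap.ext fun y => ?_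
      have : E.mulVecLin.rangeRestrict (b.symm (LinearMap.single K (fun _ => K) x y)) =
          b.symm (LinearMap.single K (fun _ => K) x y) := Subtype.ext (hid _)
      simp only [LinearMap.comp_apply, LinearEquiv.coe_coe, Submodule.subtype_apply, this,
        LinearEquiv.apply_symm_apply, LinearMap.id_apply]
    rw [this, LinearMap.toMatrix'_id]

lemma rank_of_factor {n m : Type*} [Fintype n] [DecidableEq n] [Fintype m] [DecidableEq m]
    {E : Matrix n n K} {U : Matrix n m K} {V : Matrix m n K} (h : E = U * V) (h' : V * U = 1) :
    E.rank = Fintype.card m := by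
  apply le_antisymm
  · rw [h]
    exact (Matrix.rank_mul_le_left U V).trans (Matrix.rank_le_card_width U)
  · have : V * E * U = 1 := by
      rw [h, Matrix.mul_assoc, Matrix.mul_assoc, h', Matrix.mul_one, h']
    calc Fintype.card m = (1 : Matrix m m K).rank := (Matrix.rank_one).symm
      _ = (V * E * U).rank := by rw [this]
      _ ≤ (V * E).rank := Matrix.rank_mul_le_left _ _
      _ ≤ E.rank := Matrix.rank_mul_le_right _ _

lemma trace_of_idem {n : Type*} [Fintype n] [DecidableEq n] (E : Matrix n n K) (hE : E * E = E) :
    E.trace = E.rank := by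
  obtain ⟨U, V, h, h'⟩ := exists_factor E hE
  conv_lhs => rw [h]
  rw [Matrix.trace_mul_comm, h']
  simp

/-- A decomposition of `K^X` into blocks. -/
structure Decomp (K : Type*) [Field K] (X : Type*) [Fintype X] [DecidableEq X]
    {T : Type*} [Fintype T] [DecidableEq T] (n : T → Type*)
    [∀ t, Fintype (n t)] [∀ t, DecidableEq (n t)] where
  W : ∀ t, Matrix X (n t) K
  W' : ∀ t, Matrix (n t) X K
  orth : ∀ t, W' t * W t = 1
  orth' : ∀ t s, t ≠ s → W' t * W s = 0
  sum : ∑ t, W t * W' t = 1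

section
variable {X : Type*} [Fintype X] [DecidableEq X]
    {T : Type*} [Fintype T] [DecidableEq T] {n : T → Type*}
    [∀ t, Fintype (n t)] [∀ t, DecidableEq (n t)] (D : Decomp K X n)

lemma Decomp.idem {Z : Matrix X X K} {Zt : ∀ t, Matrix (n t) (n t) K}
    (h : ∀ t, Z * D.W t = D.W t * Zt t) (hZ : Z * Z = Z) (t : T) : Zt t * Zt t = Zt t := by
  have h1 : Z * (Z * D.W t) = Z * D.W t := by rw [← Matrix.mul_assoc, hZ]
  rw [h, ← Matrix.mul_assoc, h, Matrix.mul_assoc] at h1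
  have := congrArg (D.W' t * ·) h1
  simpa only [← Matrix.mul_assoc, D.orth, Matrix.one_mul] using this

lemma Decomp.eq {Z : Matrix X X K} {Zt : ∀ t, Matrix (n t) (n t) K}
    (h : ∀ t, Z * D.W t = D.W t * Zt t) : Z = ∑ t, D.W t * Zt t * D.W' t := by
  conv_lhs => rw [← Matrix.mul_one Z, ← D.sum, Matrix.mul_sum]
  exact Finset.sum_congr rfl fun t _ => by rw [← Matrix.mul_assoc, h]

lemma Decomp.trace {Z : Matrix X X K} {Zt : ∀ t, Matrix (n t) (n t) K}
    (h : ∀ t, Z * D.W t = D.W t * Zt t) : Z.trace = ∑ t, (Zt t).trace := by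
  conv_lhs => rw [D.eq h, Matrix.trace_sum]
  refine Finset.sum_congr rfl fun t _ => ?_
  rw [Matrix.trace_mul_comm, ← Matrix.mul_assoc, D.orth, Matrix.one_mul]

lemma Decomp.rank {Z : Matrix X X K} {Zt : ∀ t, Matrix (n t) (n t) K}
    (h : ∀ t, Z * D.W t = D.W t * Zt t) (hZ : Z * Z = Z) : Z.rank = ∑ t, (Zt t).rank := by
  choose A B hAB hBA using fun t => exists_factor (Zt t) (D.idem h hZ t)
  let U : Matrix X (Σ t, Fin (Zt t).rank) K := Matrix.of fun x p => (D.W p.1 * A p.1) x p.2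
  let V : Matrix (Σ t, Fin (Zt t).rank) X K := Matrix.of fun p x => (B p.1 * D.W' p.1) p.2 x
  have h1 : Z = U * V := by
    conv_lhs => rw [D.eq h]
    ext x y
    rw [Matrix.mul_apply, Fintype.sum_sigma, Matrix.sum_apply]
    refine Finset.sum_congr rfl fun t _ => ?_
    conv_lhs => rw [hAB t, ← Matrix.mul_assoc, Matrix.mul_assoc (D.W t * A t), Matrix.mul_apply]
    rfl
  have h2 : V * U = 1 := by
    ext ⟨t, k⟩ ⟨s, l⟩
    have : (V * U) ⟨t, k⟩ ⟨s, l⟩ = ((B t * D.W' t) * (D.W s * A s)) k l := by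
      rw [Matrix.mul_apply, Matrix.mul_apply]; rfl
    rw [this, Matrix.mul_assoc, ← Matrix.mul_assoc (D.W' t)]
    by_cases hts : t = s
    · subst hts
      rw [D.orth, Matrix.one_mul, hBA]
      simp [Matrix.one_apply]
    · rw [D.orth' t s hts, Matrix.zero_mul, Matrix.mul_zero]
      rw [Matrix.one_apply_ne]
      · rfl
      · intro h; exact hts (congrArg Sigma.fst h)
  rw [rank_of_factor h1 h2]
  simp

/-- tensoring a decomposition on the right -/
def Decomp.kronR (Y : Type*) [Fintype Y] [DecidableEq Y] :
    Decomp K (X × Y) (fun t => n t × Y) where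
  W t := D.W t ⊗ₖ 1
  W' t := D.W' t ⊗ₖ 1
  orth t := by rw [← Matrix.mul_kronecker_mul, D.orth]; simp
  orth' t s h := by rw [← Matrix.mul_kronecker_mul, D.orth' t s h]; simp
  sum := by
    simp only [← Matrix.mul_kronecker_mul]
    ext ⟨x, y⟩ ⟨x', y'⟩
    have := congrFun (congrFun D.sum x) x'
    rw [Matrix.sum_apply] at this ⊢
    simp only [Matrix.kroneckerMap_apply, ← Finset.sum_mul, this, Matrix.mul_one]
    by_cases hx : x = x' <;> by_cases hy : y = y' <;> simp [Matrix.one_apply, Prod.ext_iff, hx, hy]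

/-- tensoring a decomposition on the left -/
def Decomp.kronL (Y : Type*) [Fintype Y] [DecidableEq Y] :
    Decomp K (Y × X) (fun t => Y × n t) where
  W t := 1 ⊗ₖ D.W t
  W' t := 1 ⊗ₖ D.W' t
  orth t := by rw [← Matrix.mul_kronecker_mul, D.orth]; simp
  orth' t s h := by rw [← Matrix.mul_kronecker_mul, D.orth' t s h]; simp
  sum := by
    simp only [← Matrix.mul_kronecker_mul]
    ext ⟨x, y⟩ ⟨x', y'⟩
    have := congrFun (congrFun D.sum y) y'
    rw [Matrix.sum_apply] at this ⊢
    simp only [Matrix.kroneckerMap_apply, ← Finset.mul_sum, this, Matrix.mul_one]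
    by_cases hx : x = x' <;> by_cases hy : y = y' <;> simp [Matrix.one_apply, Prod.ext_iff, hx, hy]
end
end rank

section wedd
variable {K A : Type*} [Field K] [Ring A] [Algebra K A]
variable {ι : Type*} [Fintype ι] [DecidableEq ι] {n : ι → Type*}
  [∀ i, Fintype (n i)] [∀ i, DecidableEq (n i)]

/-- matrix units -/
def mu (e : A ≃ₐ[K] Π i, Matrix (n i) (n i) K) (i : ι) (a b : n i) : A :=
  e.symm (Pi.single i (Matrix.single a b 1))

variable (e : A ≃ₐ[K] Π i, Matrix (n i) (n i) K)

/-- the projections -/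
def prj (i : ι) : A →ₐ[K] Matrix (n i) (n i) K := (Pi.evalAlgHom K _ i).comp e.toAlgHom

lemma prj_apply (i : ι) (x : A) : prj e i x = e x i := rfl

lemma e_mu (i : ι) (a b : n i) : e (mu e i a b) = Pi.single i (Matrix.single a b 1) := by
  simp [mu]

lemma mu_mul (i : ι) (a b c d : n i) :
    mu e i a b * mu e i c d = if b = c then mu e i a d else 0 := by
  apply e.injective
  rw [map_mul, e_mu, e_mu, ← Pi.single_mul]
  split_ifs with h
  · subst h; rw [e_mu]; simp
  · rw [map_zero, Matrix.single_mul_single_of_ne _ _ _ _ h]; simp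

lemma mu_mul_ne {i j : ι} (h : i ≠ j) (a b : n i) (c d : n j) :
    mu e i a b * mu e j c d = 0 := by
  apply e.injective
  rw [map_mul, e_mu, e_mu, map_zero]
  ext k : 1
  by_cases hk : k = i
  · subst hk
    simp [Pi.single_eq_of_ne h]
  · simp [Pi.single_eq_of_ne hk]

lemma sum_mu : ∑ i, ∑ a, mu e i a a = 1 := by
  apply e.injective
  simp only [map_sum, e_mu, map_one]
  ext i a b
  simp only [Finset.sum_apply, Matrix.sum_apply]
  rw [Finset.sum_eq_single i]
  · simp only [Pi.single_eq_same, Matrix.single_apply, Matrix.one_apply, Pi.one_apply]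
    rw [Finset.sum_eq_single a]
    · simp
    · intro c _ hc; simp [hc]
    · simp
  · intro j _ hj
    simp [Pi.single_eq_of_ne hj.symm]
  · simp

lemma mul_mu (z : A) (i : ι) (a b : n i) : z * mu e i a b = ∑ c, e z i c a • mu e i c b := by
  apply e.injective
  rw [map_mul, map_sum]
  simp only [map_smul, e_mu]
  ext j : 1
  by_cases hj : j = i
  · subst hj
    ext c d
    simp only [Pi.mul_apply, Pi.single_eq_same, Finset.sum_apply, Pi.smul_apply, Matrix.sum_apply,
      Matrix.smul_apply, Matrix.mul_apply, Matrix.single_apply]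
    by_cases hd : b = d
    · subst hd; simp [Finset.sum_ite_eq]
    · simp [hd]
  · simp [Pi.single_eq_of_ne hj]

lemma mu_mul' (z : A) (i : ι) (a b : n i) : mu e i a b * z = ∑ c, e z i b c • mu e i a c := by
  apply e.injective
  rw [map_mul, map_sum]
  simp only [map_smul, e_mu]
  ext j : 1
  by_cases hj : j = i
  · subst hj
    ext c d
    simp only [Pi.mul_apply, Pi.single_eq_same, Finset.sum_apply, Pi.smul_apply, Matrix.sum_apply,
      Matrix.smul_apply, Matrix.mul_apply, Matrix.single_apply]
    by_cases hd : a = c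
    · subst hd; simp [Finset.sum_ite_eq]
    · simp [hd]
  · simp [Pi.single_eq_of_ne hj]

variable {X : Type*} [Fintype X] [DecidableEq X] (o : ∀ i, n i)

/-- multiplicity of the `i`-th simple in `σ` -/
noncomputable def cls (σ : A →ₐ[K] Matrix X X K) (i : ι) : ℕ := (σ (mu e i (o i) (o i))).rank

theorem exists_decomp (σ : A →ₐ[K] Matrix X X K) :
    ∃ D : Decomp K X (fun t : (Σ i, Fin (cls e o σ i)) => n t.1),
      ∀ z t, σ z * D.W t = D.W t * e z t.1 := by
  have hex : ∀ i, ∃ (U : Matrix X (Fin (cls e o σ i)) K) (V : Matrix (Fin (cls e o σ i)) X K),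
      σ (mu e i (o i) (o i)) = U * V ∧ V * U = 1 :=
    fun i => exists_factor (σ (mu e i (o i) (o i))) (by rw [← map_mul, mu_mul, if_pos rfl])
  choose U V hUV hVU using hex
  have hU : ∀ i, σ (mu e i (o i) (o i)) * U i = U i := fun i => by
    rw [hUV i, Matrix.mul_assoc, hVU, Matrix.mul_one]
  have hV : ∀ i, V i * σ (mu e i (o i) (o i)) = V i := fun i => by
    rw [hUV i, ← Matrix.mul_assoc, hVU, Matrix.one_mul]
  let W : ∀ t : (Σ i, Fin (cls e o σ i)), Matrix X (n t.1) K :=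
    fun t => Matrix.of fun x a => (σ (mu e t.1 a (o t.1)) * U t.1) x t.2
  let W' : ∀ t : (Σ i, Fin (cls e o σ i)), Matrix (n t.1) X K :=
    fun t => Matrix.of fun a x => (V t.1 * σ (mu e t.1 (o t.1) a)) t.2 x
  have hWW : ∀ t s a b, (W' t * W s) a b =
     (V t.1 * σ (mu e t.1 (o t.1) a * mu e s.1 b (o s.1)) * U s.1) t.2 s.2 := by
    intro t s a b
    rw [map_mul, ← Matrix.mul_assoc, Matrix.mul_assoc (V t.1 * _)]
    exact (Matrix.mul_apply).trans (Matrix.mul_apply).symm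
  refine ⟨⟨W, W', ?_, ?_, ?_⟩, ?_⟩
  · intro t
    ext a b
    rw [hWW, mu_mul]
    split_ifs with h
    · subst h
      rw [hV, hVU]; simp
    · simp [Matrix.one_apply_ne h]
  · rintro ⟨i, k⟩ ⟨j, l⟩ hts
    ext a b
    rw [hWW]
    by_cases hij : i = j
    · subst hij
      have hkl : k ≠ l := fun h => hts (by rw [h])
      rw [mu_mul]
      split_ifs with h
      · rw [hV, hVU]; simp [Matrix.one_apply_ne hkl]
      · simp
    · rw [mu_mul_ne e hij]; simp
  · have hR : ∀ i a x y, σ (mu e i a a) x y =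
        ∑ k, (σ (mu e i a (o i)) * U i) x k * (V i * σ (mu e i (o i) a)) k y := by
      intro i a x y
      have h1 : mu e i a a = mu e i a (o i) * mu e i (o i) (o i) * mu e i (o i) a := by
        rw [mu_mul, if_pos rfl, mu_mul, if_pos rfl]
      rw [h1, map_mul, map_mul, hUV i, ← Matrix.mul_assoc, Matrix.mul_assoc (_ * U i)]
      exact Matrix.mul_apply
    rw [← map_one σ, ← sum_mu e]
    ext x y
    rw [Matrix.sum_apply, Fintype.sum_sigma, map_sum, Matrix.sum_apply]
    refine Finset.sum_congr rfl fun i _ => ?_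
    rw [map_sum, Matrix.sum_apply, Finset.sum_congr rfl (fun a _ => hR i a x y), Finset.sum_comm]
    refine Finset.sum_congr rfl fun k _ => ?_
    exact Matrix.mul_apply
  · intro z t
    ext x a
    have : (σ z * W t) x a = (σ (z * mu e t.1 a (o t.1)) * U t.1) x t.2 := by
      rw [map_mul, Matrix.mul_assoc]
      exact (Matrix.mul_apply).trans (Matrix.mul_apply).symm
    change (σ z * W t) x a = _
    rw [this, mul_mu, map_sum, Matrix.sum_mul, Matrix.sum_apply, Matrix.mul_apply]
    refine Finset.sum_congr rfl fun c _ => ?_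
    rw [map_smul, Matrix.smul_mul, Matrix.smul_apply, smul_eq_mul, mul_comm]
    rfl

theorem rank_rep (σ : A →ₐ[K] Matrix X X K) (z : A) (hz : z * z = z) :
    (σ z).rank = ∑ i, cls e o σ i * (e z i).rank := by
  obtain ⟨D, hD⟩ := exists_decomp e o σ
  rw [D.rank (hD z) (by rw [← map_mul, hz])]
  exact sum_sigma_fin _ (fun i => (e z i).rank)

theorem trace_rep (σ : A →ₐ[K] Matrix X X K) (z : A) :
    (σ z).trace = ∑ i, (cls e o σ i : K) * (e z i).trace := by
  obtain ⟨D, hD⟩ := exists_decomp e o σ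
  rw [D.trace (hD z)]
  exact sum_sigma_fin _ (fun i => (e z i).trace)
end wedd
end SDE
end

section
open Module Matrix
namespace SDE

/-- structure constants of a based ring -/
structure FusionData (ι : Type*) [Fintype ι] [DecidableEq ι] where
  N : ι → ι → ι → ℕ
  u : ι → ℕ
  assoc : ∀ i j k m, ∑ l, N i j l * N l k m = ∑ l, N j k l * N i l m
  one_mul : ∀ j m, ∑ i, u i * N i j m = if j = m then 1 else 0
  mul_one : ∀ i m, ∑ j, u j * N i j m = if i = m then 1 else 0

/-- the based ring with coefficients in `R` -/
def CR {ι : Type*} [Fintype ι] [DecidableEq ι] (_F : FusionData ι) (R : Type*) := ι → R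

namespace CR
variable {ι : Type*} [Fintype ι] [DecidableEq ι] {F : FusionData ι} {R R' : Type*}
  [CommRing R] [CommRing R']

instance : AddCommGroup (CR F R) := inferInstanceAs (AddCommGroup (ι → R))
instance : Module R (CR F R) := inferInstanceAs (Module R (ι → R))
instance : Module.Finite R (CR F R) := inferInstanceAs (Module.Finite R (ι → R))
instance : Module.Free R (CR F R) := inferInstanceAs (Module.Free R (ι → R))

@[ext] lemma ext {a b : CR F R} (h : ∀ i, a i = b i) : a = b := funext h

instance : Mul (CR F R) := ⟨fun a b m => ∑ i, ∑ j, a i * b j * (F.N i j m : R)⟩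
instance : One (CR F R) := ⟨fun m => (F.u m : R)⟩

lemma mul_apply (a b : CR F R) (m : ι) : (a * b) m = ∑ i, ∑ j, a i * b j * (F.N i j m : R) := rfl
lemma one_apply (m : ι) : (1 : CR F R) m = F.u m := rfl
@[simp] lemma add_apply (a b : CR F R) (m : ι) : (a + b) m = a m + b m := rfl
@[simp] lemma sub_apply (a b : CR F R) (m : ι) : (a - b) m = a m - b m := rfl
@[simp] lemma neg_apply (a : CR F R) (m : ι) : (-a) m = -a m := rfl
@[simp] lemma zero_apply (m : ι) : (0 : CR F R) m = 0 := rfl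
@[simp] lemma smul_apply (r : R) (a : CR F R) (m : ι) : (r • a) m = r * a m := rfl
lemma sum_apply {κ : Type*} (s : Finset κ) (f : κ → CR F R) (m : ι) :
    (∑ k ∈ s, f k) m = ∑ k ∈ s, f k m := Finset.sum_apply m s (fun k => (f k : ι → R))

lemma mul_assoc' (a b c : CR F R) : a * b * c = a * (b * c) := by
  ext m
  simp only [mul_apply, Finset.sum_mul, Finset.mul_sum]
  calc (∑ l, ∑ k, ∑ i, ∑ j, a i * b j * (F.N i j l : R) * c k * (F.N l k m : R))
      = ∑ i, ∑ j, ∑ k, a i * b j * c k * ((∑ l, F.N i j l * F.N l k m : ℕ) : R) := by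
        push_cast
        simp only [Finset.mul_sum]
        calc _ = ∑ l, ∑ i, ∑ j, ∑ k, a i * b j * (F.N i j l : R) * c k * (F.N l k m : R) := by
              refine Finset.sum_congr rfl fun l _ => ?_
              rw [Finset.sum_comm]
              exact Finset.sum_congr rfl fun i _ => Finset.sum_comm
          _ = _ := by
              rw [Finset.sum_comm]
              refine Finset.sum_congr rfl fun i _ => ?_
              rw [Finset.sum_comm]
              refine Finset.sum_congr rfl fun j _ => ?_
              rw [Finset.sum_comm]
              exact Finset.sum_congr rfl fun k _ => Finset.sum_congr rfl fun l _ => by ring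
    _ = ∑ i, ∑ j, ∑ k, a i * b j * c k * ((∑ l, F.N j k l * F.N i l m : ℕ) : R) := by
        simp only [F.assoc]
    _ = _ := by
        refine Finset.sum_congr rfl fun i _ => ?_
        push_cast
        simp only [Finset.mul_sum]
        conv_rhs => rw [Finset.sum_comm]
        refine Finset.sum_congr rfl fun j _ => ?_
        conv_rhs => rw [Finset.sum_comm]
        refine Finset.sum_congr rfl fun k _ => Finset.sum_congr rfl fun l _ => by ring

instance : Ring (CR F R) :=
  { (inferInstance : AddCommGroup (CR F R)), (inferInstance : Mul (CR F R)),
    (inferInstance : One (CR F R)) with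
    left_distrib := fun a b c => by
      ext m; simp only [mul_apply, add_apply, mul_add, add_mul, Finset.sum_add_distrib]
    right_distrib := fun a b c => by
      ext m; simp only [mul_apply, add_apply, mul_add, add_mul, Finset.sum_add_distrib]
    zero_mul := fun a => by ext m; simp [mul_apply]
    mul_zero := fun a => by ext m; simp [mul_apply]
    mul_assoc := mul_assoc'
    one_mul := fun a => by
      ext m
      simp only [mul_apply, one_apply]
      rw [Finset.sum_comm]
      have : ∀ j, ∑ i, (F.u i : R) * a j * (F.N i j m : R) = a j * (if j = m then 1 else 0) := by
        intro j
        have h := congrArg (Nat.cast : ℕ → R) (F.one_mul j m)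
        push_cast at h
        rw [← h, Finset.mul_sum]
        exact Finset.sum_congr rfl fun i _ => by ring
      rw [Finset.sum_congr rfl fun j _ => this j, Finset.sum_eq_single m]
      · simp
      · intro j _ hj; simp [hj]
      · simp
    mul_one := fun a => by
      ext m
      simp only [mul_apply, one_apply]
      have : ∀ j, ∑ i, a j * (F.u i : R) * (F.N j i m : R) = a j * (if j = m then 1 else 0) := by
        intro j
        have h := congrArg (Nat.cast : ℕ → R) (F.mul_one j m)
        push_cast at h
        rw [← h, Finset.mul_sum]
        exact Finset.sum_congr rfl fun i _ => by ring
      rw [Finset.sum_congr rfl fun j _ => this j, Finset.sum_eq_single m]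
      · simp
      · intro j _ hj; simp [hj]
      · simp }

instance : Algebra R (CR F R) := Algebra.ofModule
  (fun r a b => by
    ext m
    simp only [mul_apply, smul_apply, Finset.mul_sum]
    exact Finset.sum_congr rfl fun i _ => Finset.sum_congr rfl fun j _ => by ring)
  (fun r a b => by
    ext m
    simp only [mul_apply, smul_apply, Finset.mul_sum]
    exact Finset.sum_congr rfl fun i _ => Finset.sum_congr rfl fun j _ => by ring)

/-- functoriality in the coefficients -/
def map (f : R →+* R') : CR F R →+* CR F R' where
  toFun a := fun m => f (a m)
  map_one' := by ext m; exact map_natCast f _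
  map_mul' a b := by
    ext m
    change f ((a * b) m) = ∑ i, ∑ j, f (a i) * f (b j) * (F.N i j m : R')
    simp [mul_apply]
  map_zero' := by ext m; exact map_zero f
  map_add' a b := by ext m; exact map_add f _ _

@[simp] lemma map_apply (f : R →+* R') (a : CR F R) (m : ι) : map f a m = f (a m) := rfl

/-- basis elements -/
def bas (i : ι) : CR F R := Pi.single i 1

lemma bas_apply (i m : ι) : (bas i : CR F R) m = if m = i then 1 else 0 :=
  Pi.single_apply i 1 m

lemma eq_sum (a : CR F R) : a = ∑ i, a i • bas i := by
  ext m
  rw [sum_apply, Finset.sum_eq_single m]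
  · simp [bas_apply]
  · intro k _ hk; simp [bas_apply, hk.symm]
  · simp

lemma bas_mul_bas (i j : ι) : (bas i * bas j : CR F R) = ∑ l, (F.N i j l : R) • bas l := by
  ext m
  rw [sum_apply, mul_apply, Finset.sum_eq_single i, Finset.sum_eq_single j]
  · simp [bas_apply]
  · intro k _ hk; simp [bas_apply, hk]
  · simp
  · intro k _ hk; simp [bas_apply, hk]
  · simp

/-- linear functional -/
def tau (θ : ι → ℕ) : CR F R →ₗ[R] R where
  toFun a := ∑ i, a i * (θ i : R)
  map_add' a b := by simp [add_mul, Finset.sum_add_distrib]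
  map_smul' r a := by simp [Finset.mul_sum, mul_assoc]

lemma tau_apply (θ : ι → ℕ) (a : CR F R) : tau θ a = ∑ i, a i * (θ i : R) := rfl

lemma tau_map (f : R →+* R') (θ : ι → ℕ) (a : CR F R) : tau θ (map f a) = f (tau θ a) := by
  simp [tau_apply]

end CR
end SDE
end

section
open HopfAlgebra Module Coalgebra Matrix
open scoped TensorProduct Kronecker
namespace SDE
section tens
variable {K A B : Type*} [Field K] [Ring A] [Algebra K A] [Ring B] [Algebra K B]
variable {X Y Z : Type*} [Fintype X] [DecidableEq X] [Fintype Y] [DecidableEq Y]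
  [Fintype Z] [DecidableEq Z]

/-- outer tensor product of matrix representations -/
noncomputable def tens (σ : A →ₐ[K] Matrix X X K) (σ' : B →ₐ[K] Matrix Y Y K) :
    A ⊗[K] B →ₐ[K] Matrix (X × Y) (X × Y) K :=
  Algebra.TensorProduct.lift
    (AlgHom.ofLinearMap
      { toFun := fun a => σ a ⊗ₖ (1 : Matrix Y Y K)
        map_add' := fun a b => by rw [map_add, Matrix.add_kronecker]
        map_smul' := fun r a => by rw [map_smul, Matrix.smul_kronecker]; rfl }
      (by simp) (fun a b => by
        change σ (a * b) ⊗ₖ (1 : Matrix Y Y K) = (σ a ⊗ₖ 1) * (σ b ⊗ₖ 1)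
        rw [← Matrix.mul_kronecker_mul, map_mul, Matrix.mul_one]))
    (AlgHom.ofLinearMap
      { toFun := fun b => (1 : Matrix X X K) ⊗ₖ σ' b
        map_add' := fun a b => by rw [map_add, Matrix.kronecker_add]
        map_smul' := fun r a => by rw [map_smul, Matrix.kronecker_smul]; rfl }
      (by simp) (fun a b => by
        change (1 : Matrix X X K) ⊗ₖ σ' (a * b) = (1 ⊗ₖ σ' a) * (1 ⊗ₖ σ' b)
        rw [← Matrix.mul_kronecker_mul, map_mul, Matrix.mul_one]))
    (fun a b => by
      change (σ a ⊗ₖ (1 : Matrix Y Y K)) * (1 ⊗ₖ σ' b) = (1 ⊗ₖ σ' b) * (σ a ⊗ₖ 1)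
      rw [← Matrix.mul_kronecker_mul, ← Matrix.mul_kronecker_mul]; simp)

lemma tens_tmul (σ : A →ₐ[K] Matrix X X K) (σ' : B →ₐ[K] Matrix Y Y K) (a : A) (b : B) :
    tens σ σ' (a ⊗ₜ b) = σ a ⊗ₖ σ' b := by
  rw [tens, Algebra.TensorProduct.lift_tmul]
  change (σ a ⊗ₖ (1 : Matrix Y Y K)) * (1 ⊗ₖ σ' b) = _
  rw [← Matrix.mul_kronecker_mul]; simp

lemma tens_interR (σ : A →ₐ[K] Matrix X X K) (σ₁ : A →ₐ[K] Matrix Z Z K)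
    (σ' : B →ₐ[K] Matrix Y Y K) (W : Matrix X Z K) (h : ∀ a, σ a * W = W * σ₁ a) (z : A ⊗[K] B) :
    tens σ σ' z * (W ⊗ₖ (1 : Matrix Y Y K)) = (W ⊗ₖ (1 : Matrix Y Y K)) * tens σ₁ σ' z := by
  induction z with
  | zero => simp
  | tmul a b => simp only [tens_tmul, ← Matrix.mul_kronecker_mul, h, Matrix.one_mul, Matrix.mul_one]
  | add a b ha hb => rw [map_add, map_add, Matrix.add_mul, Matrix.mul_add, ha, hb]

lemma tens_interL (σ : A →ₐ[K] Matrix X X K) (σ₁ : A →ₐ[K] Matrix Z Z K)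
    (σ' : B →ₐ[K] Matrix Y Y K) (W : Matrix X Z K) (h : ∀ a, σ a * W = W * σ₁ a) (z : B ⊗[K] A) :
    tens σ' σ z * ((1 : Matrix Y Y K) ⊗ₖ W) = ((1 : Matrix Y Y K) ⊗ₖ W) * tens σ' σ₁ z := by
  induction z with
  | zero => simp
  | tmul a b => simp only [tens_tmul, ← Matrix.mul_kronecker_mul, h, Matrix.one_mul, Matrix.mul_one]
  | add a b ha hb => rw [map_add, map_add, Matrix.add_mul, Matrix.mul_add, ha, hb]

variable {ι : Type*} [Fintype ι] [DecidableEq ι] {n : ι → Type*}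
  [∀ i, Fintype (n i)] [∀ i, DecidableEq (n i)]
variable (e : A ≃ₐ[K] Π i, Matrix (n i) (n i) K) (o : ∀ i, n i)

lemma rank_tensR (σ : A →ₐ[K] Matrix X X K) (σ' : B →ₐ[K] Matrix Y Y K) (z : A ⊗[K] B)
    (hz : z * z = z) :
    (tens σ σ' z).rank = ∑ i, cls e o σ i * (tens (prj e i) σ' z).rank := by
  obtain ⟨D, hD⟩ := exists_decomp e o σ
  rw [(D.kronR Y).rank (Zt := fun t => tens (prj e t.1) σ' z)
    (fun t => tens_interR σ (prj e t.1) σ' (D.W t) (fun a => hD a t) z) (by rw [← map_mul, hz])]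
  exact sum_sigma_fin _ (fun i => (tens (prj e i) σ' z).rank)

lemma rank_tensL (σ : A →ₐ[K] Matrix X X K) (σ' : B →ₐ[K] Matrix Y Y K) (z : B ⊗[K] A)
    (hz : z * z = z) :
    (tens σ' σ z).rank = ∑ i, cls e o σ i * (tens σ' (prj e i) z).rank := by
  obtain ⟨D, hD⟩ := exists_decomp e o σ
  rw [(D.kronL Y).rank (Zt := fun t => tens σ' (prj e t.1) z)
    (fun t => tens_interL σ (prj e t.1) σ' (D.W t) (fun a => hD a t) z) (by rw [← map_mul, hz])]
  exact sum_sigma_fin _ (fun i => (tens σ' (prj e i) z).rank)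

lemma cls_prj (i l : ι) : cls e o (prj e i) l = if i = l then 1 else 0 := by
  rw [cls, prj_apply, e_mu]
  split_ifs with h
  · subst h
    rw [Pi.single_eq_same]
    have := rank_of_factor (E := Matrix.single (o i) (o i) (1 : K))
      (U := Matrix.single (o i) () 1) (V := Matrix.single () (o i) 1) (by simp) (by
        ext; simp)
    simpa using this
  · rw [Pi.single_eq_of_ne h]; simp
end tens

section tp
variable {K H : Type*} [Field K] [Ring H] [HopfAlgebra K H]
variable {X Y Z : Type*} [Fintype X] [DecidableEq X] [Fintype Y] [DecidableEq Y]
  [Fintype Z] [DecidableEq Z]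

/-- tensor product of representations of a Hopf algebra -/
noncomputable def tprod (σ : H →ₐ[K] Matrix X X K) (σ' : H →ₐ[K] Matrix Y Y K) :
    H →ₐ[K] Matrix (X × Y) (X × Y) K := (tens σ σ').comp (Bialgebra.comulAlgHom K H)

lemma tprod_apply (σ : H →ₐ[K] Matrix X X K) (σ' : H →ₐ[K] Matrix Y Y K) (x : H) :
    tprod σ σ' x = tens σ σ' (comul x) := rfl

lemma tprod_repr (σ : H →ₐ[K] Matrix X X K) (σ' : H →ₐ[K] Matrix Y Y K) {x : H} {κ : Type*}
    (r : Coalgebra.Repr K x κ) :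
    tprod σ σ' x = ∑ i ∈ r.index, σ (r.left i) ⊗ₖ σ' (r.right i) := by
  rw [tprod_apply, ← r.eq, map_sum]
  simp only [tens_tmul]

/-- the trivial representation -/
noncomputable def trivRep : H →ₐ[K] Matrix Unit Unit K :=
  (Algebra.ofId K (Matrix Unit Unit K)).comp (Bialgebra.counitAlgHom K H)

lemma trivRep_apply (x : H) (a b : Unit) : (trivRep x : Matrix Unit Unit K) a b = counit x := by
  simp [trivRep, Algebra.ofId_apply, Matrix.algebraMap_matrix_apply]

lemma trivRep_tprod (σ : H →ₐ[K] Matrix X X K) (x : H) :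
    tprod trivRep σ x = (σ x).submatrix (Equiv.punitProd X) (Equiv.punitProd X) := by
  rw [tprod_repr _ _ (ℛ K x)]
  ext ⟨u, a⟩ ⟨v, b⟩
  conv_rhs => rw [← sum_counit_smul (ℛ K x)]
  simp [Matrix.sum_apply, trivRep_apply]

lemma tprod_trivRep (σ : H →ₐ[K] Matrix X X K) (x : H) :
    tprod σ trivRep x = (σ x).submatrix (Equiv.prodPUnit X) (Equiv.prodPUnit X) := by
  rw [tprod_repr _ _ (ℛ K x)]
  ext ⟨a, u⟩ ⟨b, v⟩
  conv_rhs => rw [← sum_smul_counit (ℛ K x)]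
  simp [Matrix.sum_apply, trivRep_apply, mul_comm]

lemma tprod_assoc (σ : H →ₐ[K] Matrix X X K) (σ' : H →ₐ[K] Matrix Y Y K)
    (σ'' : H →ₐ[K] Matrix Z Z K) (x : H) :
    tprod (tprod σ σ') σ'' x = (tprod σ (tprod σ' σ'') x).submatrix (Equiv.prodAssoc X Y Z)
      (Equiv.prodAssoc X Y Z) := by
  have key := coassoc3 ((tens σ (tens σ' σ'')).toLinearMap) x
  ext ⟨⟨a, b⟩, c⟩ ⟨⟨a', b'⟩, c'⟩
  have key2 := congrFun (congrFun key (a, (b, c))) (a', (b', c'))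
  simp only [AlgHom.toLinearMap_apply, tens_tmul, Matrix.sum_apply, kroneckerMap_apply] at key2
  rw [tprod_repr _ _ (ℛ K x), tprod_repr _ _ (ℛ K x)]
  simp only [Matrix.submatrix_apply, Matrix.sum_apply, kroneckerMap_apply,
    tprod_repr _ _ (ℛ K ((ℛ K x).left _)), tprod_repr _ _ (ℛ K ((ℛ K x).right _)),
    Finset.sum_mul, Finset.mul_sum, Equiv.prodAssoc_apply]
  simpa only [mul_assoc] using key2

lemma trace_tprod (σ : H →ₐ[K] Matrix X X K) (σ' : H →ₐ[K] Matrix Y Y K) (x : H) :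
    (tprod σ σ' x).trace = (Matrix.traceLinearMap X K K ∘ₗ σ.toLinearMap)
      (Rop (Matrix.traceLinearMap Y K K ∘ₗ σ'.toLinearMap) x) := by
  rw [tprod_repr _ _ (ℛ K x), Rop_repr _ (ℛ K x), Matrix.trace_sum, map_sum]
  refine Finset.sum_congr rfl fun i _ => ?_
  rw [Matrix.trace_kronecker]
  simp [mul_comm]

variable {ι : Type*} [Fintype ι] [DecidableEq ι] {n : ι → Type*}
  [∀ i, Fintype (n i)] [∀ i, DecidableEq (n i)]
variable (e : H ≃ₐ[K] Π i, Matrix (n i) (n i) K) (o : ∀ i, n i)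

lemma cls_congr {f : X ≃ Y} (σ : H →ₐ[K] Matrix X X K) (σ' : H →ₐ[K] Matrix Y Y K)
    (h : ∀ x, σ x = (σ' x).submatrix f f) (i : ι) : cls e o σ i = cls e o σ' i := by
  rw [cls, cls, h, Matrix.rank_submatrix]

lemma comul_idem {z : H} (hz : z * z = z) : comul (R := K) z * comul z = comul (R := K) z := by
  rw [← Bialgebra.comul_mul, hz]

lemma mu_idem (i : ι) (a : n i) : mu e i a a * mu e i a a = mu e i a a := by
  rw [mu_mul, if_pos rfl]

lemma cls_tprodR (σ : H →ₐ[K] Matrix X X K) (σ' : H →ₐ[K] Matrix Y Y K) (l : ι) :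
    cls e o (tprod σ σ') l = ∑ i, cls e o σ i * cls e o (tprod (prj e i) σ') l :=
  rank_tensR e o σ σ' _ (comul_idem (mu_idem e l (o l)))

lemma cls_tprodL (σ : H →ₐ[K] Matrix X X K) (σ' : H →ₐ[K] Matrix Y Y K) (l : ι) :
    cls e o (tprod σ' σ) l = ∑ i, cls e o σ i * cls e o (tprod σ' (prj e i)) l :=
  rank_tensL e o σ σ' _ (comul_idem (mu_idem e l (o l)))

/-- the fusion data of a semisimple Hopf algebra -/
noncomputable def fus : FusionData ι where
  N i j l := cls e o (tprod (prj e i) (prj e j)) l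
  u := cls e o trivRep
  assoc i j k m := by
    rw [← cls_tprodR, ← cls_tprodL]
    exact cls_congr e o (f := Equiv.prodAssoc _ _ _) _ _ (tprod_assoc _ _ _) m
  one_mul j m := by
    rw [← cls_tprodR, cls_congr e o _ _ (trivRep_tprod _), cls_prj]
  mul_one j m := by
    rw [← cls_tprodL, cls_congr e o _ _ (tprod_trivRep _), cls_prj]

/-- class of a representation in the fusion ring -/
noncomputable def rcl (R : Type*) [CommRing R] (σ : H →ₐ[K] Matrix X X K) : CR (fus e o) R :=
  fun i => (cls e o σ i : R)

lemma rcl_apply (R : Type*) [CommRing R] (σ : H →ₐ[K] Matrix X X K) (i : ι) :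
  rcl e o R σ i = cls e o σ i := rfl

lemma rcl_tprod (R : Type*) [CommRing R] (σ : H →ₐ[K] Matrix X X K) (σ' : H →ₐ[K] Matrix Y Y K) :
    rcl e o R (tprod σ σ') = rcl e o R σ * rcl e o R σ' := by
  ext m
  rw [rcl_apply, CR.mul_apply, cls_tprodR]
  push_cast
  refine Finset.sum_congr rfl fun i _ => ?_
  rw [cls_tprodL]
  push_cast
  rw [Finset.mul_sum]
  exact Finset.sum_congr rfl fun j _ => by rw [rcl_apply, rcl_apply, mul_assoc]; rfl

lemma rcl_prj (R : Type*) [CommRing R] (i : ι) : rcl e o R (prj e i) = CR.bas i := by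
  ext m
  rw [rcl_apply, cls_prj, CR.bas_apply]
  by_cases h : i = m
  · simp [h]
  · simp [h, Ne.symm h]

lemma rcl_triv (R : Type*) [CommRing R] : rcl e o R trivRep = 1 := rfl

lemma rcl_map {R R' : Type*} [CommRing R] [CommRing R'] (f : R →+* R')
    (σ : H →ₐ[K] Matrix X X K) : CR.map f (rcl e o R σ) = rcl e o R' σ := by
  ext m; simp [rcl_apply]

/-- ranks of the integral -/
noncomputable def thet (Λ : H) (i : ι) : ℕ := (e Λ i).rank

lemma tau_rcl (R : Type*) [CommRing R] {Λ : H} (hΛ : Λ * Λ = Λ) (σ : H →ₐ[K] Matrix X X K) :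
    CR.tau (thet e Λ) (rcl e o R σ) = ((σ Λ).rank : R) := by
  rw [CR.tau_apply, rank_rep e o σ Λ hΛ]
  push_cast
  rfl

/-- the class functions -/
noncomputable def chi : CR (fus e o) K →ₗ[K] Dual K H where
  toFun c := ∑ i, c i • (Matrix.traceLinearMap (n i) K K ∘ₗ (prj e i).toLinearMap)
  map_add' a b := by simp [add_smul, Finset.sum_add_distrib]
  map_smul' r a := by simp [Finset.smul_sum, smul_smul]

lemma chi_apply (c : CR (fus e o) K) (x : H) : chi e o c x = ∑ i, c i * (e x i).trace := by
  change (∑ i, c i • (Matrix.traceLinearMap (n i) K K ∘ₗ (prj e i).toLinearMap)) x = _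
  rw [LinearMap.sum_apply]
  rfl

lemma chi_rcl (σ : H →ₐ[K] Matrix X X K) (x : H) : chi e o (rcl e o K σ) x = (σ x).trace := by
  rw [chi_apply, trace_rep e o σ]; rfl

lemma chi_one : chi e o 1 = counit := by
  ext x
  rw [← rcl_triv, chi_rcl]
  simp [Matrix.trace, trivRep_apply]

lemma Rop_add (f g : Dual K H) : Rop (f + g) = Rop f + Rop g := by
  ext x; simp [Rop, LinearMap.lTensor_add]

lemma Rop_smul (r : K) (f : Dual K H) : Rop (r • f) = r • Rop f := by
  ext x; simp [Rop, LinearMap.lTensor_smul]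

/-- `Rop` as a linear map -/
noncomputable def RopL : Dual K H →ₗ[K] (H →ₗ[K] H) where
  toFun := Rop
  map_add' := Rop_add
  map_smul' := Rop_smul

lemma RopL_apply (f : Dual K H) : RopL f = Rop f := rfl

lemma chi_mul (a b : CR (fus e o) K) : chi e o (a * b) = chi e o a ∘ₗ Rop (chi e o b) := by
  ext x
  have hb : ∀ i j, chi e o (CR.bas i * CR.bas j) x = chi e o (CR.bas i) (RopL (chi e o (CR.bas j)) x) := by
    intro i j
    have h1 : ∀ j, chi e o (CR.bas j) = Matrix.traceLinearMap (n j) K K ∘ₗ (prj e j).toLinearMap := by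
      intro j; ext y; rw [← rcl_prj, chi_rcl]; rfl
    rw [h1 i, h1 j, ← rcl_prj, ← rcl_prj, ← rcl_tprod, chi_rcl, trace_tprod]
    rfl
  rw [LinearMap.comp_apply, ← RopL_apply]
  conv_lhs => rw [CR.eq_sum a, CR.eq_sum b]
  conv_rhs => rw [CR.eq_sum a, CR.eq_sum b]
  simp only [Finset.sum_mul, Finset.mul_sum, smul_mul_assoc, mul_smul_comm, map_sum, map_smul,
    LinearMap.sum_apply, LinearMap.smul_apply, hb]

lemma chi_tr (a : CR (fus e o) K) (x y : H) : chi e o a (x * y) = chi e o a (y * x) := by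
  simp only [chi_apply, map_mul, Pi.mul_apply]
  exact Finset.sum_congr rfl fun i _ => by rw [Matrix.trace_mul_comm]

lemma mu_trace (i j : ι) (a b : n j) :
    (e (mu e j a b) i).trace = if i = j then (if a = b then 1 else 0) else 0 := by
  rw [e_mu]
  split_ifs with h h'
  · subst h; subst h'; simp
  · subst h; simp [Matrix.trace_single_eq_of_ne _ _ _ h']
  · rw [Pi.single_eq_of_ne h]; simp

lemma chi_mu (c : CR (fus e o) K) (j : ι) (a b : n j) :
    chi e o c (mu e j a b) = if a = b then c j else 0 := by
  rw [chi_apply]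
  simp only [mu_trace]
  rw [Finset.sum_eq_single j]
  · simp
  · intro i _ h; simp [h]
  · simp

lemma chi_inj : Function.Injective (chi e o) := by
  intro a b h
  ext j
  have := congrArg (fun f => f (mu e j (o j) (o j))) h
  simpa [chi_mu] using this

lemma eq_sum_mu (x : H) : x = ∑ i, ∑ a, ∑ b, e x i a b • mu e i a b := by
  conv_lhs => rw [← mul_one x, ← sum_mu e, Finset.mul_sum]
  refine Finset.sum_congr rfl fun i _ => ?_
  rw [Finset.mul_sum, Finset.sum_comm]
  exact Finset.sum_congr rfl fun b _ => mul_mu e x i b b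

lemma chi_sur (f : Dual K H) (hf : ∀ x y, f (x * y) = f (y * x)) : ∃ a, chi e o a = f := by
  obtain ⟨c, hc⟩ : ∃ c : CR (fus e o) K, ∀ i, c i = f (mu e i (o i) (o i)) := ⟨fun i => _, fun i => rfl⟩
  refine ⟨c, ?_⟩
  ext x
  rw [eq_sum_mu e x]
  simp only [map_sum, map_smul]
  refine Finset.sum_congr rfl fun i _ => Finset.sum_congr rfl fun a _ =>
    Finset.sum_congr rfl fun b _ => ?_
  congr 1
  rw [chi_mu, hc]
  split_ifs with h
  · subst h
    have h1 := hf (mu e i (o i) a) (mu e i a (o i))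
    rwa [mu_mul, mu_mul, if_pos rfl, if_pos rfl] at h1
  · have h1 := hf (mu e i a a) (mu e i a b)
    rw [mu_mul, mu_mul, if_pos rfl, if_neg (Ne.symm h), map_zero] at h1
    exact h1.symm
end tp
end SDE
end

section
open HopfAlgebra Module Coalgebra Matrix
open scoped TensorProduct Kronecker
namespace SDE
section hopf
variable {K H : Type*} [Field K] [Ring H] [HopfAlgebra K H]

local notation "𝒮" => antipode K (A := H)

lemma exists_isInt [IsSemisimpleRing H] : ∃ Λ : H, IsInt (K := K) Λ := by
  obtain ⟨e, h1, h2, h3⟩ := exists_int (Bialgebra.counitAlgHom K H)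
  exact ⟨e, h1, h2, h3⟩

lemma exists_isCoint (Hd : Type*) [Ring Hd] [Algebra K Hd] [IsSemisimpleRing Hd]
    (Φ : Hd ≃ₗ[K] Module.Dual K H)
    (hΦone : Φ 1 = Coalgebra.counit)
    (hΦmul : ∀ a b : Hd, (Φ (a * b) : Module.Dual K H) =
      LinearMap.mul' K K ∘ₗ TensorProduct.map (Φ a) (Φ b) ∘ₗ Coalgebra.comul) :
    ∃ lam : Dual K H, IsCoint lam := by
  let ε : Hd →ₐ[K] K := AlgHom.ofLinearMap
    ((LinearMap.applyₗ (1 : H) : Dual K H →ₗ[K] K) ∘ₗ Φ.toLinearMap)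
    (by simp [hΦone]) (fun a b => by
      simp [hΦmul, Bialgebra.comul_one, Algebra.TensorProduct.one_def])
  have hε : ∀ a, ε a = Φ a 1 := fun a => rfl
  obtain ⟨e, h1, h2, h3⟩ := exists_int ε
  have hmul : ∀ a b x, Φ (a * b) x = ∑ i ∈ (ℛ K x).index, Φ a ((ℛ K x).left i) *
      Φ b ((ℛ K x).right i) := by
    intro a b x
    rw [hΦmul, LinearMap.comp_apply, LinearMap.comp_apply]
    conv_lhs => rw [← (ℛ K x).eq]
    simp
  refine ⟨Φ e, h1, fun x => ?_, fun x => ?_⟩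
  · rw [← sub_eq_zero, ← Module.forall_dual_apply_eq_zero_iff K]
    intro g
    obtain ⟨a, rfl⟩ := Φ.surjective g
    have := hmul a e x
    rw [h2, map_smul, hε] at this
    rw [Rop_repr _ (ℛ K x), map_sub, map_sum, sub_eq_zero, map_smul]
    simp only [map_smul, smul_eq_mul, LinearMap.smul_apply] at this ⊢
    rw [mul_comm, this]
    exact Finset.sum_congr rfl fun i _ => mul_comm _ _
  · rw [← sub_eq_zero, ← Module.forall_dual_apply_eq_zero_iff K]
    intro g
    obtain ⟨a, rfl⟩ := Φ.surjective g
    have := hmul e a x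
    rw [h3, map_smul, hε] at this
    conv_lhs => rw [← (ℛ K x).eq]
    simp only [map_sum, LinearMap.rTensor_tmul, TensorProduct.lid_tmul, map_sub, sub_eq_zero,
      map_smul, smul_eq_mul, LinearMap.smul_apply] at this ⊢
    rw [mul_comm, this]

variable [FiniteDimensional K H]
variable {Λ : H} {lam : Dual K H} (hΛ : IsInt (K := K) Λ) (hl : IsCoint lam)
variable {ι : Type*} [Fintype ι] [DecidableEq ι] {n : ι → Type*}
  [∀ i, Fintype (n i)] [∀ i, DecidableEq (n i)]
variable (e : H ≃ₐ[K] Π i, Matrix (n i) (n i) K)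

include hΛ hl e in
lemma exists_inner : ∃ v w : H, v * w = 1 ∧ w * v = 1 ∧ ∀ h, 𝒮 (𝒮 h) = v * h * w := by
  let t : H →ₗ[K] K := ∑ i, (Matrix.traceLinearMap (n i) K K ∘ₗ (prj e i).toLinearMap)
  have ht : ∀ x, t x = ∑ i, (e x i).trace := fun x => by
    simp only [t, LinearMap.sum_apply]; rfl
  have htc : ∀ x y, t (x * y) = t (y * x) := fun x y => by
    simp only [ht, map_mul, Pi.mul_apply]
    exact Finset.sum_congr rfl fun i _ => Matrix.trace_mul_comm _ _
  have htm : ∀ x i a b, t (x * mu e i a b) = e x i b a := by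
    intro x i a b
    have hm : ∀ c, t (mu e i c b) = if c = b then 1 else 0 := by
      intro c
      rw [ht, Finset.sum_eq_single i]
      · rw [mu_trace, if_pos rfl]
      · intro j _ hj; rw [mu_trace, if_neg hj]
      · simp
    rw [mul_mu, map_sum]
    simp only [map_smul, hm]
    simp
  have htn : ∀ x, (∀ y, t (x * y) = 0) → x = 0 := by
    intro x hx
    apply e.injective
    ext i a b
    rw [← htm, hx]; simp
  let v : H := e.symm fun i => Matrix.of fun a b => lam (mu e i b a)
  have hv : ∀ x, lam x = t (v * x) := by
    intro x
    rw [eq_sum_mu e x]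
    simp only [map_sum, map_smul, Finset.mul_sum, mul_smul_comm, htm]
    simp [v]
  have hinj : Function.Injective (LinearMap.mulLeft K v) := by
    rw [← LinearMap.ker_eq_bot, LinearMap.ker_eq_bot']
    intro x hx
    apply lam_nondeg hΛ hl
    intro y
    rw [hv, ← mul_assoc]
    have : v * x = 0 := hx
    rw [this, zero_mul, map_zero]
  obtain ⟨w, hw⟩ := (LinearMap.injective_iff_surjective.1 hinj) 1
  have hw : v * w = 1 := hw
  have hw' : w * v = 1 := hinj (by change v * (w * v) = v * 1; rw [← mul_assoc, hw]; simp)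
  refine ⟨v, w, hw, hw', fun h => ?_⟩
  have : v * h = 𝒮 (𝒮 h) * v := by
    rw [← sub_eq_zero]
    apply htn
    intro y
    rw [sub_mul, map_sub, sub_eq_zero, mul_assoc, ← hv, lam_nak hΛ hl, hv, mul_assoc, htc (𝒮 (𝒮 h)),
      mul_assoc]
  rw [this, mul_assoc, hw, mul_one]

include hΛ hl e in
lemma tr_antipode_sq (f : Dual K H) (hf : ∀ x y, f (x * y) = f (y * x)) : f ∘ₗ 𝒮 ∘ₗ 𝒮 = f := by
  obtain ⟨v, w, h1, h2, h3⟩ := exists_inner hΛ hl e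
  ext x
  change f (𝒮 (𝒮 x)) = f x
  rw [h3, hf, ← mul_assoc, h2, one_mul]

include hΛ hl in
theorem CR_semisimple (o : ∀ i, n i) : IsSemisimpleRing (CR (fus e o) K) :=
  classAlg_semisimple hΛ hl (chi e o) (chi_inj e o) (chi_one e o) (chi_mul e o) (chi_tr e o)
    (chi_sur e o) (tr_antipode_sq hΛ hl e)

/-- signs -/
def sgn {α β : Type*} : α ⊕ β → ℤ := Sum.elim (fun _ => 1) (fun _ => -1)

lemma sgn_sq {α β : Type*} (a : α ⊕ β) : sgn a * sgn a = 1 := by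
  cases a <;> simp [sgn]

lemma sgn_cases {α β : Type*} (a : α ⊕ β) : sgn a = 1 ∨ sgn a = -1 := by
  cases a <;> simp [sgn]

lemma exists_sign_basis {V : Type*} [AddCommGroup V] [Module K V] [FiniteDimensional K V]
    (h2 : (2 : K) ≠ 0) (L : V →ₗ[K] V) (hL : ∀ x, L (L x) = x) :
    ∃ (r r' : ℕ) (b : Basis (Fin r ⊕ Fin r') K V), ∀ u, L (b u) = sgn u • b u := by
  let P := LinearMap.ker (L - LinearMap.id)
  let Q := LinearMap.ker (L + LinearMap.id)
  have hP : ∀ x ∈ P, L x = x := fun x hx => by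
    have : L x - x = 0 := hx
    exact sub_eq_zero.1 this
  have hQ : ∀ x ∈ Q, L x = -x := fun x hx => by
    have : L x + x = 0 := hx
    exact eq_neg_of_add_eq_zero_left this
  have hc : IsCompl P Q := by
    constructor
    · rw [Submodule.disjoint_def]
      intro x hx hx'
      have h3 : x = -x := by rw [← hQ x hx', hP x hx]
      have h4 : (2 : K) • x = 0 := by
        rw [two_smul]; nth_rewrite 2 [h3]; simp
      exact (smul_eq_zero.1 h4).resolve_left h2
    · rw [codisjoint_iff, eq_top_iff]
      intro x _
      rw [Submodule.mem_sup]
      refine ⟨(2 : K)⁻¹ • (x + L x), ?_, (2 : K)⁻¹ • (x - L x), ?_, ?_⟩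
      · change L _ - _ = 0
        simp only [map_smul, map_add, hL, LinearMap.id_apply]
        rw [add_comm (L x), sub_self]
      · change L _ + _ = 0
        simp only [map_smul, map_sub, hL, LinearMap.id_apply]
        rw [← smul_add]; simp
      · rw [← smul_add]
        have : x + L x + (x - L x) = (2 : K) • x := by rw [two_smul]; abel
        rw [this, smul_smul, inv_mul_cancel₀ h2, one_smul]
  refine ⟨_, _, ((finBasis K P).prod (finBasis K Q)).map (Submodule.prodEquivOfIsCompl P Q hc), ?_⟩
  rintro (u | u)
  · simp [sgn, hP _ (Subtype.prop _)]
  · simp [sgn, hQ _ (Subtype.prop _)]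

include hΛ hl e in
theorem exists_signed [IsAlgClosed K] (h2 : (2 : K) ≠ 0) (o : ∀ i, n i) :
    ∃ (r r' : ι → ℕ) (e' : H ≃ₐ[K] Π i, Matrix (Fin (r i) ⊕ Fin (r' i)) (Fin (r i) ⊕ Fin (r' i)) K),
      (∀ i, Nonempty (Fin (r i) ⊕ Fin (r' i))) ∧
      ∀ h i a b, e' (𝒮 (𝒮 h)) i a b = ((sgn a * sgn b : ℤ) : K) * e' h i a b := by
  obtain ⟨v, w, hvw, hwv, hS⟩ := exists_inner hΛ hl e
  have hcent : ∀ h, (v * v) * h = h * (v * v) := by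
    intro h
    have h4 := antipode_four hΛ hl h
    rw [hS (𝒮 (𝒮 h)), hS h] at h4
    calc v * v * h = (v * (v * h * w) * w) * (v * v) := by
          have : (v * (v * h * w) * w) * (v * v) = v * v * h * (w * (w * v) * v) := by
            noncomm_ring
          rw [this, hwv, mul_one, hwv, mul_one]
      _ = h * (v * v) := by rw [h4]
  have hsc : ∀ i, ∃ c : K, c ≠ 0 ∧ e v i * e v i = c • 1 := by
    intro i
    have h1 : e v i * e v i ∈ Set.range (Matrix.scalar (n i)) := by
      apply Matrix.mem_range_scalar_of_commute_single
      intro a b _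
      have := congrArg (fun z => e z i) (hcent (mu e i a b))
      simp only [map_mul, Pi.mul_apply, e_mu, Pi.single_eq_same] at this
      exact this.symm
    obtain ⟨c, hc⟩ := h1
    refine ⟨c, ?_, ?_⟩
    · rintro rfl
      have h3 : (v * v) * (w * w) = 1 := by
        rw [mul_assoc, ← mul_assoc v w, hvw, one_mul, hvw]
      have := congrArg (fun z => e z i (o i) (o i)) h3
      simp only [map_mul, Pi.mul_apply, ← hc, map_zero, zero_mul, map_one, Pi.one_apply,
        Matrix.one_apply_eq, Matrix.zero_apply] at this
      exact zero_ne_one this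
    · rw [← hc]; ext a b; simp [Matrix.scalar_apply, Matrix.diagonal_apply, Matrix.one_apply]
  choose c hc0 hc using hsc
  choose d hd using fun i => IsAlgClosed.exists_pow_nat_eq (c i) (n := 2) (by norm_num)
  have hd0 : ∀ i, d i ≠ 0 := fun i h => hc0 i (by rw [← hd, h]; simp)
  let g : ∀ i, Matrix (n i) (n i) K := fun i => (d i)⁻¹ • e v i
  have hg : ∀ i, g i * g i = 1 := by
    intro i
    simp only [g, Matrix.smul_mul, Matrix.mul_smul, hc, smul_smul, ← hd i]
    have := hd0 i
    rw [show (d i)⁻¹ * ((d i)⁻¹ * d i ^ 2) = 1 by field_simp, one_smul]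
  have hgS : ∀ h i, e (𝒮 (𝒮 h)) i = g i * e h i * g i := by
    intro h i
    have hw : e w i = (d i)⁻¹ • g i := by
      have h3 : e v i * e w i = 1 := by rw [← Pi.mul_apply, ← map_mul, hvw, map_one]; rfl
      have h4 : e v i = d i • g i := by simp [g, smul_smul, hd0 i]
      rw [h4, Matrix.smul_mul] at h3
      calc e w i = (d i)⁻¹ • (g i * (d i • (g i * e w i))) := by
            rw [Matrix.mul_smul, ← Matrix.mul_assoc, hg, Matrix.one_mul, smul_smul,
              inv_mul_cancel₀ (hd0 i), one_smul]
        _ = _ := by rw [h3, Matrix.mul_one]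
    rw [hS, map_mul, map_mul, Pi.mul_apply, Pi.mul_apply, hw]
    simp [g]
  choose r r' b hb using fun i => exists_sign_basis h2 (Matrix.toLin' (g i))
    (fun x => by simp [Matrix.mulVec_mulVec, hg])
  let φ : ∀ i, Matrix (n i) (n i) K ≃ₐ[K] Matrix (Fin (r i) ⊕ Fin (r' i)) (Fin (r i) ⊕ Fin (r' i)) K :=
    fun i => (Matrix.toLinAlgEquiv').trans (LinearMap.toMatrixAlgEquiv (b i))
  have hφ : ∀ i, φ i (g i) = Matrix.diagonal fun u => ((sgn u : ℤ) : K) := by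
    intro i
    ext u u'
    have h5 := hb i u'
    change LinearMap.toMatrixAlgEquiv (b i) (Matrix.toLin' (g i)) u u' = _
    rw [LinearMap.toMatrixAlgEquiv_apply, h5, map_zsmul]
    by_cases hu : u = u'
    · subst hu; simp
    · simp [hu, Ne.symm hu]
  refine ⟨r, r', e.trans (AlgEquiv.piCongrRight φ), ?_, ?_⟩
  · intro i
    have : Nontrivial (n i → K) := ⟨0, fun _ => 1, fun h => zero_ne_one (congrFun h (o i))⟩
    exact (b i).index_nonempty
  · intro h i x y
    change φ i (e (𝒮 (𝒮 h)) i) x y = _ * φ i (e h i) x y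
    rw [hgS, map_mul, map_mul, hφ, Matrix.mul_diagonal, Matrix.diagonal_mul]
    push_cast; ring
end hopf
end SDE
end

section
open HopfAlgebra Module Coalgebra Matrix
open scoped TensorProduct Kronecker
namespace SDE
section hopf
variable {K H : Type*} [Field K] [Ring H] [HopfAlgebra K H] [FiniteDimensional K H]

local notation "𝒮" => antipode K (A := H)

variable {Λ : H} {lam : Dual K H} (hΛ : IsInt (K := K) Λ) (hl : IsCoint lam)

lemma IsInt.idem {Λ : H} (hΛ : IsInt (K := K) Λ) : Λ * Λ = Λ := by
  rw [hΛ.left, hΛ.eps, one_smul]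

include hΛ hl in
lemma rank_tprod_one {X : Type*} [Fintype X] [DecidableEq X] [Nonempty X]
    (ρ : H →ₐ[K] Matrix X X K) (Q Q' : Matrix X X K) (hQQ : Q * Q' = 1)
    (hQ : ∀ h, (ρ h)ᵀ * Q = Q * ρ (𝒮 h))
    (schur : ∀ M, (∀ h, ρ h * M = M * ρ h) → ∃ c : K, M = c • 1) :
    (tprod ρ ρ Λ).rank = 1 := by
  have hQQ' : Q' * Q = 1 := mul_eq_one_comm.1 hQQ
  have hQ2 : ∀ h, (ρ h)ᵀ = Q * ρ (𝒮 h) * Q' := fun h => by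
    rw [← hQ, Matrix.mul_assoc, hQQ, Matrix.mul_one]
  let T : Matrix X X K → Matrix X X K := fun M =>
    ∑ i ∈ (ℛ K Λ).index, ρ ((ℛ K Λ).left i) * M * ρ (𝒮 ((ℛ K Λ).right i))
  have hTc : ∀ M h, ρ h * T M = T M * ρ h := by
    intro M h
    obtain ⟨k, rfl⟩ := antipode_surj hΛ hl h
    let G : H ⊗[K] H →ₗ[K] Matrix X X K := LinearMap.mul' K (Matrix X X K) ∘ₗ
      TensorProduct.map (LinearMap.mulRight K M ∘ₗ ρ.toLinearMap) (ρ.toLinearMap ∘ₗ 𝒮)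
    have h1 := congrArg G (hΛ.X1 k)
    rw [← (ℛ K Λ).eq] at h1
    simp only [Finset.mul_sum, map_sum, Algebra.TensorProduct.tmul_mul_tmul, one_mul] at h1
    simp only [G, LinearMap.comp_apply, TensorProduct.map_tmul, LinearMap.mul'_apply,
      LinearMap.mulRight_apply, AlgHom.toLinearMap_apply, antipode_mul_antidistrib, map_mul] at h1
    simp only [T, Finset.mul_sum, Finset.sum_mul]
    rw [Finset.sum_congr rfl fun i _ => (mul_assoc _ _ _)]
    simp only [mul_assoc] at h1 ⊢
    exact h1.symm
  have hT1 : T 1 = 1 := by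
    simp only [T, Matrix.mul_one, ← map_mul, ← map_sum]
    have : ∑ i ∈ (ℛ K Λ).index, (ℛ K Λ).left i * 𝒮 ((ℛ K Λ).right i) = 1 := by
      rw [sum_mul_antipode_eq_smul, hΛ.eps, one_smul]
    rw [this, map_one]
  choose c hc using fun M => schur (T M) (hTc M)
  have hE : ∀ m : X × X → K, (tprod ρ ρ Λ) *ᵥ m =
      c (Matrix.of (fun a b => m (a, b)) * Q) • fun p => Q' p.1 p.2 := by
    intro m
    have h1 : T (Matrix.of (fun a b => m (a, b)) * Q) * Q' =
        ∑ i ∈ (ℛ K Λ).index, ρ ((ℛ K Λ).left i) * Matrix.of (fun a b => m (a, b)) *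
          (ρ ((ℛ K Λ).right i))ᵀ := by
      simp only [T, Finset.sum_mul, hQ2]
      exact Finset.sum_congr rfl fun i _ => by simp only [Matrix.mul_assoc]
    rw [hc, Matrix.smul_mul, Matrix.one_mul] at h1
    ext ⟨a, b⟩
    have h2 := congrFun (congrFun h1 a) b
    rw [Matrix.smul_apply] at h2
    change _ = c _ • Q' a b
    rw [h2, tprod_repr _ _ (ℛ K Λ), Matrix.sum_mulVec, Finset.sum_apply, Matrix.sum_apply]
    refine Finset.sum_congr rfl fun i _ => ?_
    simp only [Matrix.mulVec, dotProduct, Matrix.kroneckerMap_apply, Matrix.mul_apply,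
      Matrix.of_apply, Matrix.transpose_apply, Fintype.sum_prod_type, Finset.sum_mul]
    rw [Finset.sum_comm]
    exact Finset.sum_congr rfl fun _ _ => Finset.sum_congr rfl fun _ _ => by ring
  have hq0 : (fun p : X × X => Q' p.1 p.2) ≠ 0 := by
    intro h
    have h3 : Q' = 0 := by ext a b; exact congrFun h (a, b)
    rw [h3, Matrix.mul_zero] at hQQ
    obtain ⟨x⟩ := ‹Nonempty X›
    have := congrFun (congrFun hQQ x) x
    simp at this
  have hr : LinearMap.range (tprod ρ ρ Λ).mulVecLin = Submodule.span K {fun p : X × X => Q' p.1 p.2} := by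
    apply le_antisymm
    · rintro _ ⟨m, rfl⟩
      rw [Matrix.mulVecLin_apply, hE]
      exact Submodule.smul_mem _ _ (Submodule.mem_span_singleton_self _)
    · rw [Submodule.span_singleton_le_iff_mem]
      refine ⟨fun p => Q' p.1 p.2, ?_⟩
      rw [Matrix.mulVecLin_apply, hE]
      have h4 : Matrix.of (fun a b => Q' a b) * Q = 1 := hQQ'
      have h5 : c 1 = 1 := by
        have := hc 1
        rw [hT1] at this
        obtain ⟨x⟩ := ‹Nonempty X›
        have := congrFun (congrFun this x) x
        simpa using this.symm
      change c (Matrix.of (fun a b => Q' a b) * Q) • _ = _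
      rw [h4, h5, one_smul]
  rw [Matrix.rank, hr, finrank_span_singleton hq0]

include hΛ hl in
theorem exists_VX [IsAlgClosed K] (V : Type*) [AddCommGroup V] [Module K V] [Module H V]
    [IsScalarTower K H V] [FiniteDimensional K V] [IsSimpleModule H V]
    [Module H (Module.Dual K V)]
    (hdual : ∀ (h : H) (f : Module.Dual K V) (v : V), (h • f) v = f (antipode (R := K) h • v))
    (φ : V ≃ₗ[H] Module.Dual K V)
    (hnt : ∀ v : V, (∀ h : H, h • v = counit (R := K) h • v) → v = 0) :
    ∃ (d : ℕ) (ρ : H →ₐ[K] Matrix (Fin d) (Fin d) K), (ρ Λ).rank = 0 ∧ (tprod ρ ρ Λ).rank = 1 := by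
  have hsc : ∀ (c : K) (v : V), c • v = (algebraMap K H c) • v := fun c v =>
    (algebraMap_smul H c v).symm
  haveI : SMulCommClass H K V := IsScalarTower.to_smulCommClass'
  haveI : SMulCommClass K H V := IsScalarTower.to_smulCommClass
  let b := finBasis K V
  let ρ : H →ₐ[K] Matrix (Fin (finrank K V)) (Fin (finrank K V)) K :=
    (LinearMap.toMatrixAlgEquiv b).toAlgHom.comp (Algebra.lsmul K K V)
  have hρ : ∀ h i j, ρ h i j = b.repr (h • b j) i := by
    intro h i j
    change LinearMap.toMatrixAlgEquiv b (Algebra.lsmul K K V h) i j = _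
    rw [LinearMap.toMatrixAlgEquiv_apply]; rfl
  have hρ' : ∀ h j, h • b j = ∑ i, ρ h i j • b i := by
    intro h j
    simp only [hρ]
    exact (b.sum_repr _).symm
  haveI : Nontrivial V := IsSimpleModule.nontrivial H V
  haveI : Nonempty (Fin (finrank K V)) := b.index_nonempty
  refine ⟨_, ρ, ?_, ?_⟩
  · have : ρ Λ = 0 := by
      ext i j
      rw [hρ, hnt (Λ • b j), map_zero]
      · rfl
      · intro h
        rw [smul_smul, hΛ.left, smul_assoc]
    rw [this, Matrix.rank_zero]
  · have φK : ∀ (c : K) v, φ (c • v) = c • φ v := by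
      intro c v
      rw [hsc, map_smul]
      ext w
      rw [hdual, Algebra.algebraMap_eq_smul_one, LinearMap.map_smul 𝒮, antipode_one, smul_assoc, one_smul, map_smul]
      rfl
    let B : V →ₗ[K] Dual K V := { toFun := φ, map_add' := map_add φ, map_smul' := φK }
    let Be : V ≃ₗ[K] Dual K V := LinearEquiv.ofBijective B φ.bijective
    let Q := Matrix.of fun i j => φ (b i) (b j)
    have hB : ∀ h v w, φ (h • v) w = φ v (𝒮 h • w) := by
      intro h v w; rw [map_smul, hdual]
    have hQt : Q = (LinearMap.toMatrix b b.dualBasis B)ᵀ := by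
      ext i j
      simp [Q, LinearMap.toMatrix_apply, B]
    have hQu : ∃ Q', Q * Q' = 1 := by
      refine ⟨(LinearMap.toMatrix b.dualBasis b Be.symm.toLinearMap)ᵀ, ?_⟩
      rw [hQt, ← Matrix.transpose_mul, ← LinearMap.toMatrix_comp]
      have : Be.symm.toLinearMap ∘ₗ B = LinearMap.id := by
        ext x; exact Be.symm_apply_apply x
      rw [this, LinearMap.toMatrix_id, Matrix.transpose_one]
    obtain ⟨Q', hQ'⟩ := hQu
    refine rank_tprod_one hΛ hl ρ Q Q' hQ' ?_ ?_
    · intro h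
      ext i j
      have h1 := hB h (b i) (b j)
      have h2 : ∀ v, φ v = B v := fun v => rfl
      rw [hρ', hρ', h2, h2, map_sum, map_sum, LinearMap.sum_apply] at h1
      simp only [map_smul, LinearMap.smul_apply, smul_eq_mul] at h1
      simp only [Matrix.mul_apply, Matrix.transpose_apply, Q, Matrix.of_apply, h2]
      rw [h1]
      exact Finset.sum_congr rfl fun _ _ => mul_comm _ _
    · intro M hM
      let L : V →ₗ[K] V := Matrix.toLin b b M
      have hL : ∀ (h : H) v, L (h • v) = h • L v := by
        intro h v
        have h3 : ρ h = LinearMap.toMatrix b b (Algebra.lsmul K K V h) := rfl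
        have h1 := congrArg (Matrix.toLin b b) (hM h)
        rw [Matrix.toLin_mul b b b, Matrix.toLin_mul b b b, h3, Matrix.toLin_toMatrix] at h1
        exact (congrArg (fun f : V →ₗ[K] V => f v) h1).symm
      let L' : Module.End H V := { toFun := L, map_add' := map_add L, map_smul' := hL }
      obtain ⟨c, hc⟩ := (IsSimpleModule.algebraMap_end_bijective_of_isAlgClosed
        (A := H) (V := V) K).2 L'
      refine ⟨c, ?_⟩
      have h4 : L = c • LinearMap.id := by
        ext v
        have := congrArg (fun f : Module.End H V => f v) hc
        exact this.symm
      have h5 := congrArg (LinearMap.toMatrix b b) h4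
      rw [LinearMap.toMatrix_toLin, map_smul, LinearMap.toMatrix_id] at h5
      exact h5
end hopf
end SDE
end

section
open HopfAlgebra Module Coalgebra Matrix
open scoped TensorProduct Kronecker
namespace SDE

lemma mtrace_sq_char_two {K X : Type*} [Field K] [CharP K 2] [Fintype X] [DecidableEq X]
    (A : Matrix X X K) : (A * A).trace = A.trace ^ 2 := by
  have h1 : (A * A).trace = ∑ p : X × X, A p.1 p.2 * A p.2 p.1 := by
    rw [Fintype.sum_prod_type]
    simp [Matrix.trace, Matrix.mul_apply]
  have h2 : A.trace ^ 2 = ∑ p : X × X, if p.1 = p.2 then A p.1 p.2 * A p.2 p.1 else 0 := by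
    rw [Fintype.sum_prod_type, Matrix.trace, sum_pow_char 2]
    simp [pow_two]
  rw [h1, h2, ← sub_eq_zero, ← Finset.sum_sub_distrib]
  refine Finset.sum_involution (fun p _ => p.swap) ?_ ?_ ?_ ?_
  · rintro ⟨i, j⟩ _
    by_cases h : i = j
    · simp [h]
    · simp only [h, Ne.symm h, if_false, Prod.swap, sub_zero]
      rw [mul_comm (A j i)]
      exact CharTwo.add_self_eq_zero _
  · rintro ⟨i, j⟩ _ h1 h2
    have : j = i := congrArg Prod.fst h2
    simp [this] at h1
  · simp
  · simp

lemma trace_sq_char_two {K V : Type*} [Field K] [CharP K 2] [AddCommGroup V] [Module K V]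
    [FiniteDimensional K V] (f : Module.End K V) :
    LinearMap.trace K V (f * f) = (LinearMap.trace K V f) ^ 2 := by
  let b := finBasis K V
  rw [LinearMap.trace_eq_matrix_trace K b, LinearMap.trace_eq_matrix_trace K b, LinearMap.toMatrix_mul]
  exact mtrace_sq_char_two _

section hopf
variable {K H : Type*} [Field K] [Ring H] [HopfAlgebra K H] [FiniteDimensional K H]

local notation "𝒮" => antipode K (A := H)

variable {Λ : H} {lam : Dual K H} (hΛ : IsInt (K := K) Λ) (hl : IsCoint lam)
variable {ι : Type*} [Fintype ι] [DecidableEq ι] {n : ι → Type*}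
  [∀ i, Fintype (n i)] [∀ i, DecidableEq (n i)]
variable (e : H ≃ₐ[K] Π i, Matrix (n i) (n i) K)

lemma trace_rank {X : Type*} [Fintype X] [DecidableEq X] (hΛ : IsInt (K := K) Λ)
    (ρ : H →ₐ[K] Matrix X X K) : (ρ Λ).trace = (ρ Λ).rank :=
  trace_of_idem _ (by rw [← map_mul, hΛ.idem])

include hΛ hl e in
theorem char_two_false [CharP K 2] {X : Type*} [Fintype X] [DecidableEq X]
    (ρ : H →ₐ[K] Matrix X X K) (h0 : (ρ Λ).rank = 0) (h1 : (tprod ρ ρ Λ).rank = 1) : False := by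
  let f : Dual K H := Matrix.traceLinearMap X K K ∘ₗ ρ.toLinearMap
  have hf : ∀ x y, f (x * y) = f (y * x) := fun x y => by
    simp only [f, LinearMap.comp_apply, AlgHom.toLinearMap_apply, map_mul,
      Matrix.traceLinearMap_apply]
    exact Matrix.trace_mul_comm _ _
  have hf0 : f Λ = 0 := by
    change (ρ Λ).trace = 0
    rw [trace_rank hΛ, h0]; simp
  have hff : (f ∘ₗ Rop f) Λ = 1 := by
    have := trace_tprod ρ ρ Λ
    rw [trace_rank hΛ, h1] at this
    rw [LinearMap.comp_apply, ← this]; simp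
  let T : Module.End K H := 𝒮 ∘ₗ 𝒮
  let R : Module.End K H := Rop f
  have hT : T * T = 1 := by
    ext x; exact antipode_four hΛ hl x
  have hc : T * R = R * T := by
    refine LinearMap.ext fun x => ?_
    change 𝒮 (𝒮 (Rop f x)) = Rop f (𝒮 (𝒮 x))
    rw [Rop_antipode_sq, tr_antipode_sq hΛ hl e _ hf]
  have t1 : LinearMap.trace K H (T * R) = 0 := by
    have := trace_Rop hΛ hl f
    rw [hf0, mul_eq_zero] at this
    exact this.resolve_left (ell_ne hΛ hl)
  have t2 : LinearMap.trace K H (T * (R * R)) ≠ 0 := by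
    have := trace_Rop hΛ hl (f ∘ₗ Rop f)
    rw [hff, ← Rop_comp] at this
    exact right_ne_zero_of_mul_eq_one this
  have t3 : LinearMap.trace K H (R * R) = 0 := by
    have : R * R = (T * R) * (T * R) := by
      rw [mul_assoc, ← mul_assoc R, ← hc, mul_assoc T R R, ← mul_assoc T T, hT, one_mul]
    rw [this, trace_sq_char_two, t1]; simp
  have hn : (T - 1) * (T - 1) = 0 := by
    have : (T - 1) * (T - 1) = T * T + 1 - (2 : K) • T := by
      rw [two_smul, mul_sub, sub_mul, sub_mul]; simp only [one_mul, mul_one]; abel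
    have h2 : (2 : K) = 0 := CharTwo.two_eq_zero
    rw [this, hT, h2, zero_smul, sub_zero, ← two_smul K, h2, zero_smul]
  have hcc : Commute (T - 1) (R * R) := by
    have : Commute T R := hc
    exact (this.mul_right this).sub_left (Commute.one_left _)
  have := (LinearMap.isNilpotent_trace_of_isNilpotent
    (hcc.isNilpotent_mul_right ⟨2, by rw [pow_two, hn]⟩)).eq_zero
  rw [sub_mul, one_mul, map_sub, t3, sub_zero] at this
  exact t2 this
end hopf
end SDE
end

section
open Module Matrix
namespace SDE

section adm
variable {L : Type*} [Field L]

def Adm (a a2 : L) : Prop := IsIntegral ℤ a ∧ ∃ u : L, IsIntegral ℤ u ∧ a ^ 2 - a2 = 2 * u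

lemma Adm.zero : Adm (0 : L) 0 := ⟨isIntegral_zero, 0, isIntegral_zero, by ring⟩

lemma Adm.add {a a2 b b2 : L} (ha : Adm a a2) (hb : Adm b b2) : Adm (a + b) (a2 + b2) := by
  obtain ⟨ha, u, hu, h⟩ := ha
  obtain ⟨hb, v, hv, h'⟩ := hb
  exact ⟨ha.add hb, u + v + a * b, (hu.add hv).add (ha.mul hb), by linear_combination h + h'⟩

lemma Adm.sum {ι : Type*} (s : Finset ι) (a a2 : ι → L) (h : ∀ i ∈ s, Adm (a i) (a2 i)) :
    Adm (∑ i ∈ s, a i) (∑ i ∈ s, a2 i) := by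
  classical
  induction s using Finset.induction_on with
  | empty => simpa using Adm.zero
  | insert i s hi ih =>
    rw [Finset.sum_insert hi, Finset.sum_insert hi]
    exact (h i (Finset.mem_insert_self _ _)).add (ih fun j hj => h j (Finset.mem_insert_of_mem hj))

lemma Adm.nat_mul {a a2 : L} (h : Adm a a2) (n : ℕ) : Adm ((n : L) * a) (n * a2) := by
  have := Adm.sum (Finset.range n) (fun _ => a) (fun _ => a2) (fun _ _ => h)
  simpa using this

lemma Adm.multiset (s : Multiset L) (h : ∀ x ∈ s, IsIntegral ℤ x) :
    Adm s.sum (s.map (fun x => x ^ 2)).sum := by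
  induction s using Multiset.induction_on with
  | empty => simpa using Adm.zero
  | cons x s ih =>
    rw [Multiset.map_cons, Multiset.sum_cons, Multiset.sum_cons]
    refine Adm.add ⟨h x (Multiset.mem_cons_self _ _), 0, isIntegral_zero, by ring⟩
      (ih fun y hy => h y (Multiset.mem_cons_of_mem hy))

lemma Adm.final [CharZero L] {a a2 b b2 : L} (N : ℤ) (ha : Adm a a2) (hb : Adm b b2)
    (h0 : a - b = 0) (h1 : a2 - b2 = N) : Even N := by
  obtain ⟨ha, u, hu, h⟩ := ha
  obtain ⟨hb, v, hv, h'⟩ := hb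
  have hab : a = b := sub_eq_zero.mp h0
  subst hab
  have hz : (2 : L) * (v - u) = (N : L) := by rw [← h1]; linear_combination h - h'
  have hInt : IsIntegral ℤ (v - u) := hv.sub hu
  have hq : v - u = algebraMap ℚ L (N / 2) := by
    have : (2 : L) ≠ 0 := two_ne_zero
    simp
    field_simp
    linear_combination hz
  rw [hq, isIntegral_algebraMap_iff (algebraMap ℚ L).injective] at hInt
  obtain ⟨m, hm⟩ := IsIntegrallyClosed.isIntegral_iff.mp hInt
  refine ⟨m, ?_⟩
  have : ((m : ℤ) : ℚ) = N / 2 := by simpa using hm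
  have : (N : ℚ) = m + m := by rw [this]; ring
  exact_mod_cast this

variable [IsAlgClosed L]

lemma charpoly_sq {X : Type*} [Fintype X] [DecidableEq X] (A : Matrix X X L) :
    (A * A).charpoly = ((A.charpoly.roots.map (fun x => x ^ 2)).map
      (fun a => Polynomial.X - Polynomial.C a)).prod := by
  have : Infinite L := IsAlgClosed.instInfinite
  apply Polynomial.funext
  intro r
  obtain ⟨t, rfl⟩ := IsAlgClosed.exists_pow_nat_eq r (n := 2) (by norm_num)
  have hs : ∀ t : L, A.charpoly.eval t = (A.charpoly.roots.map (fun a => t - a)).prod := by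
    intro t
    conv_lhs => rw [(IsAlgClosed.splits A.charpoly).eq_prod_roots_of_monic A.charpoly_monic]
    simp [Polynomial.eval_multiset_prod, Multiset.map_map]
  have e1 : (A * A).charpoly.eval (t ^ 2) = A.charpoly.eval t * (Matrix.scalar X t + A).det := by
    rw [Matrix.eval_charpoly, Matrix.eval_charpoly, ← Matrix.det_mul]
    congr 1
    have : Matrix.scalar X (t^2) = Matrix.scalar X t * Matrix.scalar X t := by
      rw [← map_mul, pow_two]
    rw [this]
    have hc : Matrix.scalar X t * A = A * Matrix.scalar X t :=
      (Matrix.scalar_commute t (fun r' => Commute.all _ _) A).eq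
    rw [sub_mul, mul_add, mul_add, hc]
    abel
  have e2 : (Matrix.scalar X t + A).det = (A.charpoly.roots.map (fun a => t + a)).prod := by
    have h1 : Matrix.scalar X t + A = - (Matrix.scalar X (-t) - A) := by
      rw [map_neg]; abel
    rw [h1, Matrix.det_neg, ← Matrix.eval_charpoly, hs]
    have : Fintype.card X = Multiset.card A.charpoly.roots := by
      rw [← A.charpoly_natDegree_eq_dim, (IsAlgClosed.splits A.charpoly).natDegree_eq_card_roots]
    rw [this]
    have h2 : (A.charpoly.roots.map (fun a => -t - a)) = (A.charpoly.roots.map (fun a => -(t + a))) := by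
      congr 1; ext a; ring
    rw [h2]
    rw [← Multiset.card_map (fun a => t + a)]
    have h3 := Multiset.prod_map_neg (A.charpoly.roots.map (fun a => t + a))
    rw [Multiset.map_map] at h3
    have h4 : (A.charpoly.roots.map (fun a => -(t + a))).prod = _ := h3
    rw [h4, ← mul_assoc, ← mul_pow]; simp
  rw [e1, e2, hs, ← Multiset.prod_map_mul, Polynomial.eval_multiset_prod, Multiset.map_map,
    Multiset.map_map]
  congr 1
  apply Multiset.map_congr rfl
  intro a _
  simp; ring

lemma trace_sq_roots {X : Type*} [Fintype X] [DecidableEq X] (A : Matrix X X L) :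
    (A * A).trace = (A.charpoly.roots.map (fun x => x ^ 2)).sum := by
  rw [Matrix.trace_eq_sum_roots_charpoly, charpoly_sq, Polynomial.roots_multiset_prod_X_sub_C]

lemma Adm.matrix {X : Type*} [Fintype X] [DecidableEq X] (A : Matrix X X L) (P : Polynomial ℤ)
    (hP : P.Monic) (h : Polynomial.aeval A P = 0) : Adm A.trace (A * A).trace := by
  rw [trace_sq_roots, Matrix.trace_eq_sum_roots_charpoly]
  apply Adm.multiset
  intro x hx
  rw [Polynomial.mem_roots A.charpoly_monic.ne_zero] at hx
  have h1 : x ∈ spectrum L A := Matrix.mem_spectrum_iff_isRoot_charpoly.mpr hx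
  refine ⟨P, hP, ?_⟩
  have h2 := spectrum.subset_polynomial_aeval A (P.map (algebraMap ℤ L)) ⟨x, h1, rfl⟩
  rw [Polynomial.aeval_map_algebraMap, h] at h2
  have : Nontrivial (Matrix X X L) := by
    by_contra hn
    rw [not_nontrivial_iff_subsingleton] at hn
    rw [spectrum.of_subsingleton] at h1
    exact h1
  rw [spectrum.zero_eq, Set.mem_singleton_iff] at h2
  rw [← h2]
  simp [Polynomial.eval_map]

end adm
end SDE
end

section
open HopfAlgebra Module Coalgebra Matrix
open scoped TensorProduct Kronecker
namespace SDE
section hopf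
variable {K H : Type*} [Field K] [Ring H] [HopfAlgebra K H] [FiniteDimensional K H]
local notation "𝒮" => antipode K (A := H)
variable {ι : Type*} [Fintype ι] [DecidableEq ι]
  {n : ι → Type*} [∀ i, Fintype (n i)] [∀ i, DecidableEq (n i)]
variable {Λ : H} {lam : Dual K H} (hΛ : IsInt (K := K) Λ) (hl : IsCoint lam)
variable (e : H ≃ₐ[K] Π i, Matrix (n i) (n i) K) (o : ∀ i, n i)
variable {r r' : ℕ} (b : Basis (Fin r ⊕ Fin r') K H)

/-- sign basis for the squared antipode -/
def IsSB : Prop := ∀ u, antipode K (antipode K (b u)) = (sgn u : ℤ) • b u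

variable (hb : IsSB b)

include hb in
lemma repr_antipode_sq (x : H) (u) : b.repr (𝒮 (𝒮 x)) u = (sgn u : K) * b.repr x u := by
  have h : (b.coord u) ∘ₗ 𝒮 ∘ₗ 𝒮 = (sgn u : K) • b.coord u := by
    refine b.ext fun v => ?_
    simp only [LinearMap.comp_apply, hb v, LinearMap.smul_apply, map_zsmul, Basis.coord_apply,
      Basis.repr_self]
    by_cases h : v = u
    · subst h; simp
    · simp [Finsupp.single_apply, h]
  exact LinearMap.congr_fun h x

include hb in
lemma Rmat_sign (f : Dual K H) (u v) :
    (sgn v : K) * LinearMap.toMatrix b b (Rop f) u v =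
      (sgn u : K) * LinearMap.toMatrix b b (Rop (f ∘ₗ 𝒮 ∘ₗ 𝒮)) u v := by
  rw [LinearMap.toMatrix_apply, LinearMap.toMatrix_apply, ← repr_antipode_sq b hb,
    ← Rop_antipode_sq, hb v, map_zsmul, map_zsmul]
  simp

/-- regular representation -/
noncomputable def piU : CR (fus e o) K →ₐ[K] Matrix (Fin r ⊕ Fin r') (Fin r ⊕ Fin r') K :=
  AlgHom.ofLinearMap ((LinearMap.toMatrix b b).toLinearMap ∘ₗ RopL ∘ₗ chi e o)
    (by
      simp only [LinearMap.comp_apply, chi_one, RopL_apply, LinearEquiv.coe_coe]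
      rw [← LinearMap.toMatrix_id b]
      rw [Rop_counit])
    (by
      intro x y
      simp only [LinearMap.comp_apply, chi_mul, RopL_apply, LinearEquiv.coe_coe]
      rw [← Rop_comp, LinearMap.toMatrix_comp b b b])

lemma piU_apply (c : CR (fus e o) K) : piU e o b c = LinearMap.toMatrix b b (Rop (chi e o c)) := rfl

include hΛ hl hb in
lemma piU_sign (c : CR (fus e o) K) (u v) :
    (sgn v : K) * piU e o b c u v = sgn u * piU e o b c u v := by
  rw [piU_apply, Rmat_sign b hb, tr_antipode_sq hΛ hl e _ (chi_tr e o c)]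

include hΛ hl hb in
lemma piU_block (h2 : (2 : K) ≠ 0) (c : CR (fus e o) K) :
    piU e o b c = fromBlocks (piU e o b c).toBlocks₁₁ 0 0 (piU e o b c).toBlocks₂₂ := by
  have key : ∀ x : K, -x = x → x = 0 := by
    intro x hx
    have : 2 * x = 0 := by linear_combination -hx
    exact (mul_eq_zero.mp this).resolve_left h2
  conv_lhs => rw [← fromBlocks_toBlocks (piU e o b c)]
  congr 1
  · ext u v
    have := piU_sign hΛ hl e o b hb c (Sum.inl u) (Sum.inr v)
    simp only [sgn, Sum.elim_inl, Sum.elim_inr, Int.cast_one, Int.cast_neg, one_mul, neg_one_mul] at this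
    exact key _ this
  · ext u v
    have := piU_sign hΛ hl e o b hb c (Sum.inr u) (Sum.inl v)
    simp only [sgn, Sum.elim_inl, Sum.elim_inr, Int.cast_one, Int.cast_neg, one_mul, neg_one_mul] at this
    exact key _ this.symm

include hΛ hl hb in
lemma exists_pi (h2 : (2 : K) ≠ 0) : ∃ (πp : CR (fus e o) K →ₐ[K] Matrix (Fin r) (Fin r) K)
    (πm : CR (fus e o) K →ₐ[K] Matrix (Fin r') (Fin r') K),
    ∀ c, piU e o b c = fromBlocks (πp c) 0 0 (πm c) := by
  have hm : ∀ x y : CR (fus e o) K, fromBlocks (piU e o b (x * y)).toBlocks₁₁ 0 0 (piU e o b (x * y)).toBlocks₂₂ =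
      fromBlocks ((piU e o b x).toBlocks₁₁ * (piU e o b y).toBlocks₁₁) 0 0
        ((piU e o b x).toBlocks₂₂ * (piU e o b y).toBlocks₂₂) := by
    intro x y
    rw [← piU_block hΛ hl e o b hb h2, map_mul]
    conv_lhs => rw [piU_block hΛ hl e o b hb h2 x, piU_block hΛ hl e o b hb h2 y]
    simp [fromBlocks_multiply]
  have h1 : (fromBlocks (piU e o b 1).toBlocks₁₁ 0 0 (piU e o b 1).toBlocks₂₂) =
      fromBlocks 1 0 0 1 := by
    rw [← piU_block hΛ hl e o b hb h2, map_one, fromBlocks_one]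
  refine ⟨AlgHom.ofLinearMap
    { toFun := fun c => (piU e o b c).toBlocks₁₁
      map_add' := fun x y => by rw [map_add]; rfl
      map_smul' := fun x y => by rw [map_smul]; rfl }
    (fromBlocks_inj.mp h1).1 (fun x y => (fromBlocks_inj.mp (hm x y)).1),
    AlgHom.ofLinearMap
    { toFun := fun c => (piU e o b c).toBlocks₂₂
      map_add' := fun x y => by rw [map_add]; rfl
      map_smul' := fun x y => by rw [map_smul]; rfl }
    (fromBlocks_inj.mp h1).2.2.2 (fun x y => (fromBlocks_inj.mp (hm x y)).2.2.2), ?_⟩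
  exact piU_block hΛ hl e o b hb h2

include hb in
lemma toMatrix_antipode_sq : LinearMap.toMatrix b b (𝒮 ∘ₗ 𝒮) =
    Matrix.diagonal fun u => (sgn u : K) := by
  ext u v
  rw [LinearMap.toMatrix_apply, LinearMap.comp_apply, repr_antipode_sq b hb, Matrix.diagonal_apply]
  by_cases h : u = v
  · subst h; simp
  · simp [h, Finsupp.single_apply, Ne.symm h]

lemma sum_sgn : ∑ u : Fin r ⊕ Fin r', sgn u = (r : ℤ) - r' := by
  simp [Fintype.sum_sum_type, sgn, sub_eq_add_neg]

include hb in
lemma trace_antipode_sq : LinearMap.trace K H (𝒮 ∘ₗ 𝒮) = (((r : ℤ) - r' : ℤ) : K) := by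
  rw [LinearMap.trace_eq_matrix_trace K b, toMatrix_antipode_sq b hb, Matrix.trace_diagonal,
    ← sum_sgn]
  push_cast; rfl

include hΛ in
lemma chi_Lam (c : CR (fus e o) K) : chi e o c Λ = CR.tau (thet e Λ) c := by
  rw [chi_apply, CR.tau_apply]
  refine Finset.sum_congr rfl fun i _ => ?_
  rw [← prj_apply, trace_rank hΛ]; rfl

include hΛ hl hb in
lemma trace_Rop' (f : Dual K H) : Matrix.trace ((Matrix.diagonal fun u => (sgn u : K)) *
    LinearMap.toMatrix b b (Rop f)) = (((r : ℤ) - r' : ℤ) : K) * f Λ := by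
  rw [← trace_antipode_sq b hb, ← toMatrix_antipode_sq b hb, ← LinearMap.toMatrix_comp b b b,
    ← LinearMap.trace_eq_matrix_trace K b]
  rw [← trace_Rop hΛ hl f, ← mul_assoc, mul_comm _ (lam Λ), ell_trace hΛ hl, one_mul]
  rfl

include hΛ hl hb in
lemma trace_piU (c : CR (fus e o) K) : Matrix.trace ((Matrix.diagonal fun u => (sgn u : K)) *
    piU e o b c) = (((r : ℤ) - r' : ℤ) : K) * CR.tau (thet e Λ) c := by
  rw [piU_apply, trace_Rop' hΛ hl b hb, chi_Lam hΛ]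

lemma trace_sgn_blocks {R : Type*} [CommRing R] (A : Matrix (Fin r) (Fin r) R)
    (D : Matrix (Fin r') (Fin r') R) :
    Matrix.trace ((Matrix.diagonal fun u => (sgn u : R)) * fromBlocks A 0 0 D) =
      A.trace - D.trace := by
  simp [Matrix.trace, Fintype.sum_sum_type, sgn, sub_eq_add_neg]

include hΛ hl e in
theorem char_zero_even [IsAlgClosed K] [CharZero K] (o : ∀ i, n i)
    {X : Type*} [Fintype X] [DecidableEq X]
    (ρ : H →ₐ[K] Matrix X X K) (h0 : (ρ Λ).rank = 0) (h1 : (tprod ρ ρ Λ).rank = 1) :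
    Even (finrank K H) := by
  have h2 : (2 : K) ≠ 0 := two_ne_zero
  obtain ⟨r, r', b, hb⟩ := exists_sign_basis h2 (𝒮 ∘ₗ 𝒮) (fun x => antipode_four hΛ hl x)
  have hb : IsSB b := hb
  obtain ⟨πp, πm, hπ⟩ := exists_pi hΛ hl e o b hb h2
  have htr : ∀ c, (πp c).trace - (πm c).trace = (((r : ℤ) - r' : ℤ) : K) * CR.tau (thet e Λ) c := by
    intro c
    rw [← trace_piU hΛ hl e o b hb, hπ, trace_sgn_blocks]
  obtain ⟨P, hP, hP0⟩ : IsIntegral ℤ (rcl e o ℤ ρ) := Algebra.IsIntegral.isIntegral _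
  have hx : Polynomial.aeval (rcl e o K ρ) P = 0 := by
    have := congrArg (CR.map (Int.castRingHom K)) hP0
    rw [Polynomial.hom_eval₂, map_zero, rcl_map] at this
    rw [← this, Polynomial.aeval_def]
    congr 1
    exact RingHom.ext_int _ _
  have hA : ∀ {Y : ℕ} (π : CR (fus e o) K →ₐ[K] Matrix (Fin Y) (Fin Y) K),
      Adm (π (rcl e o K ρ)).trace (π (rcl e o K ρ * rcl e o K ρ)).trace := by
    intro Y π
    rw [map_mul]
    refine Adm.matrix _ P hP ?_
    have := Polynomial.aeval_algHom_apply (π.restrictScalars ℤ) (rcl e o K ρ) P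
    rw [hx, map_zero] at this
    exact this
  have hev := Adm.final ((r : ℤ) - r') (hA πp) (hA πm)
    (by rw [htr, tau_rcl _ _ _ hΛ.idem, h0]; simp)
    (by rw [htr, ← rcl_tprod, tau_rcl _ _ _ hΛ.idem, h1]; simp)
  rw [Module.finrank_eq_card_basis b]
  simp only [Fintype.card_sum, Fintype.card_fin]
  have h3 : Even (((r + r' : ℕ) : ℤ)) := by
    push_cast
    have : (r : ℤ) + r' = (r - r') + 2 * r' := by ring
    rw [this]; exact hev.add (even_two_mul _)
  exact_mod_cast h3
end hopf
end SDE
end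

section
open Module Matrix
namespace SDE

lemma pow_dvd_step {A : Type*} [Ring A] (p j : ℕ) (hj : 1 ≤ j) {X Y : A} (hc : Commute X Y)
    (h : ((p ^ j : ℕ) : A) ∣ X - Y) : ((p ^ (j + 1) : ℕ) : A) ∣ X ^ p - Y ^ p := by
  have hd : ∀ {a : ℕ} {x y : A}, (a : A) ∣ y → (a : A) ∣ x * y := by
    rintro a x _ ⟨z, rfl⟩
    exact ⟨x * z, by rw [← mul_assoc, ← mul_assoc, (Nat.cast_commute a x).eq]⟩
  have hp1 : (p : A) ∣ X - Y := by
    obtain ⟨j, rfl⟩ := Nat.exists_eq_add_of_le hj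
    obtain ⟨z, hz⟩ := h
    rw [hz, pow_add, pow_one]; push_cast
    rw [mul_assoc]
    exact dvd_mul_right _ _
  have hpow : ∀ i, (p : A) ∣ X ^ i - Y ^ i := by
    intro i
    rw [← hc.mul_geom_sum₂]
    exact Dvd.dvd.mul_right hp1 _
  have hsum : (p : A) ∣ ∑ i ∈ Finset.range p, X ^ i * Y ^ (p - 1 - i) := by
    have : ∑ i ∈ Finset.range p, X ^ i * Y ^ (p - 1 - i) =
        ∑ i ∈ Finset.range p, (X ^ i - Y ^ i) * Y ^ (p - 1 - i) + p * Y ^ (p - 1) := by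
      rw [← nsmul_eq_mul]
      conv_rhs => rw [← Finset.card_range p, ← Finset.sum_const]
      simp only [Finset.card_range]
      rw [← Finset.sum_add_distrib]
      refine Finset.sum_congr rfl fun i hi => ?_
      have hi : i < p := Finset.mem_range.mp hi
      rw [sub_mul, ← pow_add]
      have : i + (p - 1 - i) = p - 1 := by omega
      rw [this]; abel
    rw [this]
    exact dvd_add (Finset.dvd_sum fun i _ => Dvd.dvd.mul_right (hpow i) _) (dvd_mul_right _ _)
  rw [← hc.mul_geom_sum₂]
  obtain ⟨z, hz⟩ := h
  obtain ⟨w, hw⟩ := hsum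
  rw [hz, hw, pow_succ]
  refine ⟨z * w, ?_⟩
  push_cast
  rw [mul_assoc, mul_assoc, ← mul_assoc z, (Nat.cast_commute p z).symm.eq, mul_assoc]

lemma pow_dvd_pow' {A : Type*} [Ring A] (p : ℕ) {X Y : A} (hc : Commute X Y)
    (h : (p : A) ∣ X - Y) (k : ℕ) : ((p ^ (k + 1) : ℕ) : A) ∣ X ^ p ^ k - Y ^ p ^ k := by
  induction k with
  | zero => simpa using h
  | succ k ih =>
    rw [pow_succ p k, pow_mul, pow_mul]
    exact pow_dvd_step p (k + 1) (by omega) (hc.pow_pow _ _) ih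

/-- truncated Witt data -/
structure Trunc (K R : Type*) [Field K] [CommRing R] (p k : ℕ) where
  red : R →+* K
  surj : Function.Surjective red
  ker : ∀ x, red x = 0 → ∃ y, x = p * y
  nil : (p : R) ^ (k + 1) = 0
  two : (2 : K) ≠ 0

namespace Trunc
variable {K R : Type*} [Field K] [CommRing R] {p k : ℕ} (T : Trunc K R p k)

lemma isNilpotent {x : R} (h : T.red x = 0) : IsNilpotent x := by
  obtain ⟨y, rfl⟩ := T.ker x h
  exact ⟨k + 1, by rw [mul_pow, T.nil, zero_mul]⟩

lemma isUnit {x : R} (h : T.red x ≠ 0) : IsUnit x := by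
  obtain ⟨y, hy⟩ := T.surj (T.red x)⁻¹
  have h1 : IsNilpotent (x * y - 1) := T.isNilpotent (by rw [map_sub, map_mul, hy]; simp [h])
  have h2 : IsUnit (x * y) := by
    have := h1.isUnit_one_add
    rwa [add_sub_cancel] at this
  exact isUnit_of_mul_isUnit_left h2

/-- section -/
noncomputable def sec (x : K) : R := by
  classical exact if x = 0 then 0 else (T.surj x).choose

lemma red_sec (x : K) : T.red (T.sec x) = x := by
  unfold sec
  split_ifs with h
  · simp [h]
  · exact (T.surj x).choose_spec

lemma sec_zero : T.sec 0 = 0 := by simp [sec]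

include T in
lemma two_mul_eq_zero {x : R} (h : 2 * x = 0) : x = 0 := by
  have : IsUnit (2 : R) := T.isUnit (by rw [map_ofNat]; exact T.two)
  exact (this.mul_right_eq_zero).mp h

variable {X Y : Type*} [Fintype X] [DecidableEq X] [Fintype Y] [DecidableEq Y]

lemma dvd_of_map {M : Matrix X X R} (h : M.map T.red = 0) : ((p : ℕ) : Matrix X X R) ∣ M := by
  have : ∀ i j, ∃ y, M i j = p * y := fun i j => T.ker _ (by
    have := congrFun (congrFun h i) j
    simpa using this)
  choose Z hZ using this
  refine ⟨Matrix.of Z, ?_⟩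
  ext i j
  rw [hZ, ← nsmul_eq_mul (p : ℕ) (Matrix.of Z)]
  simp

include T in
lemma nat_nil : ((p ^ (k + 1) : ℕ) : Matrix X X R) = 0 := by
  have := congrArg (algebraMap R (Matrix X X R)) T.nil
  simpa using this

lemma idem_zero {M : Matrix X X R} (h : M.map T.red = 0) (hM : M * M = M) : M = 0 := by
  obtain ⟨Z, hZ⟩ := T.dvd_of_map h
  have h1 : ∀ j, M ^ (j + 1) = M := by
    intro j
    induction j with
    | zero => simp
    | succ j ih => rw [pow_succ, ih, hM]
  rw [← h1 k, hZ, (Nat.cast_commute p Z).mul_pow, ← Nat.cast_pow, T.nat_nil, zero_mul]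

lemma idem_pow {M : Matrix X X R} (h : M.map T.red * M.map T.red = M.map T.red) :
    M ^ p ^ k * M ^ p ^ k = M ^ p ^ k := by
  have h1 : ((p : ℕ) : Matrix X X R) ∣ M * M - M := T.dvd_of_map (by
    rw [Matrix.map_sub _ (map_sub T.red), Matrix.map_mul, h, sub_self])
  have h2 := pow_dvd_pow' p ((Commute.refl M).mul_left (Commute.refl M)) h1 k
  rw [T.nat_nil, zero_dvd_iff, sub_eq_zero, (Commute.refl M).mul_pow] at h2
  exact h2

lemma map_pow' (M : Matrix X X R) (j : ℕ) : (M ^ j).map T.red = (M.map T.red) ^ j := by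
  exact map_pow (T.red.mapMatrix) M j

lemma idem_pow_map {M : Matrix X X R} (hp : 0 < p) (h : M.map T.red * M.map T.red = M.map T.red) :
    (M ^ p ^ k).map T.red = M.map T.red := by
  rw [T.map_pow']
  have hpos : 0 < p ^ k := by positivity
  obtain ⟨j, hj⟩ := Nat.exists_eq_succ_of_ne_zero hpos.ne'
  rw [hj]
  exact (IsIdempotentElem.pow_succ_eq j h)

lemma signed_trace (sX : X → ℤ) (sY : Y → ℤ) 
    (E : Matrix X X R) (hE : E * E = E)
    (hS : (diagonal fun x => (sX x : R)) * E = E * (diagonal fun x => (sX x : R)))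
    (U : Matrix X Y K) (V : Matrix Y X K) (hUV : E.map T.red = U * V) (hVU : V * U = 1)
    (hV : ∀ x y, sX x ≠ sY y → V y x = 0) :
    trace ((diagonal fun x => (sX x : R)) * E) = ∑ y, (sY y : R) := by
  let U1 : Matrix X Y R := U.map T.sec
  let V1 : Matrix Y X R := V.map T.sec
  have hU1 : U1.map T.red = U := by ext i j; simp [U1, T.red_sec]
  have hV1 : V1.map T.red = V := by ext i j; simp [V1, T.red_sec]
  let A : Matrix Y Y R := V1 * E * U1
  have hA : A.map T.red = 1 := by
    simp only [A, Matrix.map_mul, hU1, hV1, hUV]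
    rw [Matrix.mul_assoc, Matrix.mul_assoc, hVU, Matrix.mul_one, hVU]
  have hAu : IsUnit A.det := T.isUnit (by
    rw [RingHom.map_det]
    change (A.map T.red).det ≠ 0
    rw [hA]; simp)
  let U2 := E * U1 * A⁻¹
  let V2 := V1 * E
  have h1 : V2 * U2 = 1 := by
    calc V2 * U2 = V1 * (E * E) * U1 * A⁻¹ := by simp only [V2, U2, Matrix.mul_assoc]
      _ = 1 := by rw [hE]; exact Matrix.mul_nonsing_inv A hAu
  have hU2 : U2.map T.red = U := by
    have hAi : (A⁻¹).map T.red = 1 := by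
      have := congrArg (fun M : Matrix Y Y R => M.map T.red) (Matrix.mul_nonsing_inv A hAu)
      simp only [Matrix.map_mul, hA, Matrix.one_mul] at this
      rw [this]; simp
    simp only [U2, Matrix.map_mul, hAi, hU1, hUV, Matrix.mul_one]
    rw [Matrix.mul_assoc, hVU, Matrix.mul_one]
  have hV2 : V2.map T.red = V := by
    simp only [V2, Matrix.map_mul, hV1, hUV]
    rw [← Matrix.mul_assoc, hVU, Matrix.one_mul]
  have hEV : V2 * E = V2 := by simp only [V2]; rw [Matrix.mul_assoc, hE]
  have hEU : E * U2 = U2 := by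
    simp only [U2]; rw [← Matrix.mul_assoc, ← Matrix.mul_assoc, hE]
  have hF : E = U2 * V2 := by
    rw [← sub_eq_zero]
    apply T.idem_zero
    · rw [Matrix.map_sub _ (map_sub T.red), Matrix.map_mul, hU2, hV2, hUV, sub_self]
    · rw [sub_mul, mul_sub, mul_sub, hE, ← Matrix.mul_assoc, hEU, Matrix.mul_assoc U2 V2 E, hEV,
        Matrix.mul_assoc U2 V2, ← Matrix.mul_assoc V2 U2, h1, Matrix.one_mul]
      abel
  have hVs : V1 * (diagonal fun x => (sX x : R)) = (diagonal fun y => (sY y : R)) * V1 := by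
    ext y x
    rw [Matrix.mul_diagonal, Matrix.diagonal_mul]
    by_cases h : sX x = sY y
    · rw [h, mul_comm]
    · have : V1 y x = 0 := by simp [V1, hV x y h, T.sec_zero]
      simp [this]
  have hV2s : V2 * (diagonal fun x => (sX x : R)) = (diagonal fun y => (sY y : R)) * V2 := by
    simp only [V2]
    rw [Matrix.mul_assoc, ← hS, ← Matrix.mul_assoc, hVs, Matrix.mul_assoc]
  conv_lhs => rw [hF]
  rw [← Matrix.mul_assoc, Matrix.trace_mul_comm, ← Matrix.mul_assoc, hV2s, Matrix.mul_assoc, h1,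
    Matrix.mul_one, Matrix.trace_diagonal]

lemma trace_idem (E : Matrix X X R) (hE : E * E = E) : trace E = ((E.map T.red).rank : R) := by
  have hE' : E.map T.red * E.map T.red = E.map T.red := by rw [← Matrix.map_mul, hE]
  obtain ⟨U, V, h1, h2⟩ := exists_factor _ hE'
  have := T.signed_trace (fun _ => 1) (fun _ => 1) E hE (by simp) U V h1 h2 (by simp)
  simpa using this

end Trunc
end SDE
end

section
open Module Matrix
namespace SDE

section lp
variable {A B : Type*} [Monoid A] [Monoid B]

/-- ordered product -/
def lp {q : ℕ} (f : Fin q → A) : A := (List.ofFn f).prod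

lemma lp_zero (f : Fin 0 → A) : lp f = 1 := by simp [lp]
lemma lp_succ {q : ℕ} (f : Fin (q + 1) → A) : lp f = f 0 * lp (fun i => f i.succ) := by
  simp [lp, List.ofFn_succ]
lemma map_lp (φ : A →* B) {q : ℕ} (f : Fin q → A) : φ (lp f) = lp (fun i => φ (f i)) := by
  simp [lp, map_list_prod, List.map_ofFn, Function.comp_def]

lemma lp_smul {R A : Type*} [CommRing R] [Ring A] [Algebra R A] {q : ℕ} (r : Fin q → R)
    (f : Fin q → A) : lp (fun i => r i • f i) = (∏ i, r i) • lp f := by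
  induction q with
  | zero => simp [lp_zero]
  | succ q ih =>
    rw [lp_succ, ih, lp_succ f, Fin.prod_univ_succ, smul_mul_assoc, mul_smul_comm, smul_smul]

lemma sum_pow_lp {A κ : Type*} [Ring A] [Fintype κ] (M : κ → A) (q : ℕ) :
    (∑ k, M k) ^ q = ∑ s : Fin q → κ, lp (fun x => M (s x)) := by
  induction q with
  | zero => simp [lp_zero]
  | succ q ih =>
    rw [pow_succ', ih, ← (Fin.consEquiv fun _ => κ).sum_comp, Fintype.sum_prod_type, Finset.sum_mul]
    refine Finset.sum_congr rfl fun k _ => ?_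
    rw [Finset.mul_sum]
    refine Finset.sum_congr rfl fun s _ => ?_
    rw [lp_succ]
    simp
end lp

section pk
variable {R : Type*} [CommRing R] {Q : Type*} [Fintype Q] [DecidableEq Q]
  {Y : Q → Type*} [∀ x, Fintype (Y x)] [∀ x, DecidableEq (Y x)]

/-- Kronecker product of a family -/
def piK (M : ∀ x, Matrix (Y x) (Y x) R) : Matrix (∀ x, Y x) (∀ x, Y x) R :=
  Matrix.of fun f g => ∏ x, M x (f x) (g x)

lemma piK_apply (M : ∀ x, Matrix (Y x) (Y x) R) (f g) : piK M f g = ∏ x, M x (f x) (g x) := rfl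

lemma piK_mul (M N : ∀ x, Matrix (Y x) (Y x) R) : piK M * piK N = piK (M * N) := by
  ext f g
  simp only [Matrix.mul_apply, piK_apply, Pi.mul_apply]
  rw [Finset.prod_univ_sum, Fintype.piFinset_univ]
  exact Finset.sum_congr rfl fun h _ => Finset.prod_mul_distrib.symm

lemma piK_diag (s : ∀ x, Y x → R) : piK (fun x => diagonal (s x)) = diagonal (fun f => ∏ x, s x (f x)) := by
  ext f g
  rw [piK_apply]
  by_cases h : f = g
  · subst h; simp
  · rw [diagonal_apply_ne _ h]
    obtain ⟨x, hx⟩ := Function.ne_iff.mp h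
    exact Finset.prod_eq_zero (Finset.mem_univ x) (diagonal_apply_ne _ hx)

lemma piK_one : piK (1 : ∀ x, Matrix (Y x) (Y x) R) = 1 := by
  have := piK_diag (R := R) (Y := Y) (fun _ _ => 1)
  simp only [Finset.prod_const_one, diagonal_one] at this
  exact this

/-- as a hom -/
def piKhom : (∀ x, Matrix (Y x) (Y x) R) →* Matrix (∀ x, Y x) (∀ x, Y x) R where
  toFun := piK
  map_one' := piK_one
  map_mul' M N := (piK_mul M N).symm

lemma trace_piK (M : ∀ x, Matrix (Y x) (Y x) R) : trace (piK M) = ∏ x, trace (M x) := by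
  simp only [trace, diag_apply, piK_apply]
  rw [Finset.prod_univ_sum, Fintype.piFinset_univ]

lemma piK_map {R' : Type*} [CommRing R'] (φ : R →+* R') (M : ∀ x, Matrix (Y x) (Y x) R) :
    (piK M).map φ = piK (fun x => (M x).map φ) := by
  ext f g; simp [piK_apply]

lemma piK_smul (r : Q → R) (M : ∀ x, Matrix (Y x) (Y x) R) :
    piK (fun x => r x • M x) = (∏ x, r x) • piK M := by
  ext f g; simp [piK_apply, Finset.prod_mul_distrib]

lemma lp_piK {q : ℕ} (M : Fin q → ∀ x, Matrix (Y x) (Y x) R) :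
    lp (fun t => piK (M t)) = piK (fun x => lp (fun t => M t x)) := by
  have h1 : lp (fun t => piK (M t)) = piK (lp M) := (map_lp piKhom M).symm
  rw [h1]
  congr 1
  ext1 x
  exact map_lp (Pi.evalMonoidHom (fun x => Matrix (Y x) (Y x) R) x) M

lemma trace_pi_pow {I : Type*} [Fintype I] [DecidableEq I] (b : ∀ y, I → Matrix (Y y) (Y y) R)
    (s : ∀ y, Matrix (Y y) (Y y) R) (α : (Q → I) → R) (q : ℕ) :
    trace (piK s * (∑ w : Q → I, α w • piK (fun y => b y (w y))) ^ q) =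
      ∑ σ : Fin q → (Q → I), (∏ x, α (σ x)) * ∏ y, trace (s y * lp fun x => b y (σ x y)) := by
  rw [sum_pow_lp, Finset.mul_sum, trace_sum]
  refine Finset.sum_congr rfl fun σ _ => ?_
  rw [lp_smul, lp_piK, mul_smul_comm, trace_smul, piK_mul, trace_piK, smul_eq_mul]
  rfl
end pk

theorem grid {R : Type*} [CommRing R] {ι U I : Type*} [Fintype ι] [DecidableEq ι] [Fintype U]
    [DecidableEq U] [Fintype I] [DecidableEq I]
    {n : ι → Type*} [∀ i, Fintype (n i)] [∀ i, DecidableEq (n i)]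
    (a : ∀ i, I → Matrix (n i) (n i) R) (c : ι → R) (b : I → Matrix U U R) (s : Matrix U U R)
    (q m : ℕ) (α : (Fin m → I) → R) (β : (Fin q → I) → R)
    (hα : ∀ w, α w = ∑ i, c i * trace (lp fun y => a i (w y)))
    (hβ : ∀ w, β w = trace (s * lp fun x => b (w x))) :
    trace (piK (fun _ : Fin m => s) * (∑ w, α w • piK (fun y => b (w y))) ^ q) =
      ∑ J : Fin q → ι, (∏ x, c (J x)) *
        trace ((∑ w, β w • piK (fun x => a (J x) (w x))) ^ m) := by
  rw [trace_pi_pow (fun _ => b) (fun _ => s)]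
  have h1 : ∀ J : Fin q → ι, trace ((∑ w, β w • piK (fun x => a (J x) (w x))) ^ m) =
      ∑ t : Fin m → (Fin q → I), (∏ y, β (t y)) * ∏ x, trace (lp fun y => a (J x) (t y x)) := by
    intro J
    have := trace_pi_pow (fun x => a (J x)) (fun x => 1) β m
    have h1 : piK (fun x => (1 : Matrix (n (J x)) (n (J x)) R)) = 1 := piK_one
    rw [h1, Matrix.one_mul] at this
    rw [this]
    simp only [Matrix.one_mul]
  simp only [h1, Finset.mul_sum]
  rw [Finset.sum_comm]
  rw [← (Equiv.piComm fun (_ : Fin q) (_ : Fin m) => I).sum_comp]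
  refine Finset.sum_congr rfl fun σ _ => ?_
  simp only [hα, hβ, Equiv.piComm_apply, Function.swap]
  rw [Finset.prod_univ_sum, Fintype.piFinset_univ, Finset.sum_mul]
  refine Finset.sum_congr rfl fun J _ => ?_
  rw [Finset.prod_mul_distrib]
  ring
end SDE
end

section
open HopfAlgebra Module Coalgebra Matrix
open scoped TensorProduct Kronecker
namespace SDE
section hopf
variable {K H : Type*} [Field K] [Ring H] [HopfAlgebra K H]
local notation "𝒮" => antipode K (A := H)

/-- convolution products -/
noncomputable def cv : ∀ {q : ℕ}, (Fin q → Dual K H) → Dual K H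
  | 0, _ => counit
  | _ + 1, g => g 0 ∘ₗ Rop (cv (fun i => g i.succ))

lemma cv_zero (g : Fin 0 → Dual K H) : cv g = counit := rfl
lemma cv_succ {q : ℕ} (g : Fin (q + 1) → Dual K H) : cv g = g 0 ∘ₗ Rop (cv (fun i => g i.succ)) := rfl

lemma Rop_cv {q : ℕ} (g : Fin q → Dual K H) :
    Rop (cv g) = lp (A := Module.End K H) (fun i => Rop (g i)) := by
  induction q with
  | zero => rw [lp_zero, cv_zero, Rop_counit]; rfl
  | succ q ih => rw [lp_succ, cv_succ, ← Rop_comp, ih]; rfl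

variable {I : Type*} [Fintype I] [DecidableEq I] (b : Basis I K H)

lemma toMatrix_cv {q : ℕ} (g : Fin q → Dual K H) :
    LinearMap.toMatrix b b (Rop (cv g)) = lp (fun i => LinearMap.toMatrix b b (Rop (g i))) := by
  rw [Rop_cv]
  exact map_lp (LinearMap.toMatrixAlgEquiv b : Module.End K H →* Matrix I I K) _

variable {ι : Type*} [Fintype ι] [DecidableEq ι]
  {n : ι → Type*} [∀ i, Fintype (n i)] [∀ i, DecidableEq (n i)]
variable (e : H ≃ₐ[K] Π i, Matrix (n i) (n i) K) (o : ∀ i, n i)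

lemma reindex_rep {X Y : Type*} [Fintype X] [DecidableEq X] [Fintype Y] [DecidableEq Y]
    (f : X ≃ Y) (R : Type*) [CommRing R] (σ : H →ₐ[K] Matrix X X K) :
    ∃ σ' : H →ₐ[K] Matrix Y Y K, (∀ x y y', σ' x y y' = σ x (f.symm y) (f.symm y')) ∧
      rcl e o R σ' = rcl e o R σ := by
  refine ⟨(Matrix.reindexAlgEquiv K K f).toAlgHom.comp σ, fun x y y' => rfl, ?_⟩
  ext i
  rw [rcl_apply, rcl_apply, cls_congr e o (f := f.symm) ((Matrix.reindexAlgEquiv K K f).toAlgHom.comp σ) σ]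
  intro x; rfl

theorem exists_sgm (R : Type*) [CommRing R] (q : ℕ) (Y : Fin q → Type) [∀ x, Fintype (Y x)]
    [∀ x, DecidableEq (Y x)] (ρ : ∀ x, H →ₐ[K] Matrix (Y x) (Y x) K) :
    ∃ σ : H →ₐ[K] Matrix (∀ x, Y x) (∀ x, Y x) K,
      (∀ y, σ y = ∑ w : Fin q → I, cv (fun x => b.coord (w x)) y • piK (fun x => ρ x (b (w x)))) ∧
      rcl e o R σ = lp (fun x => rcl e o R (ρ x)) := by
  induction q with
  | zero =>
    obtain ⟨σ, h1, h2⟩ := reindex_rep e o (Equiv.ofUnique Unit (∀ x, Y x)) R (trivRep (K := K) (H := H))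
    refine ⟨σ, fun y => ?_, by rw [h2, rcl_triv, lp_zero]⟩
    ext f g
    rw [h1, trivRep_apply]
    simp [cv_zero, piK_apply]
  | succ q ih =>
    obtain ⟨σ', h1, h2⟩ := ih (fun x => Y x.succ) (fun x => ρ x.succ)
    obtain ⟨σ, h3, h4⟩ := reindex_rep e o (Fin.consEquiv Y) R (tprod (ρ 0) σ')
    refine ⟨σ, fun y => ?_, by rw [h4, rcl_tprod, h2, lp_succ]⟩
    ext f g
    rw [h3, tprod_repr _ _ (ℛ K y)]
    rw [← (Fin.consEquiv fun _ => I).sum_comp, Fintype.sum_prod_type]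
    simp only [Matrix.sum_apply, Matrix.smul_apply, cv_succ, piK_apply, Fin.prod_univ_succ,
      Fin.consEquiv_apply, Fin.cons_zero, Fin.cons_succ, LinearMap.comp_apply, Rop_repr _ (ℛ K y),
      Matrix.kronecker_apply, h1, smul_eq_mul, map_sum, map_smul]
    have h5 : ∀ z, ρ 0 z (f 0) (g 0) = ∑ u, b.coord u z * ρ 0 (b u) (f 0) (g 0) := by
      intro z
      have h := congrArg (fun t => ρ 0 t (f 0) (g 0)) (b.sum_repr z)
      simp only [map_sum, Matrix.sum_apply, map_smul, Matrix.smul_apply, smul_eq_mul] at h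
      exact h.symm
    have h6 : ((Fin.consEquiv Y).symm f) = ((f 0, fun x : Fin q => f x.succ) : Y 0 × ∀ i : Fin q, Y i.succ) := rfl
    have h7 : ((Fin.consEquiv Y).symm g) = ((g 0, fun x : Fin q => g x.succ) : Y 0 × ∀ i : Fin q, Y i.succ) := rfl
    have h5' := fun i => h5 ((ℛ K y).left i)
    simp only [h6, h7, Matrix.kroneckerMap_apply, Matrix.sum_apply, Matrix.smul_apply, piK_apply,
      smul_eq_mul, h5']
    simp only [Finset.sum_mul, Finset.mul_sum]
    rw [Finset.sum_comm]
    conv_rhs => rw [Finset.sum_comm]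
    refine Finset.sum_congr rfl fun w _ => ?_
    rw [Finset.sum_comm]
    refine Finset.sum_congr rfl fun u _ => Finset.sum_congr rfl fun i _ => ?_
    ring
end hopf
end SDE
end

section
open HopfAlgebra Module Coalgebra Matrix
open scoped TensorProduct Kronecker
namespace SDE
section hopf
variable {K H : Type*} [Field K] [Ring H] [HopfAlgebra K H] [FiniteDimensional K H]
local notation "𝒮" => antipode K (A := H)
variable {ι : Type*} [Fintype ι] [DecidableEq ι]
  {n : ι → Type} [∀ i, Fintype (n i)] [∀ i, DecidableEq (n i)]
variable {Λ : H} {lam : Dual K H} (hΛ : IsInt (K := K) Λ) (hl : IsCoint lam)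
variable (e : H ≃ₐ[K] Π i, Matrix (n i) (n i) K) (o : ∀ i, n i)
variable {r r' : ℕ} (b : Basis (Fin r ⊕ Fin r') K H) (hb : IsSB b)
variable {R : Type*} [CommRing R] {p k : ℕ} (T : Trunc K R p k)

/-- lifted blocks -/
noncomputable def aL (i : ι) (u : Fin r ⊕ Fin r') : Matrix (n i) (n i) R := (e (b u) i).map T.sec

/-- lifted coregular operators -/
noncomputable def bL (u : Fin r ⊕ Fin r') : Matrix (Fin r ⊕ Fin r') (Fin r ⊕ Fin r') R :=
  (LinearMap.toMatrix b b (Rop (b.coord u))).map T.sec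

/-- the sign matrix -/
def sL (R : Type*) [CommRing R] (r r' : ℕ) : Matrix (Fin r ⊕ Fin r') (Fin r ⊕ Fin r') R :=
  diagonal fun u => ((sgn u : ℤ) : R)

noncomputable def betL {q : ℕ} (w : Fin q → Fin r ⊕ Fin r') : R :=
  trace (sL R r r' * lp fun x => bL b T (w x))

lemma aL_map (i : ι) (u) : (aL e b T i u).map T.red = e (b u) i := by
  ext x y; simp [aL, T.red_sec]

lemma bL_map (u) : (bL b T u).map T.red = LinearMap.toMatrix b b (Rop (b.coord u)) := by
  ext x y; simp [bL, T.red_sec]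

lemma sL_map {R' : Type*} [CommRing R'] (f : R →+* R') : (sL R r r').map f = sL R' r r' := by
  rw [sL, sL, Matrix.diagonal_map (map_zero f)]
  simp

lemma lp_map {R' : Type*} [CommRing R'] (f : R →+* R') {X : Type*} [Fintype X] [DecidableEq X]
    {q : ℕ} (M : Fin q → Matrix X X R) :
    (lp M).map f = lp (fun x => (M x).map f) :=
  map_lp (RingHom.toMonoidHom f.mapMatrix) M

lemma trace_map' {R' : Type*} [CommRing R'] (f : R →+* R') {X : Type*} [Fintype X]
    (M : Matrix X X R) : f (trace M) = trace (M.map f) := by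
  simp [trace]

include hΛ hl hb in
lemma red_betL {q : ℕ} (w : Fin q → Fin r ⊕ Fin r') : T.red (betL b T w) =
    (((r : ℤ) - r' : ℤ) : K) * cv (fun x => b.coord (w x)) Λ := by
  rw [betL, trace_map', Matrix.map_mul, sL_map, lp_map]
  simp only [bL_map]
  rw [← toMatrix_cv]
  exact trace_Rop' hΛ hl b hb _

include hΛ hl hb in
lemma N_ne : (((r : ℤ) - r' : ℤ) : K) ≠ 0 := by
  rw [← trace_antipode_sq b hb]
  exact right_ne_zero_of_mul_eq_one (ell_trace hΛ hl)

include hΛ hl hb in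
theorem rows_J (hp : 0 < p) {q : ℕ} (J : Fin q → ι) :
    trace ((∑ w : Fin q → Fin r ⊕ Fin r', betL b T w • piK (fun x => aL e b T (J x) (w x))) ^ p ^ k)
     = (((r : ℤ) - r' : ℤ) : R) ^ p ^ k *
      CR.tau (thet e Λ) (lp (fun x => (CR.bas (J x) : CR (fus e o) R))) := by
  obtain ⟨σ, h1, h2⟩ := exists_sgm b e o R q (fun x => n (J x)) (fun x => prj e (J x))
  obtain ⟨N, hN⟩ : IsUnit (((r : ℤ) - r' : ℤ) : R) := T.isUnit (by
    rw [map_intCast]; exact N_ne hΛ hl b hb)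
  set Γ := ∑ w : Fin q → Fin r ⊕ Fin r', betL b T w • piK (fun x => aL e b T (J x) (w x)) with hΓ
  have hΓm : Γ.map T.red = (((r : ℤ) - r' : ℤ) : K) • σ Λ := by
    rw [h1, hΓ]
    change T.red.mapMatrix (∑ w : Fin q → Fin r ⊕ Fin r', _) = _
    rw [map_sum, Finset.smul_sum]
    refine Finset.sum_congr rfl fun w _ => ?_
    rw [smul_smul, ← red_betL hΛ hl b hb T]
    change (betL b T w • piK (fun x => aL e b T (J x) (w x))).map T.red = _
    have : (piK (fun x => aL e b T (J x) (w x))).map T.red =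
        piK (fun x => prj e (J x) (b (w x))) := by
      rw [piK_map]; simp only [aL_map, prj_apply]
    rw [← this]
    ext f g
    simp
  let G := (↑N⁻¹ : R) • Γ
  have hG : G.map T.red = σ Λ := by
    have h3 : G.map T.red = T.red (↑N⁻¹ : R) • Γ.map T.red := by ext f g; simp [G]
    rw [h3, hΓm, smul_smul]
    have : T.red (↑N⁻¹ : R) * (((r : ℤ) - r' : ℤ) : K) = 1 := by
      rw [← map_intCast T.red, ← hN, ← map_mul]; simp
    rw [this, one_smul]
  have hGi : G.map T.red * G.map T.red = G.map T.red := by rw [hG, ← map_mul, hΛ.idem]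
  have hΓG : Γ = (N : R) • G := by simp [G, smul_smul]
  rw [hΓG, smul_pow, trace_smul, T.trace_idem _ (T.idem_pow hGi), T.idem_pow_map hp hGi, hG,
    ← tau_rcl e o R hΛ.idem, h2, hN, smul_eq_mul]
  simp only [rcl_prj]

include hΛ hl hb in
theorem rows (hp : 0 < p) (q : ℕ) (c : CR (fus e o) R) :
    ∑ J : Fin q → ι, (∏ x, c (J x)) * trace ((∑ w : Fin q → Fin r ⊕ Fin r',
      betL b T w • piK (fun x => aL e b T (J x) (w x))) ^ p ^ k)
     = (((r : ℤ) - r' : ℤ) : R) ^ p ^ k * CR.tau (thet e Λ) (c ^ q) := by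
  conv_rhs => rw [CR.eq_sum c, sum_pow_lp, map_sum, Finset.mul_sum]
  refine Finset.sum_congr rfl fun J _ => ?_
  rw [rows_J hΛ hl e o b hb T hp, lp_smul, map_smul, smul_eq_mul]
  ring
end hopf
end SDE
end

section
open HopfAlgebra Module Coalgebra Matrix
open scoped TensorProduct Kronecker
namespace SDE
section Xi
variable {K H : Type*} [Field K] [Ring H] [HopfAlgebra K H]
local notation "𝒮" => antipode K (A := H)
variable {I : Type*} [Fintype I] [DecidableEq I] (b : Basis I K H)
variable {Z : Type*} [Fintype Z] [DecidableEq Z] (D : Dual K H →ₗ[K] Matrix Z Z K)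

/-- canonical element attached to a map -/
noncomputable def Xi : (H →ₗ[K] Module.End K H) →ₗ[K] Matrix (I × Z) (I × Z) K where
  toFun F := ∑ u, LinearMap.toMatrix b b (F (b u)) ⊗ₖ D (b.coord u)
  map_add' F G := by
    rw [← Finset.sum_add_distrib]
    refine Finset.sum_congr rfl fun u _ => ?_
    rw [LinearMap.add_apply, map_add, Matrix.add_kronecker]
  map_smul' c F := by
    rw [RingHom.id_apply, Finset.smul_sum]
    refine Finset.sum_congr rfl fun u _ => ?_
    rw [LinearMap.smul_apply, map_smul, Matrix.smul_kronecker]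

lemma Xi_apply (F : H →ₗ[K] Module.End K H) :
    Xi b D F = ∑ u, LinearMap.toMatrix b b (F (b u)) ⊗ₖ D (b.coord u) := rfl

lemma dual_eq_sum (g : Dual K H) : g = ∑ u, g (b u) • b.coord u := by
  refine b.ext fun v => ?_
  rw [LinearMap.sum_apply, Finset.sum_eq_single v]
  · simp
  · intro u _ h; simp [h.symm]
  · simp

lemma kron_sum {X Y : Type*} {J : Type*} (s : Finset J) (A : Matrix X X K) (B : J → Matrix Y Y K) :
    A ⊗ₖ (∑ j ∈ s, B j) = ∑ j ∈ s, A ⊗ₖ B j := by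
  ext x y
  simp [Matrix.sum_apply, Finset.mul_sum]

lemma sum_kron {X Y : Type*} {J : Type*} (s : Finset J) (A : J → Matrix X X K) (B : Matrix Y Y K) :
    (∑ j ∈ s, A j) ⊗ₖ B = ∑ j ∈ s, A j ⊗ₖ B := by
  ext x y
  simp [Matrix.sum_apply, Finset.sum_mul]

lemma Xi_smulRight (g : Dual K H) (A : Module.End K H) :
    Xi b D (g.smulRight A) = LinearMap.toMatrix b b A ⊗ₖ D g := by
  conv_rhs => rw [dual_eq_sum b g, map_sum, kron_sum]
  rw [Xi_apply]
  refine Finset.sum_congr rfl fun u _ => ?_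
  rw [LinearMap.smulRight_apply, map_smul, map_smul, Matrix.smul_kronecker, Matrix.kronecker_smul]

lemma Xi_mul (hD : ∀ f g, D (f ∘ₗ Rop g) = D f * D g) (F G J : H →ₗ[K] Module.End K H)
    (h : ∀ z, ∑ i ∈ (ℛ K z).index, F ((ℛ K z).left i) * G ((ℛ K z).right i) = J z) :
    Xi b D F * Xi b D G = Xi b D J := by
  have hJ : J = ∑ u, ∑ v, (b.coord u ∘ₗ Rop (b.coord v)).smulRight (F (b u) * G (b v)) := by
    refine LinearMap.ext fun z => ?_
    rw [← h z, LinearMap.sum_apply]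
    simp only [LinearMap.sum_apply, LinearMap.smulRight_apply, LinearMap.comp_apply]
    have : ∀ i, F ((ℛ K z).left i) * G ((ℛ K z).right i) = ∑ u, ∑ v,
        (b.coord u ((ℛ K z).left i) * b.coord v ((ℛ K z).right i)) • (F (b u) * G (b v)) := by
      intro i
      conv_lhs => rw [← b.sum_repr ((ℛ K z).left i), ← b.sum_repr ((ℛ K z).right i)]
      rw [map_sum, map_sum, Finset.sum_mul_sum]
      refine Finset.sum_congr rfl fun u _ => Finset.sum_congr rfl fun v _ => ?_
      rw [map_smul, map_smul, smul_mul_smul_comm]; rfl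
    simp only [this]
    rw [Finset.sum_comm]
    refine Finset.sum_congr rfl fun u _ => ?_
    rw [Finset.sum_comm]
    refine Finset.sum_congr rfl fun v _ => ?_
    rw [← Finset.sum_smul, Rop_repr _ (ℛ K z), map_sum]
    congr 1
    refine Finset.sum_congr rfl fun i _ => ?_
    rw [map_smul, smul_eq_mul, mul_comm]
  rw [hJ, map_sum, Xi_apply, Xi_apply, Finset.sum_mul_sum]
  refine Finset.sum_congr rfl fun u _ => ?_
  rw [map_sum]
  refine Finset.sum_congr rfl fun v _ => ?_
  rw [Xi_smulRight, hD, ← Matrix.mul_kronecker_mul]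
  congr 1
  exact (LinearMap.toMatrix_comp b b b _ _).symm

/-- right multiplication -/
noncomputable def Mr : H →ₗ[K] Module.End K H := (LinearMap.mul K H).flip

lemma Mr_apply (z x : H) : Mr (K := K) z x = x * z := rfl

/-- z to Rop (f (· z)) -/
noncomputable def Fop (f : Dual K H) : H →ₗ[K] Module.End K H :=
  RopL ∘ₗ (LinearMap.compRight K f) ∘ₗ Mr

lemma Fop_apply (f : Dual K H) (z : H) : Fop f z = Rop (f ∘ₗ Mr z) := rfl

lemma Rop_mul (f : Dual K H) (x z : H) : Rop f (x * z) =
    ∑ i ∈ (ℛ K z).index, Rop (f ∘ₗ Mr ((ℛ K z).right i)) x * (ℛ K z).left i := by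
  simp only [Rop_repr _ (ℛ K x)]
  have : comul (R := K) (x * z) = ∑ j ∈ (ℛ K x).index, ∑ i ∈ (ℛ K z).index,
      ((ℛ K x).left j * (ℛ K z).left i) ⊗ₜ[K] ((ℛ K x).right j * (ℛ K z).right i) := by
    rw [Bialgebra.comul_mul, ← (ℛ K x).eq, ← (ℛ K z).eq, Finset.sum_mul_sum]
    simp
  rw [Rop, LinearMap.comp_apply, LinearMap.comp_apply, this, Finset.sum_comm]
  simp [Finset.sum_mul, Mr_apply]

lemma Xi_D (hD : ∀ f g, D (f ∘ₗ Rop g) = D f * D g) (hD1 : D counit = 1) (f : Dual K H) :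
    Xi b D Mr * Xi b D (Fop f) =
      (LinearMap.toMatrix b b (Rop f) ⊗ₖ (1 : Matrix Z Z K)) * Xi b D Mr := by
  rw [← hD1, ← Xi_smulRight]
  have key : ∀ z : H, (Rop f : Module.End K H) * Mr z = Mr z * 0 + (Rop f ∘ₗ Mr z : Module.End K H) := by
    intro z; rw [mul_zero, zero_add]; rfl
  rw [Xi_mul b D hD _ _ ((LinearMap.mulLeft K (Rop f : Module.End K H)) ∘ₗ Mr),
    Xi_mul b D hD _ _ ((LinearMap.mulLeft K (Rop f : Module.End K H)) ∘ₗ Mr)]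
  · intro z
    refine LinearMap.ext fun x => ?_
    rw [LinearMap.comp_apply, LinearMap.mulLeft_apply]
    simp only [LinearMap.smulRight_apply, smul_mul_assoc, ← mul_smul_comm]
    rw [← Finset.mul_sum]
    simp only [← map_smul]
    rw [← map_sum, sum_counit_smul]
  · intro z
    refine LinearMap.ext fun x => ?_
    rw [LinearMap.comp_apply, LinearMap.mulLeft_apply, Module.End.mul_apply, Mr_apply, Rop_mul,
      LinearMap.sum_apply]
    rfl

lemma Xi_inv (hD : ∀ f g, D (f ∘ₗ Rop g) = D f * D g) (hD1 : D counit = 1)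
    (hinj : Function.Injective 𝒮) (h4 : ∀ h : H, 𝒮 (𝒮 (𝒮 (𝒮 h))) = h) :
    Xi b D Mr * Xi b D (Mr ∘ₗ 𝒮 ∘ₗ 𝒮 ∘ₗ 𝒮) = 1 := by
  have h1 : (1 : Matrix (I × Z) (I × Z) K) = Xi b D (counit.smulRight 1) := by
    rw [Xi_smulRight, hD1]
    have : LinearMap.toMatrix b b (1 : Module.End K H) = 1 := LinearMap.toMatrix_one b
    rw [this, Matrix.one_kronecker_one]
  rw [h1]
  refine Xi_mul b D hD _ _ _ fun z => ?_
  refine LinearMap.ext fun x => ?_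
  rw [LinearMap.sum_apply]
  simp only [Module.End.mul_apply, Mr_apply, LinearMap.comp_apply, LinearMap.smulRight_apply,
    LinearMap.smul_apply, Module.End.one_apply]
  have : ∑ i ∈ (ℛ K z).index, 𝒮 (𝒮 (𝒮 ((ℛ K z).right i))) * (ℛ K z).left i =
      algebraMap K H (counit z) := by
    apply hinj
    rw [map_sum]
    simp only [antipode_mul_antidistrib, h4]
    rw [sum_antipode_mul_eq_algebraMap_counit (ℛ K z)]
    rw [Algebra.algebraMap_eq_smul_one, map_smul, antipode_one]
  simp only [mul_assoc]
  rw [← Finset.mul_sum, this, Algebra.algebraMap_eq_smul_one]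
  simp

end Xi
end SDE
end

section
open HopfAlgebra Module Coalgebra Matrix
open scoped TensorProduct Kronecker
namespace SDE
section DD
variable {K H : Type*} [Field K] [Ring H] [HopfAlgebra K H]
local notation "𝒮" => antipode K (A := H)
variable {I : Type*} [Fintype I] [DecidableEq I] (b : Basis I K H)

/-- the operator of a functional on the m-fold tensor power of the coregular module -/
noncomputable def DD (m : ℕ) : Dual K H →ₗ[K] Matrix (Fin m → I) (Fin m → I) K :=
  ∑ w : Fin m → I, (Dual.eval K H (lp fun y => b (w y))).smulRight
    (piK fun y => LinearMap.toMatrix b b (Rop (b.coord (w y))))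

lemma DD_apply (m : ℕ) (f : Dual K H) : DD b m f = ∑ w : Fin m → I, f (lp fun y => b (w y)) •
    (piK fun y => LinearMap.toMatrix b b (Rop (b.coord (w y)))) := by
  simp [DD, LinearMap.sum_apply]

/-- splitting off the first index -/
def spl (m : ℕ) (Y : Type*) : (Fin (m + 1) → Y) ≃ Y × (Fin m → Y) := (Fin.consEquiv fun _ => Y).symm

lemma spl_apply (m : ℕ) (Y : Type*) (w : Fin (m + 1) → Y) : spl m Y w = (w 0, fun i => w i.succ) := rfl

lemma piK_succ {R : Type*} [CommRing R] {m : ℕ} (M : Fin (m + 1) → Matrix I I R) :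
    piK (Y := fun _ => I) M =
      (M 0 ⊗ₖ piK (Y := fun _ => I) (fun i => M i.succ)).submatrix (spl m I) (spl m I) := by
  ext f g
  rw [piK_apply, Fin.prod_univ_succ]
  rfl

lemma Xi_Fop {Z : Type*} [Fintype Z] [DecidableEq Z] (D : Dual K H →ₗ[K] Matrix Z Z K)
    (f : Dual K H) : Xi b D (Fop f) =
      ∑ u, LinearMap.toMatrix b b (Rop (b.coord u)) ⊗ₖ D (f ∘ₗ LinearMap.mulLeft K (b u)) := by
  have : Fop f = ∑ u, (f ∘ₗ LinearMap.mulLeft K (b u)).smulRight (Rop (b.coord u) : Module.End K H) := by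
    refine LinearMap.ext fun z => ?_
    rw [Fop_apply, dual_eq_sum b (f ∘ₗ Mr z), ← RopL_apply, map_sum, LinearMap.sum_apply]
    refine Finset.sum_congr rfl fun u _ => ?_
    rw [map_smul]; rfl
  rw [this, map_sum]
  exact Finset.sum_congr rfl fun u _ => Xi_smulRight b D _ _

lemma DD_succ (m : ℕ) (f : Dual K H) :
    DD b (m + 1) f = (Xi b (DD b m) (Fop f)).submatrix (spl m I) (spl m I) := by
  rw [Xi_Fop, DD_apply, ← (spl m I).symm.sum_comp, Fintype.sum_prod_type]
  ext x y
  rw [Matrix.sum_apply, Matrix.submatrix_apply, Matrix.sum_apply]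
  refine Finset.sum_congr rfl fun u _ => ?_
  rw [DD_apply, kron_sum, Matrix.sum_apply, Matrix.sum_apply]
  refine Finset.sum_congr rfl fun w _ => ?_
  rw [piK_succ, lp_succ, Matrix.smul_apply, Matrix.submatrix_apply, Matrix.kronecker_smul]
  rfl

lemma DD_props (hinj : Function.Injective 𝒮) (h4 : ∀ h : H, 𝒮 (𝒮 (𝒮 (𝒮 h))) = h) (m : ℕ) : (∀ f g, DD b m (f ∘ₗ Rop g) = DD b m f * DD b m g) ∧ DD b m counit = 1 := by
  induction m with
  | zero =>
    have hp : ∀ M : Fin 0 → Matrix I I K, piK (Y := fun _ => I) M = 1 := by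
      intro M
      ext x y
      rw [Subsingleton.elim x y, Matrix.one_apply_eq, piK_apply]; simp
    constructor
    · intro f g
      simp only [DD_apply, lp_zero, hp, Finset.univ_unique, Finset.sum_singleton]
      have : Rop g (1 : H) = g 1 • 1 := by
        rw [Rop]; simp [Bialgebra.comul_one, Algebra.TensorProduct.one_def]
      rw [LinearMap.comp_apply, this, smul_mul_smul_comm, mul_one, map_smul, smul_eq_mul, mul_comm]
    · simp [DD_apply, lp_zero, hp]
  | succ m ih =>
    obtain ⟨hD, hD1⟩ := ih
    have hi := Xi_inv b (DD b m) hD hD1 hinj h4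
    have hi' := mul_eq_one_comm.1 hi
    have hx := Xi_D b (DD b m) hD hD1
    set X := Xi b (DD b m) Mr
    set X' := Xi b (DD b m) (Mr ∘ₗ 𝒮 ∘ₗ 𝒮 ∘ₗ 𝒮)
    have hc : ∀ f, Xi b (DD b m) (Fop f) =
        X' * ((LinearMap.toMatrix b b (Rop f) ⊗ₖ (1 : Matrix (Fin m → I) (Fin m → I) K)) * X) := by
      intro f
      rw [← hx, ← mul_assoc, hi', one_mul]
    constructor
    · intro f g
      rw [DD_succ, DD_succ, DD_succ, Matrix.submatrix_mul_equiv, hc, hc, hc, ← Rop_comp,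
        LinearMap.toMatrix_comp b b b, ← mul_one (1 : Matrix (Fin m → I) (Fin m → I) K),
        Matrix.mul_kronecker_mul, mul_one]
      congr 1
      simp only [mul_assoc]
      rw [← mul_assoc X X', hi, one_mul]
    · rw [DD_succ, hc, Rop_counit, LinearMap.toMatrix_id, Matrix.one_kronecker_one, one_mul, hi',
        Matrix.submatrix_one_equiv]

end DD

section signs
variable {K H : Type*} [Field K] [Ring H] [HopfAlgebra K H] [FiniteDimensional K H]
local notation "𝒮" => antipode K (A := H)
variable {r r' : ℕ} (b : Basis (Fin r ⊕ Fin r') K H) (hb : IsSB b)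

lemma sL_sq (R : Type*) [CommRing R] : sL R r r' * sL R r r' = 1 := by
  rw [sL, Matrix.diagonal_mul_diagonal, ← Matrix.diagonal_one]
  congr 1; ext u
  rw [← Int.cast_mul, sgn_sq, Int.cast_one]

/-- sign matrix of the tensor power -/
def SL (R : Type*) [CommRing R] (r r' m : ℕ) : Matrix (Fin m → Fin r ⊕ Fin r') (Fin m → Fin r ⊕ Fin r') R :=
  piK (Y := fun _ => Fin r ⊕ Fin r') (fun _ => sL R r r')

lemma SL_eq (R : Type*) [CommRing R] (m : ℕ) :
    SL R r r' m = diagonal fun w => ((∏ y, sgn (w y) : ℤ) : R) := by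
  rw [SL]; simp only [sL]
  rw [piK_diag (Y := fun _ => Fin r ⊕ Fin r')]
  push_cast; rfl

lemma SL_sq (R : Type*) [CommRing R] (m : ℕ) : SL R r r' m * SL R r r' m = 1 := by
  rw [SL, piK_mul, ← piK_one]
  congr 1
  ext1 y
  exact sL_sq R

lemma SL_conj (R : Type*) [CommRing R] {m : ℕ} (σ : Fin m → R)
    (M : Fin m → Matrix (Fin r ⊕ Fin r') (Fin r ⊕ Fin r') R)
    (h : ∀ y, sL R r r' * M y * sL R r r' = σ y • M y) :
    SL R r r' m * piK (Y := fun _ => Fin r ⊕ Fin r') M * SL R r r' m =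
      (∏ y, σ y) • piK (Y := fun _ => Fin r ⊕ Fin r') M := by
  rw [SL, piK_mul, piK_mul, ← piK_smul]
  congr 1
  ext1 y
  exact h y

include hb in
lemma R_sign (u) : sL K r r' * LinearMap.toMatrix b b (Rop (b.coord u)) * sL K r r' =
    (sgn u : K) • LinearMap.toMatrix b b (Rop (b.coord u)) := by
  have h : (b.coord u) ∘ₗ 𝒮 ∘ₗ 𝒮 = (sgn u : K) • b.coord u := by
    refine LinearMap.ext fun x => ?_
    exact repr_antipode_sq b hb x u
  ext x y
  have h1 := Rmat_sign b hb (b.coord u) x y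
  rw [h, Rop_smul, map_smul, Matrix.smul_apply, smul_eq_mul] at h1
  rw [sL, Matrix.mul_diagonal, Matrix.diagonal_mul, Matrix.smul_apply, smul_eq_mul]
  have h2 : (sgn x : K) * sgn x = 1 := by rw [← Int.cast_mul, sgn_sq, Int.cast_one]
  linear_combination (sgn x : K) * h1 + (sgn u : K) * LinearMap.toMatrix b b (Rop (b.coord u)) x y * h2

include hb in
lemma DD_sign (m : ℕ) (g : Dual K H) :
    SL K r r' m * DD b m g * SL K r r' m = DD b m (g ∘ₗ 𝒮 ∘ₗ 𝒮) := by
  rw [DD_apply, DD_apply, Finset.mul_sum, Finset.sum_mul]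
  refine Finset.sum_congr rfl fun w _ => ?_
  rw [mul_smul_comm, smul_mul_assoc, SL_conj K (fun y => (sgn (w y) : K)) _ (fun y => R_sign b hb _),
    smul_smul]
  congr 1
  have h1 : ∀ q (w : Fin q → Fin r ⊕ Fin r'), 𝒮 (𝒮 (lp fun y => b (w y))) =
      (∏ y, (sgn (w y) : K)) • lp fun y => b (w y) := by
    intro q
    induction q with
    | zero => intro w; simp [lp_zero]
    | succ q ih =>
      intro w
      rw [lp_succ, antipode_sq_mul, ih, hb, Fin.prod_univ_succ, mul_smul, ← Int.cast_smul_eq_zsmul K,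
        smul_mul_assoc, mul_smul_comm]
  rw [LinearMap.comp_apply, LinearMap.comp_apply, h1, map_smul, smul_eq_mul, mul_comm]

include hb in
lemma Mr_sign (h4 : ∀ h : H, 𝒮 (𝒮 (𝒮 (𝒮 h))) = h) (u) : sL K r r' * LinearMap.toMatrix b b (Mr (K := K) (b u)) * sL K r r' =
    (sgn u : K) • LinearMap.toMatrix b b (Mr (K := K) (b u)) := by
  have : sL K r r' = LinearMap.toMatrix b b (𝒮 ∘ₗ 𝒮) := (toMatrix_antipode_sq b hb).symm
  rw [this, ← LinearMap.toMatrix_comp b b b, ← LinearMap.toMatrix_comp b b b, ← map_smul]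
  congr 1
  refine LinearMap.ext fun x => ?_
  simp only [LinearMap.comp_apply, LinearMap.smul_apply, Mr_apply]
  rw [antipode_sq_mul, h4, hb, ← Int.cast_smul_eq_zsmul K, mul_smul_comm]

include hb in
lemma Xi_sign (h4 : ∀ h : H, 𝒮 (𝒮 (𝒮 (𝒮 h))) = h) (m : ℕ) : (sL K r r' ⊗ₖ SL K r r' m) * Xi b (DD b m) Mr * (sL K r r' ⊗ₖ SL K r r' m) =
    Xi b (DD b m) Mr := by
  rw [Xi_apply, Finset.mul_sum, Finset.sum_mul]
  refine Finset.sum_congr rfl fun u _ => ?_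
  rw [← Matrix.mul_kronecker_mul, ← Matrix.mul_kronecker_mul, Mr_sign b hb h4, DD_sign b hb]
  have h : (b.coord u) ∘ₗ 𝒮 ∘ₗ 𝒮 = (sgn u : K) • b.coord u := by
    refine LinearMap.ext fun x => ?_
    exact repr_antipode_sq b hb x u
  rw [h, map_smul, Matrix.smul_kronecker, Matrix.kronecker_smul, smul_smul, ← Int.cast_mul, sgn_sq,
    Int.cast_one, one_smul]
end signs
end SDE
end

section
open HopfAlgebra Module Coalgebra Matrix
open scoped TensorProduct Kronecker
namespace SDE

lemma comm_of_conj {A : Type*} [Monoid A] {S X : A} (hS : S * S = 1) (h : S * X * S = X) :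
    S * X = X * S := by
  conv_rhs => rw [← h]
  rw [mul_assoc, hS, mul_one]

lemma lp_conj {R A : Type*} [CommRing R] [Ring A] [Algebra R A] {S : A} (hS : S * S = 1) {q : ℕ}
    (σ : Fin q → R) (M : Fin q → A) (h : ∀ y, S * M y * S = σ y • M y) :
    S * lp M * S = (∏ y, σ y) • lp M := by
  induction q with
  | zero => simp [lp_zero, hS]
  | succ q ih =>
    rw [lp_succ, Fin.prod_univ_succ]
    have h1 : S * (M 0 * lp (fun i => M i.succ)) * S =
        (S * M 0 * S) * (S * lp (fun i => M i.succ) * S) := by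
      have : (S * M 0 * S) * (S * lp (fun i => M i.succ) * S) =
        S * M 0 * (S * S) * lp (fun i => M i.succ) * S := by noncomm_ring
      rw [this, hS]; noncomm_ring
    rw [h1, h 0, ih (fun y => σ y.succ) _ (fun y => h y.succ), smul_mul_smul_comm]

lemma sign_ne {K : Type*} [Field K] (h2 : (2 : K) ≠ 0) {s t : ℤ} (hs : s = 1 ∨ s = -1)
    (ht : t = 1 ∨ t = -1) (hst : s ≠ t) {x : K} (h : (s : K) * x = t * x) : x = 0 := by
  have h3 : 2 * x = 0 := by
    rcases hs with rfl | rfl <;> rcases ht with rfl | rfl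
    · exact absurd rfl hst
    · push_cast at h; linear_combination h
    · push_cast at h; linear_combination -h
    · exact absurd rfl hst
  exact (mul_eq_zero.1 h3).resolve_left h2

namespace Trunc
variable {K R : Type*} [Field K] [CommRing R] {p k : ℕ} (T : Trunc K R p k)

lemma lift_sign {s t : ℤ} (hs : s = 1 ∨ s = -1) (ht : t = 1 ∨ t = -1) {x : K}
    (h : (s : K) * x = t * x) : (s : R) * T.sec x = t * T.sec x := by
  by_cases hst : s = t
  · rw [hst]
  · rw [sign_ne T.two hs ht hst h, T.sec_zero, mul_zero, mul_zero]
end Trunc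

lemma sgn_mul_cases {s t : ℤ} (hs : s = 1 ∨ s = -1) (ht : t = 1 ∨ t = -1) : s * t = 1 ∨ s * t = -1 := by
  rcases hs with rfl | rfl <;> rcases ht with rfl | rfl <;> simp

lemma sgn_prod_cases {J : Type*} (A : Finset J) (s : J → ℤ) (hs : ∀ j, s j = 1 ∨ s j = -1) :
    (∏ j ∈ A, s j) = 1 ∨ (∏ j ∈ A, s j) = -1 := by
  classical
  induction A using Finset.induction_on with
  | empty => simp
  | insert a A ha ih => rw [Finset.prod_insert ha]; exact sgn_mul_cases (hs a) ih

section hopf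
variable {K H : Type*} [Field K] [Ring H] [HopfAlgebra K H] [FiniteDimensional K H]
local notation "𝒮" => antipode K (A := H)
variable {ι : Type*} [Fintype ι] [DecidableEq ι]
  {n : ι → Type} [∀ i, Fintype (n i)] [∀ i, DecidableEq (n i)]
variable {Λ : H} {lam : Dual K H} (hΛ : IsInt (K := K) Λ) (hl : IsCoint lam)
variable (e : H ≃ₐ[K] Π i, Matrix (n i) (n i) K) (o : ∀ i, n i)
variable {r r' : ℕ} (b : Basis (Fin r ⊕ Fin r') K H) (hb : IsSB b)
variable {R : Type*} [CommRing R] {p k : ℕ} (T : Trunc K R p k)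

/-- e is signed -/
def IsSE (s : ∀ i, n i → ℤ) : Prop := (∀ i x, s i x = 1 ∨ s i x = -1) ∧
  ∀ h i x y, e (antipode K (antipode K h)) i x y = ((s i x * s i y : ℤ) : K) * e h i x y

variable {s : ∀ i, n i → ℤ} (he : IsSE e s)

/-- coefficients -/
noncomputable def alL {m : ℕ} (c : CR (fus e o) R) (w : Fin m → Fin r ⊕ Fin r') : R :=
  ∑ i, c i * trace (lp fun y => aL e b T i (w y))

include hb in
lemma bL_sign (u) : sL R r r' * bL b T u * sL R r r' = ((sgn u : ℤ) : R) • bL b T u := by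
  ext x y
  have h := congrFun (congrFun (R_sign b hb u) x) y
  rw [sL, Matrix.mul_diagonal, Matrix.diagonal_mul, Matrix.smul_apply, smul_eq_mul] at h ⊢
  rw [bL, Matrix.map_apply, mul_right_comm, ← Int.cast_mul]
  refine T.lift_sign (sgn_mul_cases (sgn_cases _) (sgn_cases _)) (sgn_cases _) ?_
  rw [Int.cast_mul]
  linear_combination h

include hb he in
lemma aL_sign (i : ι) (u) : (diagonal fun x => (s i x : R)) * aL e b T i u * (diagonal fun x => (s i x : R)) =
    ((sgn u : ℤ) : R) • aL e b T i u := by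
  ext x y
  have h := he.2 (b u) i x y
  rw [hb u] at h
  rw [Matrix.mul_diagonal, Matrix.diagonal_mul, Matrix.smul_apply, smul_eq_mul]
  rw [aL, Matrix.map_apply, mul_right_comm, ← Int.cast_mul]
  refine T.lift_sign (sgn_mul_cases (he.1 _ _) (he.1 _ _)) (sgn_cases _) ?_
  rw [← h, map_zsmul]
  simp

include hb he in
lemma alL_sign {m : ℕ} (c : CR (fus e o) R) (w : Fin m → Fin r ⊕ Fin r') :
    alL e o b T c w * ∏ y, ((sgn (w y) : ℤ) : R) = alL e o b T c w := by
  rw [alL, Finset.sum_mul]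
  refine Finset.sum_congr rfl fun i _ => ?_
  have hS : (diagonal fun x => (s i x : R)) * (diagonal fun x => (s i x : R)) = 1 := by
    rw [Matrix.diagonal_mul_diagonal, ← Matrix.diagonal_one]
    congr 1; ext u
    rcases he.1 i u with h | h <;> simp [h]
  have h := lp_conj hS (fun y => ((sgn (w y) : ℤ) : R)) (fun y => aL e b T i (w y))
    (fun y => aL_sign e b hb T he i (w y))
  have h' := congrArg trace h
  rw [Matrix.trace_mul_comm, ← mul_assoc, hS, one_mul, trace_smul, smul_eq_mul] at h'
  rw [mul_assoc, mul_comm (trace _), ← h']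

/-- the column operator -/
noncomputable def BL (m : ℕ) (c : CR (fus e o) R) :
    Matrix (Fin m → Fin r ⊕ Fin r') (Fin m → Fin r ⊕ Fin r') R :=
  ∑ w : Fin m → Fin r ⊕ Fin r', alL e o b T c w •
    piK (Y := fun _ => Fin r ⊕ Fin r') (fun y => bL b T (w y))

include hb he in
lemma BL_comm (m : ℕ) (c : CR (fus e o) R) :
    SL R r r' m * BL e o b T m c = BL e o b T m c * SL R r r' m := by
  apply comm_of_conj (SL_sq R m)
  rw [BL, Finset.mul_sum, Finset.sum_mul]
  refine Finset.sum_congr rfl fun w _ => ?_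
  rw [mul_smul_comm, smul_mul_assoc, SL_conj R _ _ (fun y => bL_sign b hb T (w y)), smul_smul,
    alL_sign e o b hb T he]

lemma BL_red (m : ℕ) (c : CR (fus e o) R) :
    (BL e o b T m c).map T.red = DD b m (chi e o (CR.map T.red c)) := by
  rw [DD_apply, BL]
  change T.red.mapMatrix (∑ w : Fin m → Fin r ⊕ Fin r', _) = _
  rw [map_sum]
  refine Finset.sum_congr rfl fun w _ => ?_
  have h1 : (piK (Y := fun _ => Fin r ⊕ Fin r') (fun y => bL b T (w y))).map T.red =
      piK (Y := fun _ => Fin r ⊕ Fin r') (fun y => LinearMap.toMatrix b b (Rop (b.coord (w y)))) := by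
    rw [piK_map]; simp only [bL_map]
  have h2 : T.red (alL e o b T c w) = chi e o (CR.map T.red c) (lp fun y => b (w y)) := by
    rw [alL, chi_apply, map_sum]
    refine Finset.sum_congr rfl fun i _ => ?_
    rw [map_mul, CR.map_apply, trace_map', lp_map]
    simp only [aL_map]
    congr 2
    exact (map_lp (prj e i : H →* Matrix (n i) (n i) K) _).symm
  rw [← h1, ← h2]
  ext x y
  simp

include hΛ hl hb he in
theorem columns (hp : 0 < p) (m : ℕ) (c : CR (fus e o) R)
    (hc : CR.map T.red c * CR.map T.red c = CR.map T.red c)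
    (πp : CR (fus e o) K →ₐ[K] Matrix (Fin r) (Fin r) K)
    (πm : CR (fus e o) K →ₐ[K] Matrix (Fin r') (Fin r') K)
    (hπ : ∀ c, piU e o b c = fromBlocks (πp c) 0 0 (πm c)) :
    trace (SL R r r' (m + 1) * BL e o b T (m + 1) c ^ p ^ k) =
      (((πp (CR.map T.red c)).rank : R) - (πm (CR.map T.red c)).rank) *
        (((r : ℤ) - r' : ℤ) : R) ^ m := by
  have hinj := antipode_inj hΛ hl
  have h4 := antipode_four hΛ hl
  set cb := CR.map T.red c
  obtain ⟨Up, Vp, hp1, hp2⟩ := exists_factor (πp cb) (by rw [← map_mul, hc])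
  obtain ⟨Um, Vm, hm1, hm2⟩ := exists_factor (πm cb) (by rw [← map_mul, hc])
  obtain ⟨hD, hD1⟩ := DD_props b hinj h4 m
  have hi := Xi_inv b (DD b m) hD hD1 hinj h4
  have hi' := mul_eq_one_comm.1 hi
  have hx := Xi_D b (DD b m) hD hD1 (chi e o cb)
  have hXS := Xi_sign b hb h4 m
  have hdd := DD_succ b m (chi e o cb)
  set X := Xi b (DD b m) Mr
  set X' := Xi b (DD b m) (Mr ∘ₗ 𝒮 ∘ₗ 𝒮 ∘ₗ 𝒮)
  let U0 := fromBlocks Up 0 0 Um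
  let V0 := fromBlocks Vp 0 0 Vm
  have hUV0 : U0 * V0 = LinearMap.toMatrix b b (Rop (chi e o cb)) := by
    rw [← piU_apply, hπ]
    simp only [U0, V0, fromBlocks_multiply, Matrix.mul_zero, Matrix.zero_mul, add_zero, zero_add,
      ← hp1, ← hm1]
  have hVU0 : V0 * U0 = 1 := by
    simp [U0, V0, fromBlocks_multiply, hp2, hm2, fromBlocks_one]
  have hSS : (sL K r r' ⊗ₖ SL K r r' m) * (sL K r r' ⊗ₖ SL K r r' m) = 1 := by
    rw [← Matrix.mul_kronecker_mul, sL_sq, SL_sq, Matrix.one_kronecker_one]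
  have hXc := comm_of_conj hSS hXS
  have hU := (BL_red e o b T (m + 1) c)
  have hUV : (BL e o b T (m + 1) c).map T.red =
      ((X' * (U0 ⊗ₖ (1 : Matrix (Fin m → Fin r ⊕ Fin r') (Fin m → Fin r ⊕ Fin r') K))).submatrix (spl m _) id) *
        (((V0 ⊗ₖ (1 : Matrix (Fin m → Fin r ⊕ Fin r') (Fin m → Fin r ⊕ Fin r') K)) * X).submatrix id (spl m _)) := by
    rw [hU, hdd]
    have e1 : Xi b (DD b m) (Fop (chi e o cb)) =
        (X' * (U0 ⊗ₖ (1 : Matrix (Fin m → Fin r ⊕ Fin r') (Fin m → Fin r ⊕ Fin r') K))) * ((V0 ⊗ₖ (1 : Matrix (Fin m → Fin r ⊕ Fin r') (Fin m → Fin r ⊕ Fin r') K)) * X) := by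
      rw [Matrix.mul_assoc, ← Matrix.mul_assoc (U0 ⊗ₖ (1 : Matrix (Fin m → Fin r ⊕ Fin r') (Fin m → Fin r ⊕ Fin r') K)), ← Matrix.mul_kronecker_mul, Matrix.mul_one,
        hUV0, ← hx, ← Matrix.mul_assoc, hi', Matrix.one_mul]
    rw [e1, Matrix.submatrix_mul _ _ _ _ _ Function.bijective_id]
  have hVU : (((V0 ⊗ₖ (1 : Matrix (Fin m → Fin r ⊕ Fin r') (Fin m → Fin r ⊕ Fin r') K)) * X).submatrix id (spl m _)) *
      ((X' * (U0 ⊗ₖ (1 : Matrix (Fin m → Fin r ⊕ Fin r') (Fin m → Fin r ⊕ Fin r') K))).submatrix (spl m _) id) = 1 := by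
    rw [Matrix.submatrix_mul_equiv, Matrix.mul_assoc, ← Matrix.mul_assoc X, hi, Matrix.one_mul,
      ← Matrix.mul_kronecker_mul, Matrix.mul_one, hVU0, Matrix.one_kronecker_one]
    rfl
  have hBi : (BL e o b T (m + 1) c).map T.red * (BL e o b T (m + 1) c).map T.red =
      (BL e o b T (m + 1) c).map T.red := by
    rw [hU, ← (DD_props b hinj h4 (m + 1)).1, ← chi_mul, hc]
  let sY : (Fin (πp cb).rank ⊕ Fin (πm cb).rank) × (Fin m → Fin r ⊕ Fin r') → ℤ := fun y => sgn y.1 * ∏ i, sgn (y.2 i)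
  have hV0 : (diagonal fun y => (sY y : K)) * ((V0 ⊗ₖ (1 : Matrix (Fin m → Fin r ⊕ Fin r') (Fin m → Fin r ⊕ Fin r') K)) * X) =
      ((V0 ⊗ₖ (1 : Matrix (Fin m → Fin r ⊕ Fin r') (Fin m → Fin r ⊕ Fin r') K)) * X) * (sL K r r' ⊗ₖ SL K r r' m) := by
    rw [Matrix.mul_assoc, ← hXc, ← Matrix.mul_assoc, ← Matrix.mul_assoc, ← Matrix.mul_kronecker_mul, Matrix.one_mul]
    congr 1
    have : (diagonal fun y => (sY y : K)) = (diagonal fun y => (sgn y : K)) ⊗ₖ SL K r r' m := by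
      rw [SL_eq, Matrix.diagonal_kronecker_diagonal]
      simp only [sY, Int.cast_mul]
    rw [this, ← Matrix.mul_kronecker_mul, Matrix.mul_one]
    congr 1
    ext x y
    rw [Matrix.diagonal_mul, sL, Matrix.mul_diagonal]
    rcases x with x | x <;> rcases y with y | y <;> simp [V0, sgn]
  have main := T.signed_trace (fun w : Fin (m + 1) → Fin r ⊕ Fin r' => ∏ i, sgn (w i)) sY
    (BL e o b T (m + 1) c ^ p ^ k) (T.idem_pow hBi) (by
      rw [← SL_eq]
      exact (Commute.pow_right (BL_comm e o b hb T he (m + 1) c) _).eq) _ _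
      ((T.idem_pow_map hp hBi).trans hUV) hVU (by
      intro x y hxy
      have hh := congrFun (congrFun hV0 y) (spl m _ x)
      rw [SL_eq, sL, Matrix.diagonal_kronecker_diagonal, Matrix.diagonal_mul, Matrix.mul_diagonal] at hh
      refine sign_ne T.two (sgn_prod_cases Finset.univ (fun i => sgn (x i)) fun _ => sgn_cases _)
        (sgn_mul_cases (sgn_cases y.1) (sgn_prod_cases Finset.univ _ fun _ => sgn_cases _)) hxy ?_
      rw [Matrix.submatrix_apply, id]
      refine Eq.trans ?_ hh.symm
      rw [mul_comm]
      congr 1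
      rw [Fin.prod_univ_succ, spl_apply, Int.cast_mul])
  rw [SL_eq, main]
  have : ∑ y, sY y = (((πp cb).rank : ℤ) - (πm cb).rank) * ((r : ℤ) - r') ^ m := by
    rw [Fintype.sum_prod_type]
    simp only [sY, ← Finset.mul_sum]
    rw [← Finset.sum_mul, sum_sgn]
    congr 1
    rw [← sum_sgn, Finset.sum_pow', Fintype.piFinset_univ]
  rw [← Int.cast_sum, this]
  push_cast
  rfl

include hΛ hl hb he in
theorem key_trunc (hp : 0 < p) (c : CR (fus e o) R) (hc : c * c = c)
    (πp : CR (fus e o) K →ₐ[K] Matrix (Fin r) (Fin r) K)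
    (πm : CR (fus e o) K →ₐ[K] Matrix (Fin r') (Fin r') K)
    (hπ : ∀ c, piU e o b c = fromBlocks (πp c) 0 0 (πm c)) :
    (((r : ℤ) - r' : ℤ) : R) * CR.tau (thet e Λ) c =
      ((πp (CR.map T.red c)).rank : R) - (πm (CR.map T.red c)).rank := by
  have hN : IsUnit (((r : ℤ) - r' : ℤ) : R) := T.isUnit (by
    rw [map_intCast]; exact N_ne hΛ hl b hb)
  obtain ⟨m, hm⟩ := Nat.exists_eq_succ_of_ne_zero (pow_pos hp k).ne'
  have h1 := columns hΛ hl e o b hb T he hp m c (by rw [← map_mul, hc]) πp πm hπ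
  have h2 := rows hΛ hl e o b hb T hp (p ^ k) c
  have h3 := grid (aL e b T) (fun i => c i) (bL b T) (sL R r r') (p ^ k) (p ^ k)
    (alL e o b T c) (betL b T) (fun w => rfl) (fun w => rfl)
  rw [h2] at h3
  have h4 : trace (SL R r r' (p ^ k) * BL e o b T (p ^ k) c ^ p ^ k) =
      (((r : ℤ) - r' : ℤ) : R) ^ p ^ k * CR.tau (thet e Λ) (c ^ p ^ k) := h3
  have h5 : c ^ p ^ k = c := by
    rw [hm]; exact IsIdempotentElem.pow_succ_eq _ hc
  rw [h5] at h4
  have h6 : ∀ z, z = m + 1 → trace (SL R r r' z * BL e o b T z c ^ p ^ k) =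
     (((πp (CR.map T.red c)).rank : R) - (πm (CR.map T.red c)).rank) *
        (((r : ℤ) - r' : ℤ) : R) ^ m := by
    rintro z rfl
    exact h1
  rw [h6 _ hm] at h4
  refine (hN.pow m).mul_left_cancel ?_
  rw [mul_comm, mul_comm _ (_ - _), h4, hm, pow_succ]
  ring
end hopf
end SDE
end

section

namespace SDE

/-- a complete mixed characteristic base -/
structure Wit (K W : Type*) [Field K] [CommRing W] (p : ℕ) where
  red : W →+* K
  surj : Function.Surjective red
  ker : ∀ x, red x = 0 → ∃ y, x = p * y
  redp : red p = 0
  haus : ∀ x : W, (∀ k : ℕ, (p : W) ^ k ∣ x) → x = 0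
  prec : ∀ f : ℕ → W, (∀ k, (p : W) ^ (k + 1) ∣ f (k + 1) - f k) →
    ∃ L, ∀ k, (p : W) ^ k ∣ f k - L

theorem exists_wit.{u} (K : Type u) [Field K] [IsAlgClosed K] (p : ℕ) [Fact p.Prime] [CharP K p] :
    ∃ (W : Type u) (_ : CommRing W) (_ : IsDomain W) (_ : CharZero W), Nonempty (Wit K W p) := by
  haveI : ExpChar K p := ExpChar.prime Fact.out
  haveI : PerfectRing K p := inferInstance
  have hker : ∀ x : WittVector p K, WittVector.constantCoeff x = 0 → ∃ y, x = p * y := by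
    intro x hx
    have h1 : x ∈ RingHom.ker (WittVector.constantCoeff (p := p) (R := K)) := hx
    rw [WittVector.ker_constantCoeff, Ideal.mem_span_singleton] at h1
    exact h1
  have hps : ∀ k : ℕ, Ideal.span {(p : WittVector p K)} ^ k • (⊤ : Ideal (WittVector p K)) = Ideal.span {(p : WittVector p K) ^ k} := by
    intro k
    rw [Ideal.span_singleton_pow]; simp
  have hcz : CharZero (WittVector p K) := by
    apply charZero_of_inj_zero
    intro n hn
    by_contra h0
    obtain ⟨a, m, hm, rfl⟩ := Nat.exists_eq_pow_mul_and_not_dvd h0 p (Nat.Prime.ne_one Fact.out)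
    push_cast at hn
    rcases mul_eq_zero.1 hn with h | h
    · exact WittVector.p_nonzero p K (by by_contra hh; exact pow_ne_zero a hh h)
    · have h3 := congrArg (WittVector.constantCoeff (p := p) (R := K)) h
      rw [map_natCast, map_zero] at h3
      exact hm ((CharP.cast_eq_zero_iff K p m).1 h3)
  refine ⟨WittVector p K, inferInstance, inferInstance, hcz, ⟨?_⟩⟩
  refine ⟨WittVector.constantCoeff, WittVector.constantCoeff_surjective p, hker, ?_, ?_, ?_⟩
  · simp
  · intro x hx
    have := IsHausdorff.haus (inferInstance : IsHausdorff (Ideal.span {(p : WittVector p K)}) (WittVector p K)) x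
    refine this fun n => ?_
    rw [SModEq.zero, hps, Ideal.mem_span_singleton]
    exact hx n
  · intro f hf
    have := IsPrecomplete.prec (inferInstance : IsPrecomplete (Ideal.span {(p : WittVector p K)}) (WittVector p K)) (f := f) (by
      intro m n hmn
      rw [SModEq.sub_mem, hps, Ideal.mem_span_singleton]
      induction n, hmn using Nat.le_induction with
      | base => simp
      | succ n hmn ih =>
        have : f m - f (n + 1) = (f m - f n) - (f (n + 1) - f n) := by ring
        rw [this]
        exact dvd_sub ih ((pow_dvd_pow _ (by omega)).trans (hf n)))
    obtain ⟨L, hL⟩ := this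
    refine ⟨L, fun k => ?_⟩
    have := hL k
    rwa [SModEq.sub_mem, hps, Ideal.mem_span_singleton] at this

namespace Wit
variable {K W : Type*} [Field K] [CommRing W] {p : ℕ} (T : Wit K W p)

/-- truncations -/
noncomputable def trunc (h2 : (2 : K) ≠ 0) (k : ℕ) :
    Trunc K (W ⧸ Ideal.span {(p : W) ^ (k + 1)}) p k where
  red := Ideal.Quotient.lift _ T.red (by
    intro a ha
    obtain ⟨y, rfl⟩ := Ideal.mem_span_singleton.1 ha
    rw [map_mul, map_pow, T.redp, zero_pow (Nat.succ_ne_zero k), zero_mul])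
  surj := Ideal.Quotient.lift_surjective_of_surjective _ _ T.surj
  ker x hx := by
    obtain ⟨x, rfl⟩ := Ideal.Quotient.mk_surjective x
    rw [Ideal.Quotient.lift_mk] at hx
    obtain ⟨y, rfl⟩ := T.ker x hx
    exact ⟨Ideal.Quotient.mk _ y, by simp⟩
  nil := by
    have : Ideal.Quotient.mk (Ideal.span {(p : W) ^ (k + 1)}) ((p : W) ^ (k + 1)) = 0 := by
      rw [Ideal.Quotient.eq_zero_iff_mem]; exact Ideal.mem_span_singleton_self _
    rw [map_pow, map_natCast] at this
    exact this
  two := h2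

lemma trunc_red (h2 : (2 : K) ≠ 0) (k : ℕ) (x : W) :
    (T.trunc h2 k).red (Ideal.Quotient.mk _ x) = T.red x := rfl

include T in
lemma eq_of_trunc {x y : W} (h : ∀ k : ℕ, Ideal.Quotient.mk (Ideal.span {(p : W) ^ (k + 1)}) x =
    Ideal.Quotient.mk (Ideal.span {(p : W) ^ (k + 1)}) y) : x = y := by
  rw [← sub_eq_zero]
  refine T.haus _ fun k => ?_
  have := h k
  rw [Ideal.Quotient.eq, Ideal.mem_span_singleton] at this
  exact (pow_dvd_pow _ (Nat.le_succ k)).trans this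

lemma trace_idem (h2 : (2 : K) ≠ 0) {X : Type*} [Fintype X] [DecidableEq X] (E : Matrix X X W)
    (hE : E * E = E) : E.trace = ((E.map T.red).rank : W) := by
  refine T.eq_of_trunc fun k => ?_
  set q := Ideal.Quotient.mk (Ideal.span {(p : W) ^ (k + 1)})
  have h := (T.trunc h2 k).trace_idem (E.map q) (by rw [← Matrix.map_mul, hE])
  rw [Matrix.map_map] at h
  rw [map_natCast]
  refine Eq.trans ?_ h
  simp [Matrix.trace]

end Wit

end SDE
end

section
open Module Matrix
namespace SDE

section Mx
variable {ι : Type*} [Fintype ι] [DecidableEq ι] {F : FusionData ι} {R R' : Type*}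
  [CommRing R] [CommRing R']

/-- matrix of `z ↦ x z ε` -/
def Mx (x ε : CR F R) : Matrix ι ι R := fun i j => (x * CR.bas j * ε : CR F R) i

lemma map_bas (f : R →+* R') (j : ι) : CR.map f (CR.bas j : CR F R) = CR.bas j := by
  ext m
  rw [CR.map_apply, CR.bas_apply, CR.bas_apply]
  split_ifs <;> simp

lemma Mx_map (f : R →+* R') (x ε : CR F R) :
    (Mx x ε).map f = Mx (CR.map f x) (CR.map f ε) := by
  ext i j
  change f ((x * CR.bas j * ε : CR F R) i) = _
  rw [← CR.map_apply, map_mul, map_mul, map_bas]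
  rfl

lemma Mx_mul (x ε y δ : CR F R) : Mx x ε * Mx y δ = Mx (x * y) (δ * ε) := by
  ext i j
  have h := CR.eq_sum (y * CR.bas j * δ)
  calc (Mx x ε * Mx y δ) i j = ∑ k, (x * CR.bas k * ε : CR F R) i * (y * CR.bas j * δ : CR F R) k := rfl
    _ = (x * (∑ k, (y * CR.bas j * δ : CR F R) k • CR.bas k) * ε : CR F R) i := by
      rw [Finset.mul_sum, Finset.sum_mul, CR.sum_apply]
      refine Finset.sum_congr rfl fun k _ => ?_
      rw [mul_smul_comm, smul_mul_assoc, CR.smul_apply, mul_comm]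
    _ = _ := by
      rw [← h]
      change _ = (x * y * CR.bas j * (δ * ε) : CR F R) i
      simp only [mul_assoc]

/-- linear in `x` -/
def MxL (ε : CR F R) : CR F R →ₗ[R] Matrix ι ι R where
  toFun x := Mx x ε
  map_add' x y := by
    ext i j
    change ((x + y) * CR.bas j * ε : CR F R) i = (x * CR.bas j * ε : CR F R) i + (y * CR.bas j * ε : CR F R) i
    rw [add_mul, add_mul]; rfl
  map_smul' r x := by
    ext i j
    change ((r • x) * CR.bas j * ε : CR F R) i = r * (x * CR.bas j * ε : CR F R) i
    rw [smul_mul_assoc, smul_mul_assoc]; rfl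

/-- trace -/
def psi (ε : CR F R) : CR F R →ₗ[R] R := Matrix.traceLinearMap ι R R ∘ₗ MxL ε

lemma psi_apply (ε x : CR F R) : psi ε x = (Mx x ε).trace := rfl

lemma psi_map (f : R →+* R') (ε x : CR F R) : psi (CR.map f ε) (CR.map f x) = f (psi ε x) := by
  rw [psi_apply, psi_apply, ← Mx_map]
  simp [Matrix.trace]

lemma aeval_Mx {ε x : CR F R} (hε : ε * ε = ε) (Q : Polynomial ℤ) : ∀ y : CR F R,
    Polynomial.aeval (Mx x ε) Q * Mx y ε = Mx (Polynomial.aeval x Q * y) ε := by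
  induction Q using Polynomial.induction_on' with
  | add P Q hP hQ =>
    intro y
    rw [map_add, map_add, add_mul, add_mul, hP, hQ]
    exact ((MxL ε).map_add (Polynomial.aeval x P * y) (Polynomial.aeval x Q * y)).symm
  | monomial n a =>
    intro y
    rw [Polynomial.aeval_monomial, Polynomial.aeval_monomial]
    have : ∀ m : ℕ, Mx x ε ^ m * Mx y ε = Mx (x ^ m * y) ε := by
      intro m
      induction m with
      | zero => simp
      | succ m ih => rw [pow_succ', mul_assoc, ih, Mx_mul, hε, pow_succ', mul_assoc]
    rw [mul_assoc, this, mul_assoc]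
    rw [eq_intCast, eq_intCast, ← zsmul_eq_mul, ← zsmul_eq_mul]
    exact (map_zsmul (MxL ε) a (x ^ n * y)).symm

lemma Adm_psi {L : Type*} [Field L] [IsAlgClosed L] {ε x : CR F L} (hε : ε * ε = ε)
    (P : Polynomial ℤ) (hP : P.Monic) (h : Polynomial.aeval x P = 0) :
    Adm (psi ε x) (psi ε (x * x)) := by
  have := Adm.matrix (Mx x ε) (P * Polynomial.X) (hP.mul Polynomial.monic_X) (by
    rw [map_mul, Polynomial.aeval_X, aeval_Mx hε, h, zero_mul]
    exact (MxL ε).map_zero)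
  rw [Mx_mul, hε] at this
  exact this
end Mx

section rk
variable {ι : Type*} [Fintype ι] [DecidableEq ι] {F : FusionData ι} {K : Type*} [Field K]
variable {κ : Type*} [Fintype κ] [DecidableEq κ] {n : κ → Type*} [∀ i, Fintype (n i)]
  [∀ i, DecidableEq (n i)] (g : CR F K ≃ₐ[K] Π i, Matrix (n i) (n i) K)

lemma rank_Mx (E : κ) (o : n E) (c : CR F K) (hc : c * c = c) :
    (Mx c (mu g E o o)).rank = (g c E).rank := by
  have hE : g c E * g c E = g c E := by
    have := congrFun (map_mul g c c) E
    rw [hc] at this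
    exact this.symm
  obtain ⟨m, U, V, hUV, hVU, hm⟩ : ∃ (m : ℕ) (U : Matrix (n E) (Fin m) K) (V : Matrix (Fin m) (n E) K),
      g c E = U * V ∧ V * U = 1 ∧ (g c E).rank = m := by
    obtain ⟨U, V, hUV, hVU⟩ := exists_factor (g c E) hE
    exact ⟨_, U, V, hUV, hVU, rfl⟩
  let w : Fin m → CR F K := fun t => ∑ a, U a t • mu g E a o
  have hw : ∀ t b, g (w t) E b o = U b t := by
    intro t b
    simp only [w, map_sum, map_smul, e_mu, Finset.sum_apply, Pi.smul_apply, Pi.single_eq_same,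
      Matrix.sum_apply, Matrix.smul_apply, Matrix.single_apply]
    simp
  rw [rank_of_factor (U := Matrix.of fun i t => w t i)
    (V := Matrix.of fun t j => ∑ b, V t b * g (CR.bas j) E b o), Fintype.card_fin, hm]
  · ext i j
    have h1 : c * CR.bas j * mu g E o o = ∑ t, (∑ b, V t b * g (CR.bas j) E b o) • w t := by
      rw [mul_mu, map_mul, Pi.mul_apply, hUV]
      simp only [w, Finset.smul_sum]
      rw [Finset.sum_comm]
      refine Finset.sum_congr rfl fun a _ => ?_
      simp only [smul_smul]
      rw [← Finset.sum_smul, Matrix.mul_assoc]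
      congr 1
      simp only [Matrix.mul_apply]
      exact Finset.sum_congr rfl fun t _ => by rw [mul_comm]
    change (c * CR.bas j * mu g E o o : CR F K) i = _
    rw [h1, CR.sum_apply, Matrix.mul_apply]
    refine Finset.sum_congr rfl fun t _ => ?_
    rw [CR.smul_apply, mul_comm]; rfl
  · ext t s
    rw [← hVU, Matrix.mul_apply, Matrix.mul_apply]
    simp only [Matrix.of_apply, Finset.sum_mul]
    rw [Finset.sum_comm]
    refine Finset.sum_congr rfl fun b _ => ?_
    rw [← hw s b]
    conv_rhs => rw [CR.eq_sum (w s)]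
    simp only [map_sum, map_smul, Finset.sum_apply, Pi.smul_apply, Matrix.sum_apply, Matrix.smul_apply,
      smul_eq_mul, Finset.mul_sum]
    exact Finset.sum_congr rfl fun i _ => by ring

include g in
lemma span_idem : Submodule.span K {c : CR F K | c * c = c} = ⊤ := by
  rw [eq_top_iff]
  intro y _
  have hy : y = ∑ i, ∑ a, ∑ c, g y i c a • mu g i c a := by
    conv_lhs => rw [← mul_one y, ← sum_mu g]
    simp only [Finset.mul_sum, mul_mu]
  rw [hy]
  refine Submodule.sum_mem _ fun i _ => Submodule.sum_mem _ fun a _ => Submodule.sum_mem _ fun c _ =>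
    Submodule.smul_mem _ _ ?_
  have haa : mu g i a a ∈ Submodule.span K {c : CR F K | c * c = c} :=
    Submodule.subset_span (by simp [mu_mul])
  by_cases h : c = a
  · rw [h]; exact haa
  · have : mu g i c a = (mu g i c a + mu g i a a) - mu g i a a := by abel
    rw [this]
    refine Submodule.sub_mem _ (Submodule.subset_span ?_) haa
    simp [add_mul, mul_add, mu_mul, Ne.symm h]
end rk

section lift
variable {ι : Type*} [Fintype ι] [DecidableEq ι] {F : FusionData ι} {K W : Type*} [Field K]
  [CommRing W] {p : ℕ} (T : Wit K W p)

lemma CR_nat_dvd {k : ℕ} {x y : CR F W} (h : ((p ^ k : ℕ) : CR F W) ∣ x - y) (i : ι) :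
    (p : W) ^ k ∣ x i - y i := by
  obtain ⟨z, hz⟩ := h
  rw [← nsmul_eq_mul] at hz
  refine ⟨z i, ?_⟩
  have := congrFun hz i
  rw [← Nat.cast_smul_eq_nsmul W] at this
  rw [CR.sub_apply, CR.smul_apply] at this
  rw [this]; push_cast; rfl

include T in
lemma CR_ker (x : CR F W) (h : CR.map T.red x = 0) : ∃ y : CR F W, x = (p : W) • y := by
  have : ∀ i, ∃ y, x i = p * y := fun i => T.ker _ (congrFun h i)
  choose y hy using this
  exact ⟨y, CR.ext hy⟩

lemma CR_surj (y : CR F K) : ∃ x : CR F W, CR.map T.red x = y := by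
  choose s hs using T.surj
  exact ⟨fun i => s (y i), CR.ext fun i => hs _⟩

lemma lift_idem (hp : 0 < p) (c : CR F K) (hc : c * c = c) :
    ∃ x : CR F W, x * x = x ∧ CR.map T.red x = c := by
  obtain ⟨a, ha⟩ := CR_surj T c
  have hpow : ∀ m : ℕ, 0 < m → c ^ m = c := by
    intro m hm
    obtain ⟨m, rfl⟩ := Nat.exists_eq_succ_of_ne_zero hm.ne'
    exact IsIdempotentElem.pow_succ_eq _ hc
  have hd : ∀ m, 0 < m → (p : CR F W) ∣ a ^ m - a := by
    intro m hm
    obtain ⟨y, hy⟩ := CR_ker T (a ^ m - a) (by rw [map_sub, map_pow, ha, hpow m hm, sub_self])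
    refine ⟨y, ?_⟩
    rw [hy, ← nsmul_eq_mul, Nat.cast_smul_eq_nsmul W]
  have h1 : ∀ k : ℕ, ((p ^ (k + 1) : ℕ) : CR F W) ∣ a ^ p ^ (k + 1) - a ^ p ^ k := by
    intro k
    have := pow_dvd_pow' p (Commute.pow_left (Commute.refl a) p) (hd p hp) k
    rw [← pow_mul, ← pow_succ'] at this
    exact this
  have h2 : ∀ k : ℕ, ((p ^ (k + 1) : ℕ) : CR F W) ∣ a ^ p ^ k * a ^ p ^ k - a ^ p ^ k := by
    intro k
    have := pow_dvd_pow' p (Commute.pow_left (Commute.refl a) 2) (hd 2 two_pos) k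
    rw [← pow_mul, mul_comm 2, pow_mul, pow_two] at this
    exact this
  have h3 : ∀ i, ∃ L, ∀ k, (p : W) ^ k ∣ (a ^ p ^ k) i - L := fun i =>
    T.prec (fun k => (a ^ p ^ k) i) fun k => CR_nat_dvd (h1 k) i
  obtain ⟨x, hx⟩ : ∃ x : CR F W, ∀ i, ∀ k, (p : W) ^ k ∣ (a ^ p ^ k) i - x i := by
    choose x hx using h3
    exact ⟨x, hx⟩
  have hx' : ∀ k : ℕ, ∃ z : CR F W, a ^ p ^ k - x = (p : W) ^ k • z := by
    intro k
    choose z hz using fun i => hx i k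
    exact ⟨z, CR.ext hz⟩
  refine ⟨x, ?_, ?_⟩
  · ext i
    rw [← sub_eq_zero]
    refine T.haus _ fun k => ?_
    obtain ⟨z, hz⟩ := hx' k
    have hxz : x = a ^ p ^ k - (p : W) ^ k • z := by rw [← hz]; abel
    have h4 : (p : W) ^ k ∣ (a ^ p ^ k * a ^ p ^ k) i - (a ^ p ^ k) i :=
      (pow_dvd_pow _ (Nat.le_succ k)).trans (CR_nat_dvd (h2 k) i)
    have h5 : x * x - x = (a ^ p ^ k * a ^ p ^ k - a ^ p ^ k) +
        (p : W) ^ k • (z - a ^ p ^ k * z - z * x) := by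
      have e1 : x * x = a ^ p ^ k * a ^ p ^ k - (p : W) ^ k • (a ^ p ^ k * z) -
          (p : W) ^ k • (z * x) := by
        rw [← mul_smul_comm, ← smul_mul_assoc, ← hz]
        noncomm_ring
      rw [e1, smul_sub, smul_sub, ← hz]
      abel
    have h6 := congrFun h5 i
    have h7 : (x * x) i - x i = ((a ^ p ^ k * a ^ p ^ k) i - (a ^ p ^ k) i) +
        (p : W) ^ k * (z - a ^ p ^ k * z - z * x) i := h6
    exact h7 ▸ dvd_add h4 (dvd_mul_right _ _)
  · obtain ⟨z, hz⟩ := hx' 1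
    have := congrArg (CR.map T.red) hz
    rw [map_sub, map_pow, ha, hpow _ (pow_pos hp 1)] at this
    have h0 : CR.map T.red ((p : W) ^ 1 • z) = 0 := by
      ext i
      rw [CR.map_apply, CR.smul_apply, map_mul, map_pow, T.redp]; simp
    rw [h0] at this
    exact (sub_eq_zero.1 this).symm

include T in
lemma vanish (hp : 0 < p) (hspan : Submodule.span K {c : CR F K | c * c = c} = ⊤)
    (f : CR F W →ₗ[W] W) (hf : ∀ c, c * c = c → f c = 0) (x : CR F W) : f x = 0 := by
  have h1 : ∀ y : CR F K, ∃ x : CR F W, f x = 0 ∧ CR.map T.red x = y := by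
    intro y
    have hy : y ∈ Submodule.span K {c : CR F K | c * c = c} := hspan ▸ Submodule.mem_top
    induction hy using Submodule.span_induction with
    | mem c hc =>
      obtain ⟨x, h, h'⟩ := lift_idem T hp c hc
      exact ⟨x, hf x h, h'⟩
    | zero => exact ⟨0, map_zero _, map_zero _⟩
    | add y z _ _ hy hz =>
      obtain ⟨x, h, rfl⟩ := hy
      obtain ⟨w, h', rfl⟩ := hz
      exact ⟨x + w, by rw [map_add, h, h', add_zero], map_add _ _ _⟩
    | smul r y _ hy =>
      obtain ⟨x, h, rfl⟩ := hy
      obtain ⟨s, rfl⟩ := T.surj r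
      exact ⟨s • x, by rw [map_smul, h, smul_zero], CR.ext fun i => by simp⟩
  have h2 : ∀ x, ∃ x', f x = p * f x' := by
    intro x
    obtain ⟨w, hw, hwx⟩ := h1 (CR.map T.red x)
    obtain ⟨y, hy⟩ := CR_ker T (x - w) (by rw [map_sub, hwx, sub_self])
    refine ⟨y, ?_⟩
    have := congrArg f hy
    rw [map_sub, hw, sub_zero, map_smul] at this
    exact this
  refine T.haus _ fun k => ?_
  induction k generalizing x with
  | zero => simp
  | succ k ih =>
    obtain ⟨x', hx'⟩ := h2 x
    rw [hx', pow_succ']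
    exact mul_dvd_mul_left _ (ih x')
end lift
end SDE
end

section
open HopfAlgebra Module Coalgebra Matrix
namespace SDE
section hopf
variable {K H : Type*} [Field K] [Ring H] [HopfAlgebra K H] [FiniteDimensional K H]
local notation "𝒮" => antipode K (A := H)
variable {ι : Type} [Fintype ι] [DecidableEq ι]
  {n : ι → Type} [∀ i, Fintype (n i)] [∀ i, DecidableEq (n i)]
variable {Λ : H} {lam : Dual K H} (hΛ : IsInt (K := K) Λ) (hl : IsCoint lam)
variable (e : H ≃ₐ[K] Π i, Matrix (n i) (n i) K) (o : ∀ i, n i)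

include hΛ hl e in
theorem char_odd_even [IsAlgClosed K] (p : ℕ) [Fact p.Prime] [CharP K p] (h2 : (2 : K) ≠ 0)
    (o : ∀ i, n i) (s : ∀ i, n i → ℤ) (he : IsSE e s)
    {X : Type*} [Fintype X] [DecidableEq X]
    (ρ : H →ₐ[K] Matrix X X K) (h0 : (ρ Λ).rank = 0) (h1 : (tprod ρ ρ Λ).rank = 1) :
    Even (finrank K H) := by
  obtain ⟨r, r', b, hb⟩ := exists_sign_basis h2 (𝒮 ∘ₗ 𝒮) (fun x => antipode_four hΛ hl x)
  have hb : IsSB b := hb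
  have hp : 0 < p := Nat.Prime.pos Fact.out
  obtain ⟨πp, πm, hπ⟩ := exists_pi hΛ hl e o b hb h2
  obtain ⟨W, _, _, _, ⟨T⟩⟩ := exists_wit K p
  haveI := CR_semisimple hΛ hl e o
  obtain ⟨N, d, hd, ⟨g⟩⟩ :=
    IsSemisimpleRing.exists_algEquiv_pi_matrix_of_isAlgClosed K (CR (fus e o) K)
  let q : ∀ E, Fin (d E) := fun E => 0
  have hεex : ∀ E, ∃ x : CR (fus e o) W, x * x = x ∧ CR.map T.red x = mu g E (q E) (q E) :=
    fun E => lift_idem T hp _ (by simp [mu_mul])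
  choose ε hε hεr using hεex
  -- values on idempotents
  have hpsi : ∀ E (c : CR (fus e o) W), c * c = c →
      psi (ε E) c = ((g (CR.map T.red c) E).rank : W) := by
    intro E c hc
    rw [psi_apply, T.trace_idem h2 (Mx c (ε E)) (by rw [Mx_mul, hc, hε]), Mx_map, hεr,
      rank_Mx g E (q E) _ (by rw [← map_mul, hc])]
  have hrank : ∀ {Y : ℕ} (π : CR (fus e o) K →ₐ[K] Matrix (Fin Y) (Fin Y) K)
      (c : CR (fus e o) W), c * c = c →
      ((π (CR.map T.red c)).rank : W) = ∑ E, (cls g q π E : W) * psi (ε E) c := by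
    intro Y π c hc
    rw [rank_rep g q π _ (by rw [← map_mul, hc])]
    push_cast
    exact Finset.sum_congr rfl fun E _ => by rw [hpsi E c hc]
  have hkey : ∀ c : CR (fus e o) W, c * c = c → (((r : ℤ) - r' : ℤ) : W) * CR.tau (thet e Λ) c =
      ((πp (CR.map T.red c)).rank : W) - (πm (CR.map T.red c)).rank := by
    intro c hc
    refine T.eq_of_trunc fun k => ?_
    have := key_trunc hΛ hl e o b hb (T.trunc h2 k) he hp
      (CR.map (Ideal.Quotient.mk (Ideal.span {(p : W) ^ (k + 1)})) c)
      (by rw [← map_mul, hc]) πp πm hπ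
    rw [CR.tau_map] at this
    rw [map_mul, map_intCast, map_sub, map_natCast, map_natCast]
    exact this
  let f : CR (fus e o) W →ₗ[W] W := (((r : ℤ) - r' : ℤ) : W) • CR.tau (thet e Λ) -
    ((∑ E, (cls g q πp E : W) • psi (ε E)) - ∑ E, (cls g q πm E : W) • psi (ε E))
  have hf : ∀ c, f c = (((r : ℤ) - r' : ℤ) : W) * CR.tau (thet e Λ) c -
    ((∑ E, (cls g q πp E : W) * psi (ε E) c) - ∑ E, (cls g q πm E : W) * psi (ε E) c) := by
    intro c
    simp [f, LinearMap.sum_apply]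
  have hfz : ∀ c, f c = 0 := vanish T hp (span_idem g) f (by
    intro c hc
    rw [hf, hkey c hc, hrank πp c hc, hrank πm c hc, sub_self])
  -- pass to the algebraic closure
  let L := AlgebraicClosure (FractionRing W)
  let φ : W →+* L := (algebraMap (FractionRing W) L).comp (algebraMap W (FractionRing W))
  have hφ : Function.Injective φ := (algebraMap (FractionRing W) L).injective.comp
    (IsFractionRing.injective W (FractionRing W))
  haveI : CharZero L := charZero_of_injective_ringHom hφ
  have htr : ∀ c : CR (fus e o) W,
      (∑ E, (cls g q πp E : L) * psi (CR.map φ (ε E)) (CR.map φ c)) -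
      (∑ E, (cls g q πm E : L) * psi (CR.map φ (ε E)) (CR.map φ c)) =
      (((r : ℤ) - r' : ℤ) : L) * CR.tau (thet e Λ) (CR.map φ c) := by
    intro c
    have := congrArg φ (hfz c)
    rw [hf, map_sub, map_sub, map_sum, map_sum, map_zero, map_mul, map_intCast, sub_eq_zero,
      ← CR.tau_map] at this
    rw [this]
    simp only [map_mul, map_natCast, psi_map]
  obtain ⟨P, hP, hP0⟩ : IsIntegral ℤ (rcl e o ℤ ρ) := Algebra.IsIntegral.isIntegral _
  have hx : Polynomial.aeval (rcl e o L ρ) P = 0 := by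
    have := congrArg (CR.map (Int.castRingHom L)) hP0
    rw [Polynomial.hom_eval₂, map_zero, rcl_map] at this
    rw [← this, Polynomial.aeval_def]
    congr 1
    exact RingHom.ext_int _ _
  have hA : ∀ w : Fin N → ℕ, Adm (∑ E, (w E : L) * psi (CR.map φ (ε E)) (rcl e o L ρ))
      (∑ E, (w E : L) * psi (CR.map φ (ε E)) (rcl e o L ρ * rcl e o L ρ)) := by
    intro w
    refine Adm.sum _ _ _ fun E _ => Adm.nat_mul ?_ _
    exact Adm_psi (by rw [← map_mul, hε]) P hP hx
  have htr1 := htr (rcl e o W ρ)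
  have htr2 := htr (rcl e o W (tprod ρ ρ))
  rw [rcl_map] at htr1 htr2
  have hev := Adm.final ((r : ℤ) - r') (hA (cls g q πp)) (hA (cls g q πm))
    (by rw [htr1, tau_rcl _ _ _ hΛ.idem, h0]; simp)
    (by rw [← rcl_tprod, htr2, tau_rcl _ _ _ hΛ.idem, h1]; simp)
  rw [Module.finrank_eq_card_basis b]
  simp only [Fintype.card_sum, Fintype.card_fin]
  have h3 : Even (((r + r' : ℕ) : ℤ)) := by
    push_cast
    have : (r : ℤ) + r' = (r - r') + 2 * r' := by ring
    rw [this]; exact hev.add (even_two_mul _)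
  exact_mod_cast h3

include hΛ hl in
theorem all_even [IsSemisimpleRing H] [IsAlgClosed K] 
    {X : Type*} [Fintype X] [DecidableEq X]
    (ρ : H →ₐ[K] Matrix X X K) (h0 : (ρ Λ).rank = 0) (h1 : (tprod ρ ρ Λ).rank = 1) :
    Even (finrank K H) := by
  obtain ⟨N, d, hd, ⟨e⟩⟩ :=
    IsSemisimpleRing.exists_algEquiv_pi_matrix_of_isAlgClosed K H
  let o : ∀ E, Fin (d E) := fun E => 0
  obtain ⟨p, hp⟩ := CharP.exists K
  rcases CharP.char_is_prime_or_zero K p with hpr | rfl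
  · haveI : Fact p.Prime := ⟨hpr⟩
    by_cases hp2 : p = 2
    · subst hp2
      exact (char_two_false hΛ hl e ρ h0 h1).elim
    · have h2 : (2 : K) ≠ 0 := by
        intro h
        have := (CharP.cast_eq_zero_iff K p 2).1 (by exact_mod_cast h)
        exact hp2 ((Nat.prime_dvd_prime_iff_eq hpr Nat.prime_two).1 this)
      obtain ⟨r, r', e', hne, hs⟩ := exists_signed hΛ hl e h2 o
      exact char_odd_even hΛ hl e' p h2 (fun i => (hne i).some) (fun i => sgn)
        ⟨fun i x => sgn_cases x, hs⟩ ρ h0 h1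
  · haveI := CharP.charP_to_charZero K
    exact char_zero_even hΛ hl e o ρ h0 h1
end hopf
end SDE
end

/-- Let `H` be a semisimple and cosemisimple Hopf algebra over an
algebraically closed field `K` (of arbitrary characteristic).  If `H` has a nontrivial
self-dual simple module, then the dimension of `H` is even.

Cosemisimplicity is expressed as follows: `Hd` is a `K`-algebra, `K`-linearly
isomorphic via `Φ` to the dual space `H* = Hom_K(H, K)`, whose unit is the counit and
whose multiplication corresponds to the convolution product
`(φ * ψ)(h) = φ(h₍₁₎) ψ(h₍₂₎)` (hypotheses `hΦone`, `hΦmul`), and `Hd` is semisimple.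

`V` is a simple `H`-module; its dual `Module.Dual K V` carries the `H`-module
structure `(h • f) v = f (S h • v)` (hypothesis `hdual`); `V` is self-dual and not
isomorphic to the trivial one-dimensional module `K` on which `H` acts through `ε`. -/
theorem self_dual_simple_module_even_dim_cosemisimple
    {K H : Type*} [Field K] [IsAlgClosed K]
    [Ring H] [HopfAlgebra K H] [FiniteDimensional K H]
    [IsSemisimpleRing H]
    -- cosemisimplicity: the dual algebra `Hd` is semisimple
    (Hd : Type*) [Ring Hd] [Algebra K Hd] [IsSemisimpleRing Hd]
    (Φ : Hd ≃ₗ[K] Module.Dual K H)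
    (hΦone : Φ 1 = Coalgebra.counit)
    (hΦmul : ∀ a b : Hd, (Φ (a * b) : Module.Dual K H) =
      LinearMap.mul' K K ∘ₗ TensorProduct.map (Φ a) (Φ b) ∘ₗ Coalgebra.comul)
    -- a nontrivial self-dual simple module
    (V : Type*) [AddCommGroup V] [Module K V] [Module H V]
    [IsScalarTower K H V] [FiniteDimensional K V]
    [IsSimpleModule H V]
    [Module H (Module.Dual K V)]
    (hdual : ∀ (h : H) (f : Module.Dual K V) (v : V),
      (h • f) v = f (antipode (R := K) h • v))
    (hselfdual : Nonempty (V ≃ₗ[H] Module.Dual K V))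
    (hnontrivial : IsEmpty (V ≃ₗ[H] K)) :
    Even (Module.finrank K H) := by
  obtain ⟨Λ, hΛ⟩ := SDE.exists_isInt (K := K) (H := H)
  obtain ⟨lam, hl⟩ := SDE.exists_isCoint Hd Φ hΦone hΦmul
  obtain ⟨φ⟩ := hselfdual
  have hnt : ∀ v : V, (∀ h : H, h • v = Coalgebra.counit (R := K) h • v) → v = 0 := by
    intro v hv
    by_contra hv0
    let f : K →ₗ[H] V :=
      { toFun := fun c => c • v
        map_add' := fun x y => add_smul x y v
        map_smul' := fun h c => by
          change (Coalgebra.counit (R := K) h * c) • v = h • c • v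
          have h1 : h • c • v = c • h • v := by
            rw [← algebraMap_smul H c v, ← algebraMap_smul H c (h • v), ← mul_smul, ← mul_smul,
              Algebra.commutes]
          rw [h1, hv h, smul_smul, mul_comm] }
    have hinj : Function.Injective f := fun x y hxy => smul_left_injective K hv0 hxy
    have hsur : Function.Surjective f := by
      rw [← LinearMap.range_eq_top]
      refine (eq_bot_or_eq_top (LinearMap.range f)).resolve_left fun hbot => hv0 ?_
      have h1 : f 1 ∈ LinearMap.range f := ⟨1, rfl⟩
      rw [hbot, Submodule.mem_bot] at h1
      rw [← one_smul K v]
      exact h1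
    exact hnontrivial.false (LinearEquiv.ofBijective f ⟨hinj, hsur⟩).symm
  obtain ⟨d, ρ, h0, h1⟩ := SDE.exists_VX hΛ hl V hdual φ hnt
  exact SDE.all_even hΛ hl ρ h0 h1
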